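/- Fix ℓ ≥ 3 and λ ∈ (0,1/2), let W be an (ℓ,λ)-graph statistic with the edge indicators drawn from G(n,m), p = m/C(n,2) ∈ (λ,1−λ), and let 𝒦 = (W − W_0 − W_2)/σ be its normalized version. Then for every ε > 0 there exist constants c, C > 0 depending only on ℓ, λ and ε such that for all n ≥ 3, all admissible m, and all t ∈ ℝ with n^{ε} ≤ |t| ≤ σ·n^{−ε}: |E[exp(it·𝒦)] − exp(−t²/2)| ≤ C·n^{−c·log log n}. -/

import Mathlib

open MeasureTheory ProbabilityTheory
open scoped ENNReal NNReal

noncomputable section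

/-- The uniform probability measure on a subset of a finite type. -/
def finUniform {γ : Type*} [Fintype γ] [MeasurableSpace γ] (s : Set γ) : Measure γ :=
  (Nat.card s : ℝ≥0∞)⁻¹ • ∑ a : γ, s.indicator (fun _ => (1 : ℝ≥0∞)) a • Measure.dirac a

/-- The product Bernoulli(p) measure on `ι → Bool`. -/
def bernoulliPi (ι : Type*) [Fintype ι] [DecidableEq ι] (p : ℝ) : Measure (ι → Bool) :=
  ∑ x : ι → Bool, (∏ i : ι, ENNReal.ofReal (if x i then p else 1 - p)) • Measure.dirac x

/-- The Erdős–Rényi G(n,p) measure, as a measure on edge-indicator functions. -/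
def gnp (n : ℕ) (p : ℝ) : Measure (Sym2 (Fin n) → Bool) := bernoulliPi _ p

/-- The G(n,m) measure: uniform over edge-indicator functions with exactly `m` edges
(diagonal coordinates forced to `false`). -/
def gnm (n m : ℕ) : Measure (Sym2 (Fin n) → Bool) :=
  finUniform {x | (∀ e : Sym2 (Fin n), e.IsDiag → x e = false) ∧
    (Finset.univ.filter fun e : Sym2 (Fin n) => x e = true).card = m}

open Classical in
/-- The graph factor `γ_H(x) = Σ_{E ≅ H} Π_{e ∈ E} χ_e`, where
`χ_e = (x_e − p)/√(p(1−p))`, and the sum is over edge sets `E` spanning a copy of `H`. -/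
def graphFactor {β : Type*} [Fintype β] (H : SimpleGraph β) (p : ℝ) {n : ℕ}
    (x : Sym2 (Fin n) → Bool) : ℝ :=
  ∑ E : Finset (Sym2 (Fin n)),
    if ∃ f : β ↪ Fin n, (↑E : Set (Sym2 (Fin n))) = Sym2.map f '' H.edgeSet then
      ∏ e ∈ E, (((if x e then (1 : ℝ) else 0) - p) / Real.sqrt (p * (1 - p)))
    else 0

/-- The `(ℓ,λ)`-graph statistic `W = Σ_{H ∈ ℋ} n^{ℓ−v(H)} Δ_H γ_H(x)`, where graphs on at
most `ℓ` vertices with no isolated vertices are represented as graphs on `Fin ℓ` padded with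
isolated vertices, and `v(H) = Nat.card H.support` is the number of non-isolated vertices. -/
def graphStat (ℓ : ℕ) (ℋ : Finset (SimpleGraph (Fin ℓ))) (Δ : SimpleGraph (Fin ℓ) → ℝ)
    (p : ℝ) {n : ℕ} (x : Sym2 (Fin n) → Bool) : ℝ :=
  ∑ G ∈ ℋ, (n : ℝ) ^ (ℓ - Nat.card G.support) * Δ G * graphFactor G p x

/-- The order-`k` portion `W_k` of an `(ℓ,λ)`-graph statistic: the terms with `v(H) = k`. -/
def graphStatPart (ℓ : ℕ) (ℋ : Finset (SimpleGraph (Fin ℓ))) (Δ : SimpleGraph (Fin ℓ) → ℝ)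
    (p : ℝ) (kk : ℕ) {n : ℕ} (x : Sym2 (Fin n) → Bool) : ℝ :=
  ∑ G ∈ ℋ.filter fun G => Nat.card G.support = kk,
    (n : ℝ) ^ (ℓ - Nat.card G.support) * Δ G * graphFactor G p x

/-- The data of an `(ℓ,λ)`-factor system: `ℋ` is a set of pairwise non-isomorphic graphs
(with no isolated vertices, padded to `Fin ℓ`), `ℋ' ⊆ ℋ` contains a connected graph on `k`
vertices for every `3 ≤ k ≤ ℓ`, and the coefficients satisfy `|Δ_H| ≤ 1/λ` on `ℋ` and
`|Δ_H| ≥ λ` on `ℋ'`. -/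
def IsFactorSystem (ℓ : ℕ) (lam : ℝ) (ℋ ℋ' : Finset (SimpleGraph (Fin ℓ)))
    (Δ : SimpleGraph (Fin ℓ) → ℝ) : Prop :=
  ℋ' ⊆ ℋ ∧
  (∀ G₁ ∈ ℋ, ∀ G₂ ∈ ℋ, Nonempty (G₁ ≃g G₂) → G₁ = G₂) ∧
  (∀ kk : ℕ, 3 ≤ kk → kk ≤ ℓ →
    ∃ G ∈ ℋ', (G.induce G.support).Connected ∧ Nat.card G.support = kk) ∧
  (∀ G ∈ ℋ, |Δ G| ≤ 1 / lam) ∧ (∀ G ∈ ℋ', lam ≤ |Δ G|)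

end

set_option linter.unusedSectionVars false
set_option linter.unusedSimpArgs false
set_option linter.unusedVariables false

namespace GS

/-! Basic finite product probability -/

noncomputable def wt (p : ℝ) (b : Bool) : ℝ := if b then p else 1 - p

noncomputable def WW {ι : Type*} [Fintype ι] (p : ℝ) (x : ι → Bool) : ℝ := ∏ i, wt p (x i)

noncomputable def Ex {ι : Type*} [Fintype ι] [DecidableEq ι] {E : Type*} [AddCommGroup E]
    [Module ℝ E] (p : ℝ) (f : (ι → Bool) → E) : E := ∑ x, WW p x • f x

def mix {ι : Type*} (P : ι → Prop) [DecidablePred P] (x' x : ι → Bool) : ι → Bool :=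
  fun i => if P i then x' i else x i

section basics
variable {ι : Type*} [Fintype ι] [DecidableEq ι] {E : Type*} [AddCommGroup E] [Module ℝ E]
variable {p : ℝ}

lemma wt_sum : ∑ b, wt p b = 1 := by simp [wt]

lemma wt_nonneg (h0 : 0 ≤ p) (h1 : p ≤ 1) (b : Bool) : 0 ≤ wt p b := by
  unfold wt; split <;> linarith

lemma WW_nonneg (h0 : 0 ≤ p) (h1 : p ≤ 1) (x : ι → Bool) : 0 ≤ WW p x :=
  Finset.prod_nonneg fun _ _ => wt_nonneg h0 h1 _

lemma sum_prod_fun (g : ι → Bool → ℝ) :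
    ∑ x : ι → Bool, ∏ i, g i (x i) = ∏ i, ∑ b, g i b := by
  rw [Finset.prod_univ_sum]
  simp only [Fintype.piFinset_univ]

lemma WW_sum : ∑ x : ι → Bool, WW p x = 1 := by
  unfold WW
  rw [sum_prod_fun (fun _ b => wt p b)]
  simp only [wt_sum, Finset.prod_const_one]

lemma Ex_add (f g : (ι → Bool) → E) : Ex p (fun x => f x + g x) = Ex p f + Ex p g := by
  simp [Ex, Finset.sum_add_distrib]

lemma Ex_sub (f g : (ι → Bool) → E) : Ex p (fun x => f x - g x) = Ex p f - Ex p g := by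
  simp [Ex, Finset.sum_sub_distrib, smul_sub]

lemma Ex_smul (c : ℝ) (f : (ι → Bool) → E) : Ex p (fun x => c • f x) = c • Ex p f := by
  simp [Ex, Finset.smul_sum, smul_comm c]

lemma Ex_mul_left (c : ℝ) (f : (ι → Bool) → ℝ) : Ex p (fun x => c * f x) = c * Ex p f :=
  Ex_smul c f

lemma Ex_cmul_left (c : ℂ) (f : (ι → Bool) → ℂ) : Ex p (fun x => c * f x) = c * Ex p f := by
  simp [Ex, Finset.mul_sum, mul_left_comm]

lemma Ex_sum {α : Type*} (s : Finset α) (f : α → (ι → Bool) → E) :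
    Ex p (fun x => ∑ a ∈ s, f a x) = ∑ a ∈ s, Ex p (f a) := by
  simp only [Ex, Finset.smul_sum]; rw [Finset.sum_comm]

lemma Ex_const (c : E) : Ex (ι := ι) p (fun _ => c) = c := by
  simp [Ex, ← Finset.sum_smul, WW_sum]

lemma Ex_mono (h0 : 0 ≤ p) (h1 : p ≤ 1) {f g : (ι → Bool) → ℝ} (h : ∀ x, f x ≤ g x) :
    Ex p f ≤ Ex p g :=
  Finset.sum_le_sum fun x _ => mul_le_mul_of_nonneg_left (h x) (WW_nonneg h0 h1 x)

lemma Ex_nonneg (h0 : 0 ≤ p) (h1 : p ≤ 1) {f : (ι → Bool) → ℝ} (h : ∀ x, 0 ≤ f x) :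
    0 ≤ Ex p f :=
  Finset.sum_nonneg fun x _ => mul_nonneg (WW_nonneg h0 h1 x) (h x)

lemma Ex_norm_le (h0 : 0 ≤ p) (h1 : p ≤ 1) (f : (ι → Bool) → ℂ) :
    ‖Ex p f‖ ≤ Ex p (fun x => ‖f x‖) := by
  refine (norm_sum_le _ _).trans (Finset.sum_le_sum fun x _ => ?_)
  rw [norm_smul, Real.norm_of_nonneg (WW_nonneg h0 h1 x)]; rfl

lemma Ex_ofReal (f : (ι → Bool) → ℝ) : Ex p (fun x => (f x : ℂ)) = ((Ex p f : ℝ) : ℂ) := by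
  simp [Ex]

lemma mix_swap (P : ι → Prop) [DecidablePred P] (F : (ι → Bool) → E) :
    Ex p (fun x => Ex p (fun x' => F (mix P x' x))) = Ex p F := by
  have key : ∀ x x' : ι → Bool,
      WW p x * WW p x' = WW p (mix P x' x) * WW p (mix P x x') := by
    intro x x'
    unfold WW
    rw [← Finset.prod_mul_distrib, ← Finset.prod_mul_distrib]
    refine Finset.prod_congr rfl fun i _ => ?_
    unfold mix; split <;> ring
  have h1 : Ex p (fun x => Ex p (fun x' => F (mix P x' x))) =
      ∑ q : (ι → Bool) × (ι → Bool), (WW p q.1 * WW p q.2) • F (mix P q.2 q.1) := by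
    rw [Fintype.sum_prod_type]
    simp only [Ex, Finset.smul_sum, smul_smul]
  let e : ((ι → Bool) × (ι → Bool)) ≃ ((ι → Bool) × (ι → Bool)) :=
    { toFun := fun q => (mix P q.2 q.1, mix P q.1 q.2)
      invFun := fun q => (mix P q.2 q.1, mix P q.1 q.2)
      left_inv := by
        rintro ⟨x, y⟩; ext i <;> simp only [mix] <;> split <;> rfl
      right_inv := by
        rintro ⟨x, y⟩; ext i <;> simp only [mix] <;> split <;> rfl }
  have h2 : (∑ q : (ι → Bool) × (ι → Bool), (WW p q.1 * WW p q.2) • F (mix P q.2 q.1)) =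
      ∑ q : (ι → Bool) × (ι → Bool), (WW p q.1 * WW p q.2) • F q.1 := by
    refine Fintype.sum_equiv e _ _ ?_
    rintro ⟨x, y⟩
    simp only [e, Equiv.coe_fn_mk]
    rw [key]
  rw [h1, h2, Fintype.sum_prod_type]
  simp only [Ex, ← Finset.sum_smul, ← Finset.mul_sum, WW_sum, mul_one]

lemma Ex_indep_real (P : ι → Prop) [DecidablePred P] (F G : (ι → Bool) → ℝ)
    (hF : ∀ x y, (∀ i, P i → x i = y i) → F x = F y)
    (hG : ∀ x y, (∀ i, ¬ P i → x i = y i) → G x = G y) :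
    Ex p (fun x => F x * G x) = Ex p F * Ex p G := by
  rw [← mix_swap P]
  have : ∀ x x', F (mix P x' x) * G (mix P x' x) = G x * F x' := by
    intro x x'
    rw [hF (mix P x' x) x' (fun i hi => by simp [mix, hi]),
      hG (mix P x' x) x (fun i hi => by simp [mix, hi]), mul_comm]
  simp only [this, Ex_mul_left]
  simp only [mul_comm _ (Ex p F), Ex_mul_left]

lemma Ex_indep (P : ι → Prop) [DecidablePred P] (F G : (ι → Bool) → ℂ)
    (hF : ∀ x y, (∀ i, P i → x i = y i) → F x = F y)
    (hG : ∀ x y, (∀ i, ¬ P i → x i = y i) → G x = G y) :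
    Ex p (fun x => F x * G x) = Ex p F * Ex p G := by
  rw [← mix_swap P]
  have : ∀ x x', F (mix P x' x) * G (mix P x' x) = G x * F x' := by
    intro x x'
    rw [hF (mix P x' x) x' (fun i hi => by simp [mix, hi]),
      hG (mix P x' x) x (fun i hi => by simp [mix, hi]), mul_comm]
  simp only [this, Ex_cmul_left]
  simp only [mul_comm _ (Ex p F), Ex_cmul_left]

end basics

/-! Characters -/

noncomputable def ch (p : ℝ) (b : Bool) : ℝ := ((if b then (1 : ℝ) else 0) - p) / Real.sqrt (p * (1 - p))

noncomputable def mon {ι : Type*} (p : ℝ) (U : Finset ι) (x : ι → Bool) : ℝ := ∏ i ∈ U, ch p (x i)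

section chars
variable {ι : Type*} [Fintype ι] [DecidableEq ι] {p : ℝ}

lemma sqrt_pos' (h0 : 0 < p) (h1 : p < 1) : 0 < Real.sqrt (p * (1 - p)) :=
  Real.sqrt_pos.2 (mul_pos h0 (by linarith))

lemma ch_mean : ∑ b, wt p b * ch p b = 0 := by
  simp [wt, ch]; ring

lemma ch_sq (h0 : 0 < p) (h1 : p < 1) : ∑ b, wt p b * (ch p b * ch p b) = 1 := by
  have h := sqrt_pos' h0 h1
  have h2 : Real.sqrt (p * (1 - p)) ^ 2 = p * (1 - p) :=
    Real.sq_sqrt (mul_pos h0 (by linarith)).le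
  simp [wt, ch]
  field_simp
  rw [h2]; ring

lemma ch_quad (h0 : 0 < p) (h1 : p < 1) (b : Bool) :
    ch p b * ch p b = 1 + (1 - 2 * p) / Real.sqrt (p * (1 - p)) * ch p b := by
  have h := sqrt_pos' h0 h1
  have h2 : Real.sqrt (p * (1 - p)) ^ 2 = p * (1 - p) :=
    Real.sq_sqrt (mul_pos h0 (by linarith)).le
  cases b <;> simp [ch] <;> field_simp <;> rw [h2] <;> ring

lemma ch_abs_le {lam : ℝ} (hl : 0 < lam) (h0 : lam < p) (h1 : p < 1 - lam) (b : Bool) :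
    |ch p b| ≤ 1 / lam := by
  have h2 : lam ≤ Real.sqrt (p * (1 - p)) := by
    apply Real.le_sqrt_of_sq_le
    nlinarith
  have h3 : |(if b then (1 : ℝ) else 0) - p| ≤ 1 := by
    rw [abs_le]; split <;> constructor <;> linarith
  unfold ch
  rw [abs_div, abs_of_nonneg (Real.sqrt_nonneg _)]
  exact div_le_div₀ zero_le_one h3 hl h2

lemma mon_abs_le {B : ℝ} (hB : ∀ b, |ch p b| ≤ B) (U : Finset ι) (x : ι → Bool) :
    |mon p U x| ≤ B ^ U.card := by
  unfold mon
  rw [Finset.abs_prod]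
  calc _ ≤ ∏ i ∈ U, B := Finset.prod_le_prod (fun _ _ => abs_nonneg _) fun _ _ => hB _
    _ = _ := by simp

lemma mon_dep (U : Finset ι) (x y : ι → Bool) (h : ∀ i ∈ U, x i = y i) :
    mon p U x = mon p U y := Finset.prod_congr rfl fun i hi => by rw [h i hi]

lemma Ex_prod (g : ι → Bool → ℝ) :
    Ex p (fun x : ι → Bool => ∏ i, g i (x i)) = ∏ i, ∑ b, wt p b * g i b := by
  unfold Ex WW
  simp only [smul_eq_mul, ← Finset.prod_mul_distrib]
  exact sum_prod_fun (fun i b => wt p b * g i b)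

lemma mon_eq_univ (U : Finset ι) (x : ι → Bool) :
    mon p U x = ∏ i, (if i ∈ U then ch p (x i) else 1) := by
  unfold mon
  rw [Finset.prod_ite_mem]; simp

lemma Ex_mon_mul (h0 : 0 < p) (h1 : p < 1) (U V : Finset ι) :
    Ex p (fun x => mon p U x * mon p V x) = if U = V then 1 else 0 := by
  simp only [mon_eq_univ, ← Finset.prod_mul_distrib]
  rw [Ex_prod (fun i b => (if i ∈ U then ch p b else 1) * (if i ∈ V then ch p b else 1))]
  split_ifs with h
  · subst h
    refine Finset.prod_eq_one fun i _ => ?_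
    by_cases hi : i ∈ U
    · simpa only [hi, if_true] using ch_sq h0 h1
    · simpa only [hi, if_false, mul_one] using wt_sum
  · obtain ⟨i, hi⟩ : ∃ i, ¬ (i ∈ U ↔ i ∈ V) := by
      by_contra hc; push Not at hc; exact h (Finset.ext hc)
    refine Finset.prod_eq_zero (Finset.mem_univ i) ?_
    by_cases hU : i ∈ U
    · have hV : i ∉ V := fun hV => hi ⟨fun _ => hV, fun _ => hU⟩
      simpa only [hU, hV, if_true, if_false, mul_one] using ch_mean
    · have hV : i ∈ V := by by_contra hV; exact hi ⟨fun h => absurd h hU, fun h => absurd h hV⟩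
      simpa only [hU, hV, if_true, if_false, one_mul] using ch_mean

lemma Ex_mon (h0 : 0 < p) (h1 : p < 1) (U : Finset ι) (hU : U.Nonempty) :
    Ex p (fun x => mon p U x) = 0 := by
  have := Ex_mon_mul h0 h1 U ∅
  simpa [mon, hU.ne_empty] using this

lemma parseval (h0 : 0 < p) (h1 : p < 1) {α : Type*} (s : Finset α) (a : α → ℝ)
    (U : α → Finset ι) (hU : Set.InjOn U s) :
    Ex p (fun x => (∑ m ∈ s, a m * mon p (U m) x) ^ 2) = ∑ m ∈ s, a m ^ 2 := by
  classical
  have : ∀ x : ι → Bool, (∑ m ∈ s, a m * mon p (U m) x) ^ 2 =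
      ∑ m ∈ s, ∑ m' ∈ s, (a m * a m') * (mon p (U m) x * mon p (U m') x) := by
    intro x
    rw [sq, Finset.sum_mul_sum]
    exact Finset.sum_congr rfl fun _ _ => Finset.sum_congr rfl fun _ _ => by ring
  simp only [this, Ex_sum, Ex_mul_left, Ex_mon_mul h0 h1]
  refine Finset.sum_congr rfl fun m hm => ?_
  rw [Finset.sum_eq_single m]
  · simp [sq]
  · intro b hb hne
    have : U m ≠ U b := fun h => hne (hU hm hb h).symm
    simp [this]
  · exact fun h => absurd hm h

/-- (2,4) hypercontractivity -/
lemma hyper_aux (h0 : 0 < p) (h1 : p < 1) {B : ℝ} (hB : ∀ b, |ch p b| ≤ B)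
    (c : Finset ι → ℝ) (T : Finset ι) :
    Ex p (fun x => (∑ U ∈ T.powerset, c U * mon p U x) ^ 4) ≤
      (∑ U ∈ T.powerset, (3 + B) ^ U.card * c U ^ 2) ^ 2 := by
  have hB0 : 0 ≤ B := (abs_nonneg _).trans (hB true)
  induction T using Finset.induction_on generalizing c with
  | empty => simp [mon, Ex_const]; ring_nf; rfl
  | insert i T hi ih =>
    set g : (ι → Bool) → ℝ := fun x => ∑ U ∈ T.powerset, c U * mon p U x with hg
    set h : (ι → Bool) → ℝ := fun x => ∑ U ∈ T.powerset, c (insert i U) * mon p U x with hh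
    have hsplit : ∀ x, ∑ U ∈ (insert i T).powerset, c U * mon p U x = g x + ch p (x i) * h x := by
      intro x
      rw [Finset.sum_powerset_insert hi, hg, hh, Finset.mul_sum]
      congr 1
      refine Finset.sum_congr rfl fun U hU => ?_
      have : i ∉ U := fun hh => hi (Finset.mem_powerset.1 hU hh)
      rw [mon, Finset.prod_insert this, mon]; ring
    have hsplit2 : ∑ U ∈ (insert i T).powerset, (3 + B) ^ U.card * c U ^ 2 =
        (∑ U ∈ T.powerset, (3 + B) ^ U.card * c U ^ 2) +
        (3 + B) * ∑ U ∈ T.powerset, (3 + B) ^ U.card * c (insert i U) ^ 2 := by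
      rw [Finset.sum_powerset_insert hi, Finset.mul_sum]
      congr 1
      refine Finset.sum_congr rfl fun U hU => ?_
      have : i ∉ U := fun hh => hi (Finset.mem_powerset.1 hU hh)
      rw [Finset.card_insert_of_notMem this]; ring
    have ihg := ih c
    have ihh := ih (fun U => c (insert i U))
    simp only [hsplit, hsplit2]
    set A := ∑ U ∈ T.powerset, (3 + B) ^ U.card * c U ^ 2
    set H := ∑ U ∈ T.powerset, (3 + B) ^ U.card * c (insert i U) ^ 2
    have hA : 0 ≤ A := Finset.sum_nonneg fun _ _ => by positivity
    have hH : 0 ≤ H := Finset.sum_nonneg fun _ _ => by positivity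
    have gdep : ∀ x y : ι → Bool, (∀ j, ¬ j = i → x j = y j) → g x = g y := by
      intro x y hxy
      refine Finset.sum_congr rfl fun U hU => ?_
      rw [mon_dep U x y fun j hj => hxy j fun hji => hi (Finset.mem_powerset.1 hU (hji ▸ hj))]
    have hdep : ∀ x y : ι → Bool, (∀ j, ¬ j = i → x j = y j) → h x = h y := by
      intro x y hxy
      refine Finset.sum_congr rfl fun U hU => ?_
      rw [mon_dep U x y fun j hj => hxy j fun hji => hi (Finset.mem_powerset.1 hU (hji ▸ hj))]
    have e1 : ∀ k : ℕ, Ex p (fun x : ι → Bool => ch p (x i) ^ k) = ∑ b, wt p b * ch p b ^ k := by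
      intro k
      have := Ex_prod (ι := ι) (p := p) (fun j b => if j = i then ch p b ^ k else 1)
      simp only [Finset.prod_ite_eq', Finset.mem_univ, if_true] at this
      rw [this]
      rw [Finset.prod_eq_single i]
      · simp
      · intro b _ hb; simpa only [hb, if_false, mul_one] using wt_sum
      · simp
    have ind : ∀ (k : ℕ) (F : ℝ → ℝ → ℝ), Ex p (fun x => ch p (x i) ^ k * F (g x) (h x)) =
        (∑ b, wt p b * ch p b ^ k) * Ex p (fun x => F (g x) (h x)) := by
      intro k F
      rw [← e1]
      refine Ex_indep_real (fun j => j = i) (fun x => ch p (x i) ^ k) (fun x => F (g x) (h x)) ?_ ?_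
      · intro x y hxy; simp only [hxy i rfl]
      · intro x y hxy; simp only [gdep x y hxy, hdep x y hxy]
    have m1 : ∑ b, wt p b * ch p b ^ 1 = 0 := by simpa only [pow_one] using ch_mean
    have m2 : ∑ b, wt p b * ch p b ^ 2 = 1 := by simpa only [pow_two] using ch_sq h0 h1
    have m3 : |∑ b, wt p b * ch p b ^ 3| ≤ B := by
      calc |∑ b, wt p b * ch p b ^ 3| ≤ ∑ b, |wt p b * ch p b ^ 3| := Finset.abs_sum_le_sum_abs _ _
        _ ≤ ∑ b, B * (wt p b * ch p b ^ 2) := by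
          refine Finset.sum_le_sum fun b _ => ?_
          rw [abs_mul, abs_of_nonneg (wt_nonneg h0.le h1.le b), abs_pow]
          have := hB b
          have hw := wt_nonneg h0.le h1.le b
          rw [← sq_abs (ch p b)]
          have h5 : |ch p b| ^ 3 ≤ B * |ch p b| ^ 2 := by
            rw [pow_succ']; exact mul_le_mul_of_nonneg_right this (by positivity)
          nlinarith
        _ = B := by rw [← Finset.mul_sum, m2, mul_one]
    have m4 : ∑ b, wt p b * ch p b ^ 4 ≤ B ^ 2 := by
      calc ∑ b, wt p b * ch p b ^ 4 ≤ ∑ b, B ^ 2 * (wt p b * ch p b ^ 2) := by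
            refine Finset.sum_le_sum fun b _ => ?_
            have hw := wt_nonneg h0.le h1.le b
            have h5 : ch p b ^ 2 ≤ B ^ 2 := sq_le_sq' (by linarith [abs_le.1 (hB b)]) (abs_le.1 (hB b)).2
            have : ch p b ^ 4 ≤ B ^ 2 * ch p b ^ 2 := by nlinarith [sq_nonneg (ch p b)]
            nlinarith
        _ = B ^ 2 := by rw [← Finset.mul_sum, m2, mul_one]
    have expand : Ex p (fun x => (g x + ch p (x i) * h x) ^ 4) =
        Ex p (fun x => g x ^ 4) + 6 * Ex p (fun x => g x ^ 2 * h x ^ 2)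
        + (∑ b, wt p b * ch p b ^ 3) * (4 * Ex p (fun x => g x * h x ^ 3))
        + (∑ b, wt p b * ch p b ^ 4) * Ex p (fun x => h x ^ 4) := by
      have : ∀ x : ι → Bool, (g x + ch p (x i) * h x) ^ 4 =
          g x ^ 4 + ch p (x i) ^ 1 * (4 * (g x ^ 3 * h x)) + ch p (x i) ^ 2 * (6 * (g x ^ 2 * h x ^ 2))
            + ch p (x i) ^ 3 * (4 * (g x * h x ^ 3)) + ch p (x i) ^ 4 * h x ^ 4 := by
        intro x; ring
      simp only [this, Ex_add]
      rw [ind 1 (fun a b => 4 * (a ^ 3 * b)), ind 2 (fun a b => 6 * (a ^ 2 * b ^ 2)),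
        ind 3 (fun a b => 4 * (a * b ^ 3)), ind 4 (fun a b => b ^ 4), m1, m2]
      simp only [Ex_mul_left]; ring
    have g4 : 0 ≤ Ex p (fun x => g x ^ 4) := Ex_nonneg h0.le h1.le fun x => by positivity
    have hh4 : 0 ≤ Ex p (fun x => h x ^ 4) := Ex_nonneg h0.le h1.le fun x => by positivity
    set G4 := Ex p (fun x => g x ^ 4)
    set H4 := Ex p (fun x => h x ^ 4)
    have cs : Ex p (fun x => g x ^ 2 * h x ^ 2) ≤ A * H := by
      have c1 : Ex p (fun x => g x ^ 2 * h x ^ 2) ^ 2 ≤ G4 * H4 := by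
        have := Finset.sum_mul_sq_le_sq_mul_sq Finset.univ
          (fun x : ι → Bool => Real.sqrt (WW p x) * g x ^ 2) (fun x => Real.sqrt (WW p x) * h x ^ 2)
        have w : ∀ x : ι → Bool, Real.sqrt (WW p x) * Real.sqrt (WW p x) = WW p x :=
          fun x => Real.mul_self_sqrt (WW_nonneg h0.le h1.le x)
        calc _ = _ := ?_
          _ ≤ _ := this
          _ = _ := ?_
        · congr 1; refine Finset.sum_congr rfl fun x _ => ?_
          rw [smul_eq_mul]; conv_lhs => rw [← w x]
          ring
        · congr 1 <;>
          · refine Finset.sum_congr rfl fun x _ => ?_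
            rw [smul_eq_mul]; conv_rhs => rw [← w x]
            ring
      have c2 : G4 * H4 ≤ (A * H) ^ 2 := by
        rw [mul_pow]; exact mul_le_mul ihg ihh hh4 (by positivity)
      exact abs_le_of_sq_le_sq' (c1.trans c2) (by positivity) |>.2
    have gh3 : |Ex p (fun x => g x * h x ^ 3)| ≤ (A * H + H ^ 2) / 2 := by
      have q : ∀ x, |g x * h x ^ 3| ≤ (g x ^ 2 * h x ^ 2 + h x ^ 4) / 2 := by
        intro x
        rw [abs_le]; constructor
        · nlinarith [mul_nonneg (sq_nonneg (h x)) (sq_nonneg (g x + h x))]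
        · nlinarith [mul_nonneg (sq_nonneg (h x)) (sq_nonneg (g x - h x))]
      have q2 : |Ex p (fun x => g x * h x ^ 3)| ≤ Ex p (fun x => (1/2 : ℝ) * (g x ^ 2 * h x ^ 2 + h x ^ 4)) := by
        refine (Finset.abs_sum_le_sum_abs _ _).trans (Finset.sum_le_sum fun x _ => ?_)
        rw [smul_eq_mul, abs_mul, abs_of_nonneg (WW_nonneg h0.le h1.le x), smul_eq_mul]
        refine mul_le_mul_of_nonneg_left ?_ (WW_nonneg h0.le h1.le x)
        linarith [q x]
      rw [Ex_mul_left, Ex_add] at q2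
      have : H4 ≤ H ^ 2 := ihh
      linarith
    rw [expand]
    have t3 : (∑ b, wt p b * ch p b ^ 3) * (4 * Ex p (fun x => g x * h x ^ 3)) ≤
        B * (2 * (A * H + H ^ 2)) := by
      refine (le_abs_self _).trans ?_
      rw [abs_mul, abs_mul]
      have : |(4 : ℝ)| = 4 := by norm_num
      rw [this]
      exact mul_le_mul m3 (by linarith) (by positivity) hB0
    have t4 : (∑ b, wt p b * ch p b ^ 4) * H4 ≤ B ^ 2 * H ^ 2 :=
      mul_le_mul m4 ihh hh4 (by positivity)
    have ihg' : G4 ≤ A ^ 2 := ihg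
    have hAH : 0 ≤ A * H := mul_nonneg hA hH
    nlinarith [mul_nonneg hB0 hAH, mul_nonneg hB0 (sq_nonneg H), sq_nonneg H]

end chars

end GS

set_option linter.unusedSectionVars false
set_option linter.unusedSimpArgs false
set_option linter.unusedVariables false

namespace GS

section degree
variable {ι : Type*} [Fintype ι] [DecidableEq ι] {p : ℝ}

/-- functions of degree at most d -/
def PD (p : ℝ) (d : ℕ) : Submodule ℝ ((ι → Bool) → ℝ) :=
  Submodule.span ℝ {f | ∃ U : Finset ι, U.card ≤ d ∧ f = mon p U}

lemma PD_mono {d e : ℕ} (h : d ≤ e) : PD (ι := ι) p d ≤ PD p e := by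
  refine Submodule.span_mono ?_
  rintro f ⟨U, hU, rfl⟩
  exact ⟨U, hU.trans h, rfl⟩

lemma mon_mem (U : Finset ι) {d : ℕ} (h : U.card ≤ d) : mon p U ∈ PD (ι := ι) p d :=
  Submodule.subset_span ⟨U, h, rfl⟩

lemma ch_mul_mem (h0 : 0 < p) (h1 : p < 1) (i : ι) {d : ℕ} {f : (ι → Bool) → ℝ}
    (hf : f ∈ PD p d) : (fun x => ch p (x i) * f x) ∈ PD p (d + 1) := by
  induction hf using Submodule.span_induction with
  | mem f hf =>
    obtain ⟨U, hU, rfl⟩ := hf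
    by_cases hi : i ∈ U
    · have e : (fun x : ι → Bool => ch p (x i) * mon p U x) =
          mon p (U.erase i) + ((1 - 2 * p) / Real.sqrt (p * (1 - p))) • mon p U := by
        funext x
        have : mon p U x = ch p (x i) * mon p (U.erase i) x := by
          unfold mon; rw [Finset.mul_prod_erase U (fun j => ch p (x j)) hi]
        simp only [Pi.add_apply, Pi.smul_apply, smul_eq_mul, this]
        rw [← mul_assoc, ch_quad h0 h1]; ring
      rw [e]
      refine Submodule.add_mem _ (mon_mem _ ?_) (Submodule.smul_mem _ _ (mon_mem _ (by omega)))
      exact (Finset.card_erase_le).trans (by omega)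
    · have e : (fun x : ι → Bool => ch p (x i) * mon p U x) = mon p (insert i U) := by
        funext x; unfold mon; rw [Finset.prod_insert hi]
      rw [e]
      exact mon_mem _ ((Finset.card_insert_le _ _).trans (by omega))
  | zero =>
    have : (fun x => ch p (x i) * (0 : (ι → Bool) → ℝ) x) = 0 := by funext x; simp
    rw [this]; exact Submodule.zero_mem _
  | add f g _ _ hf hg =>
    have : (fun x => ch p (x i) * (f + g) x) = (fun x => ch p (x i) * f x) + fun x => ch p (x i) * g x := by
      funext x; simp [mul_add]
    rw [this]; exact Submodule.add_mem _ hf hg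
  | smul c f _ hf =>
    have : (fun x => ch p (x i) * (c • f) x) = c • (fun x => ch p (x i) * f x) := by
      funext x; simp; ring
    rw [this]; exact Submodule.smul_mem _ _ hf

lemma mon_mul_mem (h0 : 0 < p) (h1 : p < 1) (V : Finset ι) {d : ℕ} {f : (ι → Bool) → ℝ}
    (hf : f ∈ PD p d) : (mon p V * f) ∈ PD p (d + V.card) := by
  induction V using Finset.induction_on with
  | empty =>
    have : mon p (∅ : Finset ι) * f = f := by funext x; simp [mon]
    rw [this]; simpa using hf
  | insert i V hi ih =>
    have : mon p (insert i V) * f = fun x => ch p (x i) * (mon p V * f) x := by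
      funext x; simp only [Pi.mul_apply, mon]; rw [Finset.prod_insert hi]; ring
    rw [this, Finset.card_insert_of_notMem hi]
    exact ch_mul_mem h0 h1 i ih

lemma PD_mul (h0 : 0 < p) (h1 : p < 1) {d e : ℕ} {f g : (ι → Bool) → ℝ}
    (hf : f ∈ PD p d) (hg : g ∈ PD p e) : f * g ∈ PD p (d + e) := by
  induction hf using Submodule.span_induction with
  | mem f hf =>
    obtain ⟨U, hU, rfl⟩ := hf
    exact PD_mono (by omega) (mon_mul_mem h0 h1 U hg)
  | zero => simp
  | add f g _ _ hf hg => rw [add_mul]; exact Submodule.add_mem _ hf hg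
  | smul c f _ hf => rw [smul_mul_assoc]; exact Submodule.smul_mem _ _ hf

lemma PD_pow2 (h0 : 0 < p) (h1 : p < 1) {d : ℕ} {f : (ι → Bool) → ℝ}
    (hf : f ∈ PD p d) (j : ℕ) : f ^ (2 ^ j) ∈ PD p (d * 2 ^ j) := by
  induction j with
  | zero => simpa using hf
  | succ j ih =>
    have := PD_mul h0 h1 ih ih
    rw [← pow_add] at this
    convert this using 2 <;> ring

lemma PD_expand {d : ℕ} {f : (ι → Bool) → ℝ} (hf : f ∈ PD p d) :
    ∃ c : Finset ι → ℝ, (∀ U, d < U.card → c U = 0) ∧ ∀ x, f x = ∑ U, c U * mon p U x := by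
  induction hf using Submodule.span_induction with
  | mem f hf =>
    obtain ⟨U, hU, rfl⟩ := hf
    refine ⟨fun V => if V = U then 1 else 0, ?_, ?_⟩
    · intro V hV
      have : V ≠ U := by rintro rfl; omega
      simp [this]
    · intro x; simp
  | zero => exact ⟨fun _ => 0, by simp, by simp⟩
  | add f g _ _ hf hg =>
    obtain ⟨c, hc, hc'⟩ := hf
    obtain ⟨d, hd, hd'⟩ := hg
    refine ⟨fun U => c U + d U, fun U hU => by simp [hc U hU, hd U hU], fun x => ?_⟩
    simp only [Pi.add_apply, hc', hd', add_mul, Finset.sum_add_distrib]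
  | smul a f _ hf =>
    obtain ⟨c, hc, hc'⟩ := hf
    refine ⟨fun U => a * c U, fun U hU => by simp [hc U hU], fun x => ?_⟩
    simp only [Pi.smul_apply, smul_eq_mul, hc', Finset.mul_sum, mul_assoc]

lemma hyper (h0 : 0 < p) (h1 : p < 1) {B : ℝ} (hB : ∀ b, |ch p b| ≤ B) {d : ℕ}
    {f : (ι → Bool) → ℝ} (hf : f ∈ PD p d) :
    Ex p (fun x => f x ^ 4) ≤ (3 + B) ^ (2 * d) * Ex p (fun x => f x ^ 2) ^ 2 := by
  have hB0 : 0 ≤ B := (abs_nonneg _).trans (hB true)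
  obtain ⟨c, hc, hf⟩ := PD_expand hf
  have := hyper_aux h0 h1 hB c Finset.univ
  rw [Finset.powerset_univ] at this
  have pv := parseval h0 h1 Finset.univ c (fun U : Finset ι => U) (fun _ _ _ _ h => h)
  simp only [hf]
  refine this.trans ?_
  rw [pv, mul_comm 2 d, pow_mul, ← mul_pow]
  refine pow_le_pow_left₀ (Finset.sum_nonneg fun _ _ => by positivity) ?_ 2
  rw [Finset.mul_sum]
  refine Finset.sum_le_sum fun U _ => ?_
  by_cases h : d < U.card
  · simp [hc U h]
  · refine mul_le_mul_of_nonneg_right ?_ (sq_nonneg _)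
    exact pow_le_pow_right₀ (by linarith) (by omega)

lemma moment (h0 : 0 < p) (h1 : p < 1) {B : ℝ} (hB : ∀ b, |ch p b| ≤ B) {d : ℕ}
    {f : (ι → Bool) → ℝ} (hf : f ∈ PD p d) (j : ℕ) :
    Ex p (fun x => f x ^ (2 ^ (j + 1))) ≤ ((3 + B) ^ (d * j) * Ex p (fun x => f x ^ 2)) ^ (2 ^ j) := by
  have hB0 : 0 ≤ B := (abs_nonneg _).trans (hB true)
  induction j with
  | zero => simp
  | succ j ih =>
    have h := hyper h0 h1 hB (PD_pow2 h0 h1 hf j)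
    have e1 : (fun x => (f ^ 2 ^ j) x ^ 4) = fun x => f x ^ (2 ^ (j + 1 + 1)) := by
      funext x; rw [Pi.pow_apply, ← pow_mul]; congr 1; ring
    have e2 : (fun x => (f ^ 2 ^ j) x ^ 2) = fun x => f x ^ (2 ^ (j + 1)) := by
      funext x; rw [Pi.pow_apply, ← pow_mul]; congr 1
    rw [e1, e2] at h
    refine h.trans ?_
    have hn : 0 ≤ Ex p (fun x => f x ^ (2 ^ (j + 1))) :=
      Ex_nonneg h0.le h1.le fun x => by rw [pow_succ 2 j, mul_comm, pow_mul]; positivity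
    calc _ ≤ (3 + B) ^ (2 * (d * 2 ^ j)) * (((3 + B) ^ (d * j) * Ex p (fun x => f x ^ 2)) ^ (2 ^ j)) ^ 2 := by
          gcongr
      _ = _ := by
          rw [mul_pow, mul_pow, mul_pow]; ring

end degree

lemma exp_I_taylor (y : ℝ) (J : ℕ) :
    ‖Complex.exp (Complex.I * y) - ∑ j ∈ Finset.range J, (Complex.I * y) ^ j / (j.factorial : ℂ)‖
      ≤ 4 * |y| ^ J := by
  have he : Real.exp 1 ≤ 3 := by linarith [Real.exp_one_lt_d9]
  have hn : ‖Complex.I * (y : ℂ)‖ = |y| := by simp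
  rcases le_total |y| 1 with h | h
  · have := Complex.norm_exp_sub_sum_le_norm_mul_exp (Complex.I * y) J
    rw [hn] at this
    refine this.trans ?_
    have : Real.exp |y| ≤ 4 := (Real.exp_le_exp.2 h).trans (by linarith)
    rw [mul_comm]
    exact mul_le_mul_of_nonneg_right this (by positivity)
  · refine (norm_sub_le _ _).trans ?_
    have h1 : ‖Complex.exp (Complex.I * y)‖ = 1 := by
      rw [mul_comm]; exact Complex.norm_exp_ofReal_mul_I y
    have h2 : ‖∑ j ∈ Finset.range J, (Complex.I * y) ^ j / (j.factorial : ℂ)‖ ≤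
        |y| ^ J * ∑ j ∈ Finset.range J, (1 : ℝ) ^ j / j.factorial := by
      refine (norm_sum_le _ _).trans ?_
      rw [Finset.mul_sum]
      refine Finset.sum_le_sum fun j hj => ?_
      rw [norm_div, norm_pow, hn, Complex.norm_natCast, one_pow, mul_one_div]
      have := pow_le_pow_right₀ h (Finset.mem_range.1 hj).le
      gcongr
    have h3 := Real.sum_le_exp_of_nonneg zero_le_one J
    have h4 : 1 ≤ |y| ^ J := one_le_pow₀ h
    rw [h1]
    nlinarith

section charfun
variable {ι : Type*} [Fintype ι] [DecidableEq ι] {p : ℝ}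

/-- characteristic function of a small polynomial -/
lemma charfun_small (h0 : 0 < p) (h1 : p < 1) {B : ℝ} (hB : ∀ b, |ch p b| ≤ B) {d : ℕ}
    {f : (ι → Bool) → ℝ} (hf : f ∈ PD p d) (hmean : Ex p f = 0)
    {V : ℝ} (hV : Ex p (fun x => f x ^ 2) = V) (hV2 : 256 * (3 + B) ^ (2 * d) * V ≤ 1) :
    ‖Ex p (fun x => Complex.exp (Complex.I * (f x : ℝ)))‖ ≤ 1 - V / 4 := by
  have hB0 : 0 ≤ B := (abs_nonneg _).trans (hB true)
  have hV0 : 0 ≤ V := hV ▸ Ex_nonneg h0.le h1.le fun x => sq_nonneg _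
  have hy := hyper h0 h1 hB hf
  rw [hV] at hy
  have hK : 1 ≤ (3 + B) ^ (2 * d) := one_le_pow₀ (by linarith)
  have hV1 : V ≤ 1 := by nlinarith
  have e1 : Ex p (fun x => (((1 : ℝ) : ℂ) + Complex.I * (f x : ℝ)) - (1 / 2 : ℂ) * ((f x ^ 2 : ℝ) : ℂ)) =
      ((1 - V / 2 : ℝ) : ℂ) := by
    rw [Ex_sub, Ex_add, Ex_const, Ex_cmul_left, Ex_cmul_left, Ex_ofReal, Ex_ofReal, hmean, hV]
    push_cast; ring
  have e2 : Ex p (fun x => Complex.exp (Complex.I * (f x : ℝ))) =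
      Ex p (fun x => Complex.exp (Complex.I * (f x : ℝ)) -
        ((((1 : ℝ) : ℂ) + Complex.I * (f x : ℝ)) - (1 / 2 : ℂ) * ((f x ^ 2 : ℝ) : ℂ))) + ((1 - V / 2 : ℝ) : ℂ) := by
    rw [Ex_sub, e1]; ring
  rw [e2]
  refine (norm_add_le _ _).trans ?_
  have e3 : ‖((1 - V / 2 : ℝ) : ℂ)‖ = 1 - V / 2 := by
    rw [Complex.norm_real, Real.norm_of_nonneg]; linarith
  rw [e3]
  have e4 : ‖Ex p (fun x => Complex.exp (Complex.I * (f x : ℝ)) -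
        ((((1 : ℝ) : ℂ) + Complex.I * (f x : ℝ)) - (1 / 2 : ℂ) * ((f x ^ 2 : ℝ) : ℂ)))‖ ≤
        Ex p (fun x => (1 / 8 : ℝ) * f x ^ 2 + 32 * f x ^ 4) := by
    refine (Ex_norm_le h0.le h1.le _).trans (Ex_mono h0.le h1.le fun x => ?_)
    have := exp_I_taylor (f x) 3
    have e5 : ∑ j ∈ Finset.range 3, (Complex.I * (f x : ℂ)) ^ j / (j.factorial : ℂ) =
        ((((1 : ℝ) : ℂ) + Complex.I * (f x : ℝ)) - (1 / 2 : ℂ) * ((f x ^ 2 : ℝ) : ℂ)) := by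
      simp [Finset.sum_range_succ, Nat.factorial, mul_pow]
      ring
    rw [e5] at this
    refine this.trans ?_
    have a : f x ^ 2 = |f x| ^ 2 := (sq_abs _).symm
    have b : f x ^ 4 = |f x| ^ 4 := by rw [← abs_pow, abs_of_nonneg (by positivity)]
    rw [a, b]
    nlinarith [mul_nonneg (sq_nonneg |f x|) (sq_nonneg (1 - 16 * |f x|))]
  rw [Ex_add, Ex_mul_left, Ex_mul_left, hV] at e4
  nlinarith

/-- Functions depending only on coordinates in a set -/
def Dep {E : Type*} (P : ι → Prop) (F : (ι → Bool) → E) : Prop :=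
  ∀ x y : ι → Bool, (∀ i, P i → x i = y i) → F x = F y

/-- product over untouched groups -/
lemma prod_groups {M : Type*} [DecidableEq M] (h0 : 0 ≤ p) (h1 : p ≤ 1) (grp : ι → Option M)
    (Y : M → (ι → Bool) → ℂ) (hY : ∀ i, Dep (fun u => grp u = some i) (Y i))
    (Φ : (ι → Bool) → ℂ) (T : Finset M) (hΦ : Dep (fun u => ∀ i ∈ T, grp u ≠ some i) Φ) :
    Ex p (fun x => (∏ i ∈ T, Y i x) * Φ x) = (∏ i ∈ T, Ex p (Y i)) * Ex p Φ := by
  classical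
  induction T using Finset.induction_on generalizing Φ with
  | empty => simp
  | insert i T hi ih =>
    have e : ∀ x, (∏ j ∈ insert i T, Y j x) * Φ x = (∏ j ∈ T, Y j x) * (Y i x * Φ x) := by
      intro x; rw [Finset.prod_insert hi]; ring
    simp only [e]
    rw [ih (fun x => Y i x * Φ x)]
    · rw [Finset.prod_insert hi, Ex_indep (fun u => grp u = some i) (Y i) Φ (hY i)]
      · ring
      · intro x y hxy
        refine hΦ x y fun u hu => hxy u (hu i (Finset.mem_insert_self _ _))
    · intro x y hxy
      have a : Y i x = Y i y := hY i x y fun u hu => hxy u fun j hj hj' => by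
        rw [hu] at hj'; cases hj'; exact hi hj
      have b : Φ x = Φ y := hΦ x y fun u hu => hxy u fun j hj => hu j (Finset.mem_insert_of_mem hj)
      simp only [a, b]

lemma touched_bound {M : Type*} [Fintype M] [DecidableEq M] (h0 : 0 ≤ p) (h1 : p ≤ 1)
    (grp : ι → Option M)
    (Y : M → (ι → Bool) → ℂ) (hY : ∀ i, Dep (fun u => grp u = some i) (Y i))
    (hY1 : ∀ i x, ‖Y i x‖ ≤ 1) {ρ : ℝ} (hρ0 : 0 ≤ ρ) (hρ1 : ρ ≤ 1) (hYE : ∀ i, ‖Ex p (Y i)‖ ≤ ρ)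
    (Φ : (ι → Bool) → ℂ) (A : Finset ι) (hΦ : Dep (fun u => u ∈ A) Φ) {b : ℝ}
    (hb : ∀ x, ‖Φ x‖ ≤ b) {t : ℕ} (ht : A.card ≤ t) :
    ‖Ex p (fun x => (∏ i, Y i x) * Φ x)‖ ≤ b * ρ ^ (Fintype.card M - t) := by
  classical
  set T : Finset M := Finset.univ.filter fun i => ∀ u ∈ A, grp u ≠ some i with hT
  have hTc : Fintype.card M - t ≤ T.card := by
    have : Tᶜ.card ≤ A.card := by
      have hsub : Tᶜ ⊆ (A.image grp).eraseNone := by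
        intro i hi
        simp only [hT, Finset.mem_compl, Finset.mem_filter, Finset.mem_univ, true_and] at hi
        push Not at hi
        obtain ⟨u, hu, hui⟩ := hi
        simp only [Finset.mem_eraseNone, Finset.mem_image]
        exact ⟨u, hu, hui⟩
      refine (Finset.card_le_card hsub).trans ?_
      refine le_trans ?_ (Finset.card_image_le (s := A) (f := grp))
      exact Finset.card_eraseNone_le _
    rw [Finset.card_compl] at this
    omega
  have e : ∀ x, (∏ i, Y i x) * Φ x = (∏ i ∈ T, Y i x) * ((∏ i ∈ Tᶜ, Y i x) * Φ x) := by
    intro x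
    rw [← mul_assoc, Finset.prod_mul_prod_compl]
  simp only [e]
  rw [prod_groups h0 h1 grp Y hY (fun x => (∏ i ∈ Tᶜ, Y i x) * Φ x) T]
  · rw [norm_mul, norm_prod, mul_comm]
    have hb0 : 0 ≤ b := (norm_nonneg _).trans (hb (fun _ => true))
    refine mul_le_mul ?_ ?_ (Finset.prod_nonneg fun _ _ => norm_nonneg _) hb0
    · refine (Ex_norm_le h0 h1 _).trans ?_
      rw [← Ex_const (ι := ι) (p := p) b]
      refine Ex_mono h0 h1 fun x => ?_
      rw [norm_mul, norm_prod]
      have : ∏ i ∈ Tᶜ, ‖Y i x‖ ≤ 1 := Finset.prod_le_one (fun _ _ => norm_nonneg _) fun i _ => hY1 i x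
      calc _ ≤ 1 * b := mul_le_mul this (hb x) (norm_nonneg _) zero_le_one
        _ = b := one_mul b
    · calc ∏ i ∈ T, ‖Ex p (Y i)‖ ≤ ∏ i ∈ T, ρ :=
            Finset.prod_le_prod (fun _ _ => norm_nonneg _) fun i _ => hYE i
        _ = ρ ^ T.card := by simp
        _ ≤ _ := pow_le_pow_of_le_one hρ0 hρ1 hTc
  · intro x y hxy
    have a : ∀ i ∈ Tᶜ, Y i x = Y i y := fun i hi => hY i x y fun u hu => hxy u fun j hj hj' => by
      rw [hu] at hj'; cases hj'; exact (Finset.mem_compl.1 hi) hj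
    have b : Φ x = Φ y := hΦ x y fun u hu => hxy u fun j hj => by
      exact (Finset.mem_filter.1 hj).2 u hu
    simp only [b, Finset.prod_congr rfl a]

lemma power_bound {M : Type*} [Fintype M] [DecidableEq M] (h0 : 0 ≤ p) (h1 : p ≤ 1)
    {B : ℝ} (hB : ∀ b, |ch p b| ≤ B) (hB1 : 1 ≤ B)
    (grp : ι → Option M)
    (Y : M → (ι → Bool) → ℂ) (hY : ∀ i, Dep (fun u => grp u = some i) (Y i))
    (hY1 : ∀ i x, ‖Y i x‖ ≤ 1) {ρ : ℝ} (hρ0 : 0 ≤ ρ) (hρ1 : ρ ≤ 1) (hYE : ∀ i, ‖Ex p (Y i)‖ ≤ ρ)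
    {α : Type*} (s : Finset α) (r : α → ℝ) (U : α → Finset ι) {D : ℕ} (hU : ∀ m ∈ s, (U m).card ≤ D)
    {L : ℝ} (hL : ∑ m ∈ s, |r m| ≤ L) (j : ℕ) :
    ∀ (Φ : (ι → Bool) → ℂ) (A : Finset ι) (hΦ : Dep (fun u => u ∈ A) Φ) (b : ℝ)
    (hb : ∀ x, ‖Φ x‖ ≤ b) (t : ℕ) (ht : A.card ≤ t),
    ‖Ex p (fun x => (∏ i, Y i x) * (Φ x * ((∑ m ∈ s, r m * mon p (U m) x : ℝ) : ℂ) ^ j))‖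
      ≤ b * (L * B ^ D) ^ j * ρ ^ (Fintype.card M - (t + j * D)) := by
  classical
  induction j with
  | zero =>
    intro Φ A hΦ b hb t ht
    simpa using touched_bound h0 h1 grp Y hY hY1 hρ0 hρ1 hYE Φ A hΦ hb ht
  | succ j ih =>
    intro Φ A hΦ b hb t ht
    have hb0 : 0 ≤ b := (norm_nonneg _).trans (hb (fun _ => true))
    have hL0 : 0 ≤ L := (Finset.sum_nonneg fun _ _ => abs_nonneg _).trans hL
    have e : ∀ x, (∏ i, Y i x) * (Φ x * ((∑ m ∈ s, r m * mon p (U m) x : ℝ) : ℂ) ^ (j + 1)) =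
        ∑ m ∈ s, (r m : ℂ) * ((∏ i, Y i x) * ((Φ x * (mon p (U m) x : ℂ)) *
          ((∑ m ∈ s, r m * mon p (U m) x : ℝ) : ℂ) ^ j)) := by
      intro x
      rw [pow_succ]
      conv_lhs => rw [show ∀ a b c d : ℂ, a * (b * (c * d)) = (a * b * c) * d by intros; ring]
      conv_lhs => 
        arg 2
        rw [Complex.ofReal_sum]
      rw [Finset.mul_sum]
      refine Finset.sum_congr rfl fun m _ => ?_
      push_cast; ring
    simp only [e]
    rw [Ex_sum]
    refine (norm_sum_le _ _).trans ?_
    have step : ∀ m ∈ s, ‖Ex p (fun x => (r m : ℂ) * ((∏ i, Y i x) * ((Φ x * (mon p (U m) x : ℂ)) *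
          ((∑ m ∈ s, r m * mon p (U m) x : ℝ) : ℂ) ^ j)))‖ ≤
          |r m| * (b * B ^ D * (L * B ^ D) ^ j * ρ ^ (Fintype.card M - (t + D + j * D))) := by
      intro m hm
      rw [Ex_cmul_left, norm_mul, Complex.norm_real, Real.norm_eq_abs]
      refine mul_le_mul_of_nonneg_left ?_ (abs_nonneg _)
      refine ih (fun x => Φ x * (mon p (U m) x : ℂ)) (A ∪ U m) ?_ (b * B ^ D) ?_ (t + D) ?_
      · intro x y hxy
        show Φ x * _ = Φ y * _
        rw [hΦ x y fun i hi => hxy i (Finset.mem_union_left _ hi),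
          mon_dep (U m) x y fun i hi => hxy i (Finset.mem_union_right _ hi)]
      · intro x
        rw [norm_mul, Complex.norm_real, Real.norm_eq_abs]
        refine mul_le_mul (hb x) ((mon_abs_le hB _ _).trans ?_) (abs_nonneg _) hb0
        exact pow_le_pow_right₀ hB1 (hU m hm)
      · exact (Finset.card_union_le _ _).trans (add_le_add ht (hU m hm))
    refine (Finset.sum_le_sum step).trans ?_
    rw [← Finset.sum_mul]
    have e2 : t + D + j * D = t + (j + 1) * D := by ring
    rw [e2]
    calc _ ≤ L * (b * B ^ D * (L * B ^ D) ^ j * ρ ^ (Fintype.card M - (t + (j + 1) * D))) := by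
          refine mul_le_mul_of_nonneg_right hL ?_
          positivity
      _ = _ := by ring

/-- Main analytic estimate -/
lemma main_analytic {M : Type*} [Fintype M] [DecidableEq M] (h0 : 0 < p) (h1 : p < 1)
    {B : ℝ} (hB : ∀ b, |ch p b| ≤ B) (hB1 : 1 ≤ B)
    (grp : ι → Option M)
    (X : M → (ι → Bool) → ℝ) (hX : ∀ i, Dep (fun u => grp u = some i) (X i))
    {ρ : ℝ} (hρ0 : 0 ≤ ρ) (hρ1 : ρ ≤ 1)
    (hXE : ∀ i, ‖Ex p (fun x => Complex.exp (Complex.I * (X i x : ℝ)))‖ ≤ ρ)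
    {α : Type*} (s : Finset α) (r : α → ℝ) (U : α → Finset ι) {D : ℕ} (hU : ∀ m ∈ s, (U m).card ≤ D)
    {L : ℝ} (hL : ∑ m ∈ s, |r m| ≤ L) (hL1 : 1 ≤ L) {v : ℝ}
    (hv : Ex p (fun x => (∑ m ∈ s, r m * mon p (U m) x) ^ 2) ≤ v) (b : ℕ) :
    ‖Ex p (fun x => Complex.exp (Complex.I * ((∑ i, X i x + ∑ m ∈ s, r m * mon p (U m) x : ℝ) : ℂ)))‖
      ≤ 2 ^ (b + 1) * (L * B ^ D) ^ (2 ^ (b + 1)) * ρ ^ (Fintype.card M - 2 ^ (b + 1) * D) +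
        4 * ((3 + B) ^ (D * b) * v) ^ (2 ^ b) := by
  classical
  set J := 2 ^ (b + 1) with hJ
  set R : (ι → Bool) → ℝ := fun x => ∑ m ∈ s, r m * mon p (U m) x with hR
  set Y : M → (ι → Bool) → ℂ := fun i x => Complex.exp (Complex.I * (X i x : ℝ)) with hYdef
  have hY1 : ∀ i x, ‖Y i x‖ = 1 := fun i x => by
    simp only [hYdef]; rw [mul_comm]; exact Complex.norm_exp_ofReal_mul_I _
  have hYD : ∀ i, Dep (fun u => grp u = some i) (Y i) := by
    intro i x y hxy; simp only [hYdef, hX i x y hxy]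
  have e : ∀ x, Complex.exp (Complex.I * ((∑ i, X i x + R x : ℝ) : ℂ)) =
      (∏ i, Y i x) * (Complex.exp (Complex.I * (R x : ℝ)) -
        ∑ j ∈ Finset.range J, (Complex.I * (R x : ℝ)) ^ j / (j.factorial : ℂ)) +
      ∑ j ∈ Finset.range J, (Complex.I ^ j / (j.factorial : ℂ)) *
        ((∏ i, Y i x) * (1 * (R x : ℂ) ^ j)) := by
    intro x
    have : Complex.exp (Complex.I * ((∑ i, X i x + R x : ℝ) : ℂ)) =
        (∏ i, Y i x) * Complex.exp (Complex.I * (R x : ℝ)) := by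
      rw [← Complex.exp_sum, ← Complex.exp_add]; congr 1
      push_cast; rw [mul_add, Finset.mul_sum]
    rw [this, mul_sub, Finset.mul_sum]
    have e3 : ∀ j ∈ Finset.range J, (Complex.I ^ j / (j.factorial : ℂ)) *
        ((∏ i, Y i x) * (1 * (R x : ℂ) ^ j)) = (∏ i, Y i x) * ((Complex.I * (R x : ℝ)) ^ j / (j.factorial : ℂ)) := by
      intro j _; rw [mul_pow]; ring
    rw [Finset.sum_congr rfl e3]; ring
  have hRdeg : R ∈ PD p D := by
    have : R = ∑ m ∈ s, r m • mon p (U m) := by funext x; simp [hR, Finset.sum_apply]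
    rw [this]
    exact Submodule.sum_mem _ fun m hm => Submodule.smul_mem _ _ (mon_mem _ (hU m hm))
  have hmom : Ex p (fun x => R x ^ J) ≤ ((3 + B) ^ (D * b) * v) ^ (2 ^ b) := by
    refine (moment h0 h1 hB hRdeg b).trans ?_
    have hnn : 0 ≤ Ex p (fun x => R x ^ 2) := Ex_nonneg h0.le h1.le fun x => sq_nonneg _
    gcongr
  change ‖Ex p (fun x => Complex.exp (Complex.I * ((∑ i, X i x + R x : ℝ) : ℂ)))‖ ≤ _
  simp only [e]
  rw [Ex_add, Ex_sum]
  have hP : 1 ≤ L * B ^ D := by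
    have := one_le_pow₀ (n := D) hB1
    nlinarith
  refine (norm_add_le _ _).trans ?_
  rw [add_comm]
  refine add_le_add ?_ ?_
  · refine (norm_sum_le _ _).trans ?_
    have : ∀ j ∈ Finset.range J, ‖Ex p (fun x => (Complex.I ^ j / (j.factorial : ℂ)) *
        ((∏ i, Y i x) * (1 * (R x : ℂ) ^ j)))‖ ≤ (L * B ^ D) ^ J * ρ ^ (Fintype.card M - J * D) := by
      intro j hj
      have hjJ := (Finset.mem_range.1 hj).le
      rw [Ex_cmul_left, norm_mul]
      have hf : ‖Complex.I ^ j / (j.factorial : ℂ)‖ ≤ 1 := by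
        rw [norm_div, norm_pow, Complex.norm_I, one_pow, Complex.norm_natCast]
        have : (1 : ℝ) ≤ j.factorial := by exact_mod_cast Nat.succ_le_of_lt (Nat.factorial_pos j)
        exact div_le_one_of_le₀ this (by positivity)
      have pb := power_bound h0.le h1.le hB hB1 grp Y hYD (fun i x => (hY1 i x).le) hρ0 hρ1 hXE s r U hU hL j
        (fun _ => 1) ∅ (fun _ _ _ => rfl) 1 (fun _ => by simp) 0 (by simp)
      calc _ ≤ 1 * (1 * (L * B ^ D) ^ j * ρ ^ (Fintype.card M - (0 + j * D))) :=
            mul_le_mul hf pb (norm_nonneg _) zero_le_one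
        _ = (L * B ^ D) ^ j * ρ ^ (Fintype.card M - j * D) := by simp
        _ ≤ _ := by
            refine mul_le_mul (pow_le_pow_right₀ hP hjJ) ?_ (by positivity) (by positivity)
            refine pow_le_pow_of_le_one hρ0 hρ1 ?_
            exact Nat.sub_le_sub_left (Nat.mul_le_mul_right _ hjJ) _
    refine (Finset.sum_le_sum this).trans ?_
    rw [Finset.sum_const, Finset.card_range, nsmul_eq_mul, hJ, ← mul_assoc]
    push_cast; exact le_rfl
  · refine (Ex_norm_le h0.le h1.le _).trans ?_
    calc _ ≤ Ex p (fun x => 4 * R x ^ J) := by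
          refine Ex_mono h0.le h1.le fun x => ?_
          rw [norm_mul, norm_prod]
          simp only [hY1, Finset.prod_const_one, one_mul]
          refine (exp_I_taylor (R x) J).trans_eq ?_
          rw [Even.pow_abs]
          rw [hJ, pow_succ]; exact even_two.mul_left _
      _ = 4 * Ex p (fun x => R x ^ J) := Ex_mul_left _ _
      _ ≤ _ := by gcongr

end charfun

end GS

set_option linter.unusedSectionVars false
set_option linter.unusedSimpArgs false
set_option linter.unusedVariables false

namespace GS

section decouple
variable {ι : Type*} [Fintype ι] [DecidableEq ι] {p : ℝ}

lemma Ex_comm {κ : Type*} [Fintype κ] [DecidableEq κ] (F : (ι → Bool) → (κ → Bool) → ℂ) :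
    Ex p (fun x => Ex p (fun y => F x y)) = Ex p (fun y => Ex p (fun x => F x y)) := by
  simp only [Ex, Finset.smul_sum]
  rw [Finset.sum_comm]
  refine Finset.sum_congr rfl fun y _ => Finset.sum_congr rfl fun x _ => ?_
  rw [smul_comm]

lemma Ex_cmul_right (c : ℂ) (f : (ι → Bool) → ℂ) : Ex p (fun x => f x * c) = Ex p f * c := by
  simp only [mul_comm _ c, Ex_cmul_left]

lemma Ex_cs (h0 : 0 ≤ p) (h1 : p ≤ 1) (f : (ι → Bool) → ℝ) :
    Ex p f ^ 2 ≤ Ex p (fun x => f x ^ 2) := by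
  have : 0 ≤ Ex p (fun x => (f x - Ex p f) ^ 2) := Ex_nonneg h0 h1 fun x => sq_nonneg _
  have e : ∀ x, (f x - Ex p f) ^ 2 = f x ^ 2 - ((2 * Ex p f) * f x - Ex p f ^ 2) := fun x => by ring
  simp only [e] at this
  rw [Ex_sub, Ex_sub, Ex_mul_left, Ex_const] at this
  nlinarith

lemma Ex_csC (h0 : 0 ≤ p) (h1 : p ≤ 1) (f : (ι → Bool) → ℂ) :
    ‖Ex p f‖ ^ 2 ≤ Ex p (fun x => ‖f x‖ ^ 2) := by
  refine le_trans ?_ (Ex_cs h0 h1 _)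
  have := Ex_norm_le h0 h1 f
  gcongr

lemma Ex_conj (f : (ι → Bool) → ℂ) : (starRingEnd ℂ) (Ex p f) = Ex p (fun x => (starRingEnd ℂ) (f x)) := by
  simp [Ex, map_sum]

/-- the character -/
noncomputable def ee (y : ℝ) : ℂ := Complex.exp (Complex.I * (y : ℂ))

lemma ee_conj (y : ℝ) : (starRingEnd ℂ) (ee y) = ee (-y) := by
  unfold ee; rw [← Complex.exp_conj]; simp

lemma ee_add (y z : ℝ) : ee (y + z) = ee y * ee z := by
  unfold ee; rw [← Complex.exp_add]; push_cast; ring_nf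

lemma ee_norm (y : ℝ) : ‖ee y‖ = 1 := by
  unfold ee; rw [mul_comm]; exact Complex.norm_exp_ofReal_mul_I _

lemma Ex_ee_sq (G : (ι → Bool) → ℝ) :
    ((‖Ex p (fun y => ee (G y))‖ ^ 2 : ℝ) : ℂ) =
      Ex p (fun y => Ex p (fun z => ee (G y - G z))) := by
  rw [Complex.ofReal_pow, ← Complex.mul_conj', Ex_conj, ← Ex_cmul_right]
  congr 1; funext y
  rw [← Ex_cmul_left]
  congr 1; funext z
  rw [ee_conj, sub_eq_add_neg, ee_add]

lemma decouple_step (h0 : 0 ≤ p) (h1 : p ≤ 1) (P : ι → Prop) [DecidablePred P]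
    (G : (ι → Bool) → (ι → Bool) → ℝ)
    (hG : ∀ x y z, (∀ i, ¬ P i → y i = z i) → G x y = G x z) :
    ‖Ex p (fun x => Ex p (fun x' => ee (G x x')))‖ ^ 2 ≤
      ‖Ex p (fun x => Ex p (fun x' => ee (G x x' - G (mix P x' x) x')))‖ := by
  have e1 : Ex p (fun x => Ex p (fun x' => ee (G x x'))) =
      Ex p (fun x' => Ex p (fun x => Ex p (fun y => ee (G (mix P y x) x')))) := by
    rw [Ex_comm]
    congr 1; funext x'
    exact (mix_swap P (fun x => ee (G x x'))).symm
  have e2 : ((Ex p (fun x' => Ex p (fun x => ‖Ex p (fun y => ee (G (mix P y x) x'))‖ ^ 2)) : ℝ) : ℂ) =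
      Ex p (fun x => Ex p (fun x' => ee (G x x' - G (mix P x' x) x'))) := by
    rw [← Ex_ofReal]
    simp only [← Ex_ofReal, Ex_ee_sq]
    have s1 : ∀ x', Ex p (fun x => Ex p (fun y => Ex p (fun z => ee (G (mix P y x) x' - G (mix P z x) x')))) =
        Ex p (fun x => Ex p (fun z => ee (G x x' - G (mix P z x) x'))) := by
      intro x'
      rw [← mix_swap P (fun x => Ex p (fun z => ee (G x x' - G (mix P z x) x')))]
      congr 1; funext x; congr 1; funext y; congr 1; funext z
      have : mix P z (mix P y x) = mix P z x := by funext i; simp only [mix]; split_ifs <;> rfl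
      rw [this]
    simp only [s1]
    rw [Ex_comm]
    congr 1; funext x
    rw [← mix_swap P (fun x' => ee (G x x' - G (mix P x' x) x'))]
    congr 1; funext x'; congr 1; funext z
    have a1 : mix P (mix P z x') x = mix P z x := by funext i; simp only [mix]; split_ifs <;> rfl
    have a2 : ∀ w, G w (mix P z x') = G w x' := fun w => hG _ _ _ fun i hi => by simp [mix, hi]
    rw [a1, a2, a2]
  rw [← e2, Complex.norm_real, Real.norm_eq_abs]
  refine le_trans ?_ (le_abs_self _)
  rw [e1]
  refine (Ex_csC h0 h1 _).trans (Ex_mono h0 h1 fun x' => ?_)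
  exact Ex_csC h0 h1 _

variable {Γ : Type*} [DecidableEq Γ]

/-- selection of coordinates with colour in `A` from `x'` -/
def sel (c : ι → Option Γ) (A : Finset Γ) (x x' : ι → Bool) : ι → Bool :=
  fun i => if c i ∈ A.image some then x' i else x i

lemma decouple_base (h0 : 0 ≤ p) (h1 : p ≤ 1) (c : ι → Option Γ) (T : Finset Γ)
    (Q : (ι → Bool) → ℝ) :
    ‖Ex p (fun x => ee (Q x))‖ ^ (2 ^ T.card) ≤
      ‖Ex p (fun x => Ex p (fun x' => ee (∑ A ∈ T.powerset, (-1 : ℝ) ^ A.card * Q (sel c A x x'))))‖ := by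
  induction T using Finset.induction_on with
  | empty =>
    have : ∀ x x' : ι → Bool, sel c ∅ x x' = x := fun x x' => by funext i; simp [sel]
    simp [this, Ex_const]
  | insert j T hj ih =>
    rw [Finset.card_insert_of_notMem hj, pow_succ, pow_mul]
    refine (pow_le_pow_left₀ (by positivity) ih 2).trans ?_
    refine (decouple_step h0 h1 (fun i => c i = some j) _ ?_).trans (le_of_eq ?_)
    · intro x y z hyz
      refine Finset.sum_congr rfl fun A hA => ?_
      congr 2
      funext i
      simp only [sel]
      split_ifs with h
      · refine hyz i fun h' => ?_
        rw [h'] at h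
        simp only [Finset.mem_image, Option.some.injEq, exists_eq_right] at h
        exact hj (Finset.mem_powerset.1 hA h)
      · rfl
    · congr 1; congr 1; funext x; congr 1; funext x'; congr 1
      rw [Finset.sum_powerset_insert hj, sub_eq_add_neg, ← Finset.sum_neg_distrib]
      congr 1
      refine Finset.sum_congr rfl fun A hA => ?_
      have hjA : j ∉ A := fun h => hj (Finset.mem_powerset.1 hA h)
      rw [Finset.card_insert_of_notMem hjA, pow_succ]
      have : sel c A (mix (fun i => c i = some j) x' x) x' = sel c (insert j A) x x' := by
        funext i
        simp only [sel, mix, Finset.image_insert, Finset.mem_insert]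
        split_ifs <;> first | rfl | tauto
      rw [this]; ring

lemma alt_zero (c : ι → Option Γ) (T : Finset Γ) {j : Γ} (hj : j ∈ T) (F : (ι → Bool) → ℝ)
    (hF : ∀ x y, (∀ i, c i ≠ some j → x i = y i) → F x = F y) (x x' : ι → Bool) :
    ∑ A ∈ T.powerset, (-1 : ℝ) ^ A.card * F (sel c A x x') = 0 := by
  rw [← Finset.insert_erase hj, Finset.sum_powerset_insert (Finset.notMem_erase _ _),
    ← Finset.sum_add_distrib]
  refine Finset.sum_eq_zero fun A hA => ?_
  have hjA : j ∉ A := fun h => Finset.notMem_erase _ _ (Finset.mem_powerset.1 hA h)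
  rw [Finset.card_insert_of_notMem hjA, pow_succ]
  have : F (sel c (insert j A) x x') = F (sel c A x x') := by
    refine hF _ _ fun i hi => ?_
    simp only [sel, Finset.image_insert, Finset.mem_insert, hi, false_or]
  rw [this]; ring

/-- the lifted edge -/
def lift (c : ι → Option Γ) (A : Finset Γ) (i : ι) : ι ⊕ ι :=
  if c i ∈ A.image some then Sum.inr i else Sum.inl i

lemma lift_proj (c : ι → Option Γ) (A : Finset Γ) (i : ι) : Sum.elim id id (lift c A i) = i := by
  unfold lift; split_ifs <;> rfl

lemma lift_inj (c : ι → Option Γ) (A : Finset Γ) : Function.Injective (lift c A) := fun i j h => by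
  rw [← lift_proj c A i, h, lift_proj]

lemma mon_sel (c : ι → Option Γ) (A : Finset Γ) (S : Finset ι) (x x' : ι → Bool) :
    mon p S (sel c A x x') = mon p (S.image (lift c A)) (Sum.elim x x') := by
  unfold mon
  rw [Finset.prod_image (fun i _ j _ h => lift_inj c A h)]
  refine Finset.prod_congr rfl fun i _ => ?_
  unfold lift sel
  split_ifs <;> rfl

lemma Ex_sum_type (F : (ι → Bool) → (ι → Bool) → ℂ) :
    Ex p (fun x => Ex p (fun x' => F x x')) =
      Ex p (fun z : ι ⊕ ι → Bool => F (fun i => z (Sum.inl i)) (fun i => z (Sum.inr i))) := by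
  simp only [Ex, Finset.smul_sum]
  rw [← Finset.sum_product' Finset.univ Finset.univ
    (fun x y => WW p x • WW p y • F x y), Finset.univ_product_univ]
  rw [← (Equiv.sumArrowEquivProdArrow ι ι Bool).sum_comp]
  refine Finset.sum_congr rfl fun z _ => ?_
  simp only [WW, Fintype.prod_sum_type, mul_smul]
  rfl

/-- `S` meets every colour of `T`. -/
def Full (c : ι → Option Γ) (T : Finset Γ) (S : Finset ι) : Prop :=
  ∀ j ∈ T, ∃ i ∈ S, c i = some j

open Classical in
lemma decouple (h0 : 0 ≤ p) (h1 : p ≤ 1) (c : ι → Option Γ) (T : Finset Γ) (hT : 2 ≤ T.card)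
    (g : ι → Bool → ℝ) (𝒮 : Finset (Finset ι)) (q : Finset ι → ℝ) :
    ‖Ex p (fun x => ee (∑ i, g i (x i) + ∑ S ∈ 𝒮, q S * mon p S x))‖ ^ (2 ^ T.card) ≤
      ‖Ex p (fun z : ι ⊕ ι → Bool => ee (∑ m ∈ (𝒮.filter (Full c T)) ×ˢ T.powerset,
        ((-1 : ℝ) ^ m.2.card * q m.1) * mon p (m.1.image (lift c m.2)) z))‖ := by
  refine (decouple_base h0 h1 c T _).trans (le_of_eq ?_)
  rw [Ex_sum_type]
  congr 1; congr 1; funext z; congr 1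
  rw [Finset.sum_product]
  simp only [mul_add, Finset.sum_add_distrib, Finset.mul_sum]
  rw [Finset.sum_comm]
  rw [Finset.sum_eq_zero, zero_add]
  · rw [Finset.sum_comm, Finset.sum_filter]
    refine Finset.sum_congr rfl fun S _ => ?_
    split_ifs with hS
    · refine Finset.sum_congr rfl fun A _ => ?_
      rw [mon_sel, mul_assoc]
      congr 3
      funext u; cases u <;> rfl
    · unfold Full at hS
      push Not at hS
      obtain ⟨j, hj, hjS⟩ := hS
      exact alt_zero c T hj (fun x => q S * mon p S x) (fun x y hxy => by
        simp only [mon_dep (p := p) S x y fun i hi => hxy i (hjS i hi)]) _ _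
  · intro i _
    obtain ⟨j, hj, hji⟩ : ∃ j ∈ T, c i ≠ some j := by
      obtain ⟨a, ha, b, hb, hab⟩ := Finset.one_lt_card.1 hT
      by_cases h : c i = some a
      · exact ⟨b, hb, fun h' => hab (by rw [h] at h'; exact Option.some.inj h')⟩
      · exact ⟨a, ha, h⟩
    exact alt_zero c T hj (fun x => g i (x i)) (fun x y hxy => by rw [hxy i hji]) _ _

lemma lift_injOn (c : ι → Option Γ) (T : Finset Γ) (s : Set (Finset ι × Finset Γ))
    (hs : ∀ m ∈ s, Full c T m.1 ∧ m.2 ⊆ T) :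
    Set.InjOn (fun m : Finset ι × Finset Γ => m.1.image (lift c m.2)) s := by
  rintro ⟨S, A⟩ hm ⟨S', A'⟩ hm' h
  obtain ⟨hF, hA⟩ := hs _ hm
  obtain ⟨hF', hA'⟩ := hs _ hm'
  simp only at h hF hA hF' hA'
  have hS : ∀ (S : Finset ι) (A : Finset Γ), (S.image (lift c A)).image (Sum.elim id id) = S := by
    intro S A
    rw [Finset.image_image]
    have : (Sum.elim id id) ∘ lift c A = id := funext fun i => lift_proj c A i
    rw [this, Finset.image_id]
  have e1 : S = S' := by rw [← hS S A, h, hS]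
  subst e1
  have key : ∀ (A A' : Finset Γ), A ⊆ T → S.image (lift c A) = S.image (lift c A') → A ⊆ A' := by
    intro A A' hA h j hj
    obtain ⟨i, hi, hc⟩ := hF j (hA hj)
    have h2 : lift c A i = Sum.inr i := by unfold lift; rw [if_pos]; simp [hc, hj]
    have h3 : Sum.inr i ∈ S.image (lift c A') := by
      rw [← h, ← h2]; exact Finset.mem_image_of_mem _ hi
    obtain ⟨i', hi', h4⟩ := Finset.mem_image.1 h3
    have h5 : i' = i := by
      rw [← lift_proj c A' i', h4]; rfl
    subst h5
    unfold lift at h4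
    split_ifs at h4 with h6
    rw [hc] at h6; simpa using h6
  exact Prod.ext rfl (Finset.Subset.antisymm (key _ _ hA h) (key _ _ hA' h.symm))

end decouple
end GS

set_option linter.unusedSectionVars false
set_option linter.unusedSimpArgs false
set_option linter.unusedVariables false

open MeasureTheory ProbabilityTheory
open scoped ENNReal NNReal

namespace GS

section slice

lemma integral_bernoulliPi {ι : Type*} [Fintype ι] [DecidableEq ι] {p : ℝ} (h0 : 0 ≤ p) (h1 : p ≤ 1)
    (f : (ι → Bool) → ℝ) : ∫ x, f x ∂(bernoulliPi ι p) = Ex p f := by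
  unfold bernoulliPi
  rw [integral_finsetSum_measure]
  · refine Finset.sum_congr rfl fun x _ => ?_
    rw [integral_smul_measure, integral_dirac]
    congr 1
    rw [ENNReal.toReal_prod]
    refine Finset.prod_congr rfl fun i _ => ?_
    rw [ENNReal.toReal_ofReal]
    · rfl
    · split_ifs <;> linarith
  · intro x _
    refine (Integrable.of_finite).smul_measure ?_
    exact (ENNReal.prod_lt_top fun i _ => ENNReal.ofReal_lt_top).ne

lemma integral_finUniform {γ : Type*} [Fintype γ] [MeasurableSpace γ] [MeasurableSingletonClass γ]
    (s : Set γ) (F : Finset γ) (hF : ∀ x, x ∈ F ↔ x ∈ s) (f : γ → ℂ) :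
    ∫ x, f x ∂(finUniform s) = ((F.card : ℝ))⁻¹ • ∑ a ∈ F, f a := by
  classical
  have hs : s = (F : Set γ) := by ext x; simp [hF]
  subst hs
  unfold finUniform
  rw [integral_smul_measure, integral_finsetSum_measure]
  · rw [Nat.card_eq_card_toFinset, ENNReal.toReal_inv, ENNReal.toReal_natCast]
    simp only [Finset.toFinset_coe]
    congr 1
    have : ∀ a, (∫ x, f x ∂((F : Set γ).indicator (fun _ => (1 : ℝ≥0∞)) a • Measure.dirac a)) =
        if a ∈ F then f a else 0 := by
      intro a
      rw [integral_smul_measure, integral_dirac]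
      by_cases h : a ∈ F <;> simp [h]
    simp only [this]
    rw [Finset.sum_ite_mem, Finset.univ_inter]
  · intro x _
    refine (Integrable.of_finite).smul_measure ?_
    by_cases h : x ∈ F <;> simp [h]

lemma mode_step_up (m k j : ℕ) (hj : j < m) :
    (m + k).choose j * m ^ j * k ^ (m + k - j) ≤
      (m + k).choose (j + 1) * m ^ (j + 1) * k ^ (m + k - (j + 1)) := by
  have e : m + k - j = (m + k - (j + 1)) + 1 := by omega
  have hc := Nat.choose_succ_right_eq (m + k) j
  have hin : (j + 1) * k ≤ (m + k - j) * m := by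
    calc (j + 1) * k ≤ m * k := Nat.mul_le_mul_right _ hj
      _ = k * m := mul_comm _ _
      _ ≤ (m + k - j) * m := Nat.mul_le_mul_right _ (by omega)
  refine Nat.le_of_mul_le_mul_left ?_ (show 0 < j + 1 by omega)
  calc (j + 1) * ((m + k).choose j * m ^ j * k ^ (m + k - j))
      = ((m + k).choose j * m ^ j * k ^ (m + k - (j + 1))) * ((j + 1) * k) := by
        conv_lhs => rw [e]
        rw [pow_succ]; ring
    _ ≤ ((m + k).choose j * m ^ j * k ^ (m + k - (j + 1))) * ((m + k - j) * m) :=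
        Nat.mul_le_mul_left _ hin
    _ = ((m + k).choose j * (m + k - j)) * m ^ (j + 1) * k ^ (m + k - (j + 1)) := by
        rw [pow_succ m j]; ring
    _ = _ := by rw [← hc]; ring

lemma mode_step_down (m k j : ℕ) (hj : m ≤ j) (hj2 : j < m + k) :
    (m + k).choose (j + 1) * m ^ (j + 1) * k ^ (m + k - (j + 1)) ≤
      (m + k).choose j * m ^ j * k ^ (m + k - j) := by
  have e : m + k - j = (m + k - (j + 1)) + 1 := by omega
  have hc := Nat.choose_succ_right_eq (m + k) j
  have hin : (m + k - j) * m ≤ (j + 1) * k := by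
    calc (m + k - j) * m ≤ k * (j + 1) := Nat.mul_le_mul (by omega) (by omega)
      _ = _ := mul_comm _ _
  refine Nat.le_of_mul_le_mul_left ?_ (show 0 < j + 1 by omega)
  calc (j + 1) * ((m + k).choose (j + 1) * m ^ (j + 1) * k ^ (m + k - (j + 1)))
      = ((m + k).choose (j + 1) * (j + 1)) * m ^ (j + 1) * k ^ (m + k - (j + 1)) := by ring
    _ = ((m + k).choose j * m ^ j * k ^ (m + k - (j + 1))) * ((m + k - j) * m) := by
        rw [hc, pow_succ m j]; ring
    _ ≤ ((m + k).choose j * m ^ j * k ^ (m + k - (j + 1))) * ((j + 1) * k) :=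
        Nat.mul_le_mul_left _ hin
    _ = _ := by
        conv_rhs => rw [e]
        rw [pow_succ]; ring

lemma mode_le (m k j : ℕ) (hj : j ≤ m + k) :
    (m + k).choose j * m ^ j * k ^ (m + k - j) ≤ (m + k).choose m * m ^ m * k ^ k := by
  have base : (m + k).choose m * m ^ m * k ^ (m + k - m) = (m + k).choose m * m ^ m * k ^ k := by
    rw [Nat.add_sub_cancel_left]
  rw [← base]
  rcases le_total j m with h | h
  · exact Nat.decreasingInduction
      (motive := fun j _ => (m + k).choose j * m ^ j * k ^ (m + k - j) ≤
        (m + k).choose m * m ^ m * k ^ (m + k - m))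
      (fun i hi ih => (mode_step_up m k i hi).trans ih) le_rfl h
  · induction j, h using Nat.le_induction with
    | base => exact le_rfl
    | succ i hi ih => exact (mode_step_down m k i hi (by omega)).trans (ih (by omega))

lemma mode_bound (m k : ℕ) (hN : 0 < m + k) :
    (1 : ℝ) ≤ ((m + k : ℕ) + 1 : ℝ) * ((m + k).choose m *
      (((m : ℝ) / (m + k : ℕ)) ^ m * (1 - (m : ℝ) / (m + k : ℕ)) ^ k)) := by
  have h1 : (m + k) ^ (m + k) ≤ (m + k + 1) * ((m + k).choose m * m ^ m * k ^ k) := by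
    rw [add_pow]
    calc _ ≤ ∑ j ∈ Finset.range (m + k + 1), (m + k).choose m * m ^ m * k ^ k := by
          refine Finset.sum_le_sum fun j hj => ?_
          have := mode_le m k j (by simpa [Nat.lt_succ_iff] using hj)
          calc _ = (m + k).choose j * m ^ j * k ^ (m + k - j) := by push_cast; ring
            _ ≤ _ := this
      _ = _ := by simp
  have hNr : (0 : ℝ) < (m + k : ℕ) := by exact_mod_cast hN
  have e : 1 - (m : ℝ) / (m + k : ℕ) = (k : ℝ) / (m + k : ℕ) := by
    field_simp; push_cast; ring
  rw [e, div_pow, div_pow]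
  have h2 : ((m + k : ℕ) : ℝ) ^ (m + k) ≤ ((m + k : ℕ) + 1 : ℝ) * ((m + k).choose m * m ^ m * k ^ k) := by
    exact_mod_cast h1
  have : ((m + k : ℕ) + 1 : ℝ) * ((m + k).choose m * ((m : ℝ) ^ m / ((m + k : ℕ) : ℝ) ^ m * ((k : ℝ) ^ k / ((m + k : ℕ) : ℝ) ^ k))) =
      (((m + k : ℕ) + 1 : ℝ) * ((m + k).choose m * m ^ m * k ^ k)) / ((m + k : ℕ) : ℝ) ^ (m + k) := by
    rw [pow_add]; field_simp
  rw [this, le_div_iff₀ (by positivity), one_mul]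
  exact h2

variable {n : ℕ}

/-- number of edges -/
def cnt (x : Sym2 (Fin n) → Bool) : ℕ :=
  (Finset.univ.filter fun e : Sym2 (Fin n) => ¬ e.IsDiag ∧ x e = true).card

lemma cnt_eq (x : Sym2 (Fin n) → Bool) :
    (cnt x : ℝ) = ∑ e, (if ¬ e.IsDiag ∧ x e = true then (1 : ℝ) else 0) := by
  unfold cnt; simp

lemma card_nondiag : (Finset.univ.filter fun e : Sym2 (Fin n) => ¬ e.IsDiag).card = n.choose 2 := by
  have := Sym2.card_subtype_not_diag (α := Fin n)
  rw [Fintype.card_subtype, Fintype.card_fin] at this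
  exact this

lemma cnt_le (x : Sym2 (Fin n) → Bool) : cnt x ≤ n.choose 2 := by
  rw [← card_nondiag]
  refine Finset.card_le_card fun e he => ?_
  simp only [Finset.mem_filter, Finset.mem_univ, true_and] at he ⊢
  exact he.1

/-- the slice -/
def slice (n m : ℕ) : Finset (Sym2 (Fin n) → Bool) :=
  Finset.univ.filter fun x => (∀ e : Sym2 (Fin n), e.IsDiag → x e = false) ∧
    (Finset.univ.filter fun e : Sym2 (Fin n) => x e = true).card = m

lemma slice_card (n m : ℕ) : (slice n m).card = (n.choose 2).choose m := by
  rw [← card_nondiag, ← Finset.card_powersetCard]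
  refine Finset.card_bij (fun x _ => Finset.univ.filter fun e => x e = true) ?_ ?_ ?_
  · intro x hx
    simp only [slice, Finset.mem_filter, Finset.mem_univ, true_and] at hx
    rw [Finset.mem_powersetCard]
    refine ⟨fun e he => ?_, hx.2⟩
    simp only [Finset.mem_filter, Finset.mem_univ, true_and] at he ⊢
    intro hd
    rw [hx.1 e hd] at he; cases he
  · intro x _ y _ h
    funext e
    have := congrArg (fun s => e ∈ s) h
    simp only [Finset.mem_filter, Finset.mem_univ, true_and, eq_iff_iff] at this
    exact Bool.eq_iff_iff.2 this
  · intro S hS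
    rw [Finset.mem_powersetCard] at hS
    refine ⟨fun e => decide (e ∈ S), ?_, ?_⟩
    · simp only [slice, Finset.mem_filter, Finset.mem_univ, true_and, decide_eq_true_eq,
        decide_eq_false_iff_not, Finset.filter_univ_mem]
      refine ⟨fun e hd he => ?_, hS.2⟩
      have := hS.1 he
      simp only [Finset.mem_filter, Finset.mem_univ, true_and] at this
      exact this hd
    · simp

/-- erase the diagonal -/
def offd (x : Sym2 (Fin n) → Bool) : Sym2 (Fin n) → Bool :=
  fun e => if e.IsDiag then false else x e

lemma offd_mem (x : Sym2 (Fin n) → Bool) (m : ℕ) : offd x ∈ slice n m ↔ cnt x = m := by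
  simp only [slice, Finset.mem_filter, Finset.mem_univ, true_and]
  have h1 : ∀ e : Sym2 (Fin n), e.IsDiag → offd x e = false := fun e he => by simp [offd, he]
  have h2 : (Finset.univ.filter fun e : Sym2 (Fin n) => offd x e = true) =
      (Finset.univ.filter fun e : Sym2 (Fin n) => ¬ e.IsDiag ∧ x e = true) := by
    ext e; simp only [Finset.mem_filter, Finset.mem_univ, true_and, offd]
    by_cases h : e.IsDiag <;> simp [h]
  rw [h2]
  exact ⟨fun h => h.2, fun h => ⟨h1, h⟩⟩

lemma fiber_weight {p : ℝ} {m : ℕ} (a : Sym2 (Fin n) → Bool) (ha : a ∈ slice n m) :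
    Ex p (fun x => if offd x = a then (1 : ℝ) else 0) = p ^ m * (1 - p) ^ (n.choose 2 - m) := by
  simp only [slice, Finset.mem_filter, Finset.mem_univ, true_and] at ha
  have e : ∀ x : Sym2 (Fin n) → Bool, (if offd x = a then (1 : ℝ) else 0) =
      ∏ e, (if e.IsDiag then 1 else if x e = a e then 1 else 0) := by
    intro x
    split_ifs with h
    · rw [Finset.prod_eq_one]
      intro e _
      by_cases hd : e.IsDiag
      · simp [hd]
      · simp [hd, ← h, offd]
    · have : ∃ e, offd x e ≠ a e := by
        by_contra hc; push Not at hc; exact h (funext hc)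
      obtain ⟨e, he⟩ := this
      symm
      refine Finset.prod_eq_zero (Finset.mem_univ e) ?_
      by_cases hd : e.IsDiag
      · simp [offd, hd, ha.1 e hd] at he
      · simp only [offd, hd, if_false] at he
        simp [hd, he]
  simp only [e]
  refine (Ex_prod (fun e b => if e.IsDiag then (1 : ℝ) else if b = a e then 1 else 0)).trans ?_
  have e2 : ∀ e : Sym2 (Fin n), ∑ b, wt p b * (if e.IsDiag then (1 : ℝ) else if b = a e then 1 else 0) =
      (if a e = true then p else 1) * (if ¬ e.IsDiag ∧ a e = false then (1 - p) else 1) := by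
    intro e
    by_cases hd : e.IsDiag
    · simp [hd, ha.1 e hd, wt]
    · cases h : a e <;> simp [hd, h, wt]
  simp only [e2]
  rw [Finset.prod_mul_distrib, Finset.prod_ite, Finset.prod_ite]
  simp only [Finset.prod_const, one_pow, mul_one]
  rw [ha.2]
  congr 2
  rw [← card_nondiag, ← ha.2]
  rw [← Finset.card_sdiff_of_subset]
  · congr 1
    ext e
    simp only [Finset.mem_filter, Finset.mem_univ, true_and, Finset.mem_sdiff, Bool.not_eq_true]
  · intro e he
    simp only [Finset.mem_filter, Finset.mem_univ, true_and] at he ⊢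
    intro hd; rw [ha.1 e hd] at he; cases he

lemma slice_sum {p : ℝ} {m : ℕ} (f : (Sym2 (Fin n) → Bool) → ℂ)
    (hf : ∀ x y, (∀ e, ¬ e.IsDiag → x e = y e) → f x = f y) :
    Ex p (fun x => (if cnt x = m then (1 : ℂ) else 0) * f x) =
      ((p ^ m * (1 - p) ^ (n.choose 2 - m) : ℝ) : ℂ) * ∑ a ∈ slice n m, f a := by
  have e : ∀ x, (if cnt x = m then (1 : ℂ) else 0) * f x =
      ∑ a ∈ slice n m, f a * ((if offd x = a then (1 : ℝ) else 0 : ℝ) : ℂ) := by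
    intro x
    have hfx : f (offd x) = f x := hf _ _ fun e he => by simp [offd, he]
    have : ∀ a ∈ slice n m, f a * ((if offd x = a then (1 : ℝ) else 0 : ℝ) : ℂ) =
        if offd x = a then f x else 0 := by
      intro a _
      split_ifs with h
      · rw [← h, hfx]; simp
      · simp
    rw [Finset.sum_congr rfl this, Finset.sum_ite_eq]
    simp only [offd_mem]
    split_ifs <;> simp
  simp only [e]
  rw [Ex_sum, Finset.mul_sum]
  refine Finset.sum_congr rfl fun a ha => ?_
  rw [Ex_cmul_left, Ex_ofReal, fiber_weight a ha, mul_comm]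

lemma root_sum (N c m : ℕ) (hc : c ≤ N) (hm : m ≤ N) :
    ∑ j ∈ Finset.range (N + 1), ee (2 * Real.pi * j / (N + 1) * ((c : ℝ) - m)) =
      if c = m then ((N + 1 : ℕ) : ℂ) else 0 := by
  split_ifs with h
  · subst h; simp [ee]
  · set ζ : ℂ := Complex.exp (2 * Real.pi * Complex.I / ((N + 1 : ℕ) : ℂ)) with hζ
    have hprim : IsPrimitiveRoot ζ (N + 1) := Complex.isPrimitiveRoot_exp (N + 1) (by omega)
    have e : ∀ j ∈ Finset.range (N + 1), ee (2 * Real.pi * j / (N + 1) * ((c : ℝ) - m)) =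
        (ζ ^ ((c : ℤ) - m)) ^ j := by
      intro j _
      rw [← zpow_natCast, ← zpow_mul, hζ, ← Complex.exp_int_mul, ee]
      congr 1; push_cast; ring
    rw [Finset.sum_congr rfl e]
    have h1 : ζ ^ ((c : ℤ) - m) ≠ 1 := by
      intro h1
      have := (hprim.zpow_eq_one_iff_dvd _).1 h1
      obtain ⟨k, hk⟩ := this
      have : |(c : ℤ) - m| < (N + 1 : ℕ) := by rw [abs_lt]; push_cast; constructor <;> omega
      have h3 := Int.eq_zero_of_abs_lt_dvd ⟨k, hk⟩ this
      apply h; omega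
    have h2 : (ζ ^ ((c : ℤ) - m)) ^ (N + 1) = 1 := by
      rw [← zpow_natCast, ← zpow_mul, mul_comm, zpow_mul, zpow_natCast, hprim.pow_eq_one, one_zpow]
    have := mul_geom_sum (ζ ^ ((c : ℤ) - m)) (N + 1)
    rw [h2, sub_self] at this
    exact (mul_eq_zero.1 this).resolve_left (sub_ne_zero.2 h1)

lemma slice_transfer {m : ℕ} {p : ℝ} (hp : p = (m : ℝ) / (n.choose 2)) (h0 : 0 < p) (h1 : p < 1)
    (f : (Sym2 (Fin n) → Bool) → ℂ)
    (hf : ∀ x y, (∀ e, ¬ e.IsDiag → x e = y e) → f x = f y) {Z : ℝ}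
    (hZ : ∀ θ : ℝ, ‖Ex p (fun x => ee (θ * cnt x) * f x)‖ ≤ Z) :
    ‖∫ x, f x ∂(gnm n m)‖ ≤ ((n.choose 2 : ℝ) + 1) * Z := by
  classical
  set N := n.choose 2 with hN
  have hNpos : 0 < N := by
    rcases Nat.eq_zero_or_pos N with h | h
    · rw [hp, h] at h0; simp at h0
    · exact h
  have hNr : (0 : ℝ) < N := by exact_mod_cast hNpos
  have hmN : m ≤ N := by
    rw [hp, div_lt_one hNr] at h1
    exact_mod_cast h1.le
  obtain ⟨k, hk⟩ := Nat.exists_eq_add_of_le hmN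
  have hint : ∫ x, f x ∂(gnm n m) = ((slice n m).card : ℝ)⁻¹ • ∑ a ∈ slice n m, f a := by
    unfold gnm
    rw [integral_finUniform _ (slice n m)]
    · intro x; simp [slice]
  have hS : ‖Ex p (fun x => (if cnt x = m then (1 : ℂ) else 0) * f x)‖ ≤ Z := by
    have e : ∀ x : Sym2 (Fin n) → Bool, (if cnt x = m then (1 : ℂ) else 0) * f x =
        ((N + 1 : ℕ) : ℂ)⁻¹ * ∑ j ∈ Finset.range (N + 1), ee (-(2 * Real.pi * j / (N + 1) * m)) *
          (ee (2 * Real.pi * j / (N + 1) * cnt x) * f x) := by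
      intro x
      have hr := root_sum N (cnt x) m (cnt_le x) hmN
      have h2 : ∀ j ∈ Finset.range (N + 1), ee (-(2 * Real.pi * j / (N + 1) * m)) *
          (ee (2 * Real.pi * j / (N + 1) * cnt x) * f x) =
          ee (2 * Real.pi * j / (N + 1) * ((cnt x : ℝ) - m)) * f x := by
        intro j _
        rw [← mul_assoc, ← ee_add]; congr 2; ring
      rw [Finset.sum_congr rfl h2, ← Finset.sum_mul, hr]
      have : ((N + 1 : ℕ) : ℂ) ≠ 0 := by exact_mod_cast Nat.succ_ne_zero N
      split_ifs
      · rw [← mul_assoc, inv_mul_cancel₀ this]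
      · simp
    simp only [e]
    rw [Ex_cmul_left, Ex_sum, norm_mul, norm_inv, Complex.norm_natCast]
    have : ‖∑ j ∈ Finset.range (N + 1), Ex p (fun x => ee (-(2 * Real.pi * j / (N + 1) * m)) *
          (ee (2 * Real.pi * j / (N + 1) * cnt x) * f x))‖ ≤ (N + 1 : ℕ) * Z := by
      refine (norm_sum_le _ _).trans ?_
      calc _ ≤ ∑ j ∈ Finset.range (N + 1), Z := by
            refine Finset.sum_le_sum fun j _ => ?_
            rw [Ex_cmul_left, norm_mul, ee_norm, one_mul]
            exact hZ _
        _ = _ := by simp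
    rw [inv_mul_le_iff₀ (by positivity)]
    exact this
  rw [slice_sum f hf, norm_mul, Complex.norm_real] at hS
  have hmode := mode_bound m k (by omega)
  rw [← hk, ← hp] at hmode
  have hkk : N - m = k := by omega
  rw [← hN, hkk] at hS
  have hw : 0 < p ^ m * (1 - p) ^ k := by
    have : 0 < 1 - p := by linarith
    positivity
  rw [Real.norm_of_nonneg hw.le] at hS
  rw [hint, norm_smul, norm_inv, Real.norm_natCast, slice_card, ← hN]
  have hC : (0 : ℝ) < N.choose m := by exact_mod_cast Nat.choose_pos hmN
  rw [inv_mul_le_iff₀ hC]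
  set G := ‖∑ a ∈ slice n m, f a‖ with hG
  have hG0 : 0 ≤ G := norm_nonneg _
  calc G = 1 * G := (one_mul _).symm
    _ ≤ (((N : ℝ) + 1) * (N.choose m * (p ^ m * (1 - p) ^ k))) * G :=
        mul_le_mul_of_nonneg_right hmode hG0
    _ = (((N : ℝ) + 1) * N.choose m) * (p ^ m * (1 - p) ^ k * G) := by ring
    _ ≤ (((N : ℝ) + 1) * N.choose m) * Z := by gcongr
    _ = _ := by ring

end slice
end GS

set_option linter.unusedSectionVars false
set_option linter.unusedSimpArgs false
set_option linter.unusedVariables false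

namespace GS

section copies
variable {ℓ n : ℕ}

/-- `S` spans a copy of `G` -/
def Copy (G : SimpleGraph (Fin ℓ)) (S : Finset (Sym2 (Fin n))) : Prop :=
  ∃ f : Fin ℓ ↪ Fin n, (↑S : Set (Sym2 (Fin n))) = Sym2.map f '' G.edgeSet

open Classical in
/-- vertices of an edge set -/
noncomputable def vs (S : Finset (Sym2 (Fin n))) : Finset (Fin n) :=
  Finset.univ.filter fun w => ∃ e ∈ S, w ∈ e

lemma mem_vs {S : Finset (Sym2 (Fin n))} {w : Fin n} : w ∈ vs S ↔ ∃ e ∈ S, w ∈ e := by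
  simp [vs]

lemma sub_vs (S : Finset (Sym2 (Fin n))) : S ⊆ (vs S).sym2 := by
  intro e he
  rw [Finset.mem_sym2_iff]
  intro w hw
  exact mem_vs.2 ⟨e, he, hw⟩

lemma copy_mem {G : SimpleGraph (Fin ℓ)} {S : Finset (Sym2 (Fin n))} {f : Fin ℓ ↪ Fin n}
    (h : (↑S : Set (Sym2 (Fin n))) = Sym2.map f '' G.edgeSet) {a b : Fin ℓ} :
    s(f a, f b) ∈ S ↔ G.Adj a b := by
  rw [← Finset.mem_coe, h]
  constructor
  · rintro ⟨e, he, h2⟩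
    have : e = s(a, b) := Sym2.map.injective f.injective (by rw [h2]; rfl)
    rw [this] at he; exact he
  · intro hab; exact ⟨s(a, b), hab, rfl⟩

lemma copy_mem_vs {G : SimpleGraph (Fin ℓ)} {S : Finset (Sym2 (Fin n))} {f : Fin ℓ ↪ Fin n}
    (h : (↑S : Set (Sym2 (Fin n))) = Sym2.map f '' G.edgeSet) {w : Fin n} :
    w ∈ vs S ↔ ∃ a ∈ G.support, f a = w := by
  rw [mem_vs]
  constructor
  · rintro ⟨e, he, hw⟩
    rw [← Finset.mem_coe, h] at he
    obtain ⟨e', he', rfl⟩ := he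
    rw [Sym2.mem_map] at hw
    obtain ⟨a, ha, rfl⟩ := hw
    refine ⟨a, ?_, rfl⟩
    obtain ⟨b, rfl⟩ := ha
    exact ⟨b, he'⟩
  · rintro ⟨a, ⟨b, hab⟩, rfl⟩
    exact ⟨s(f a, f b), (copy_mem h).2 hab, by simp⟩

lemma copy_vs_card {G : SimpleGraph (Fin ℓ)} {S : Finset (Sym2 (Fin n))} {f : Fin ℓ ↪ Fin n}
    (h : (↑S : Set (Sym2 (Fin n))) = Sym2.map f '' G.edgeSet) :
    (vs S).card = Nat.card G.support := by
  classical
  have : vs S = (G.support.toFinset).image f := by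
    ext w; rw [copy_mem_vs h]; simp
  rw [this, Finset.card_image_of_injective _ f.injective, Nat.card_eq_card_toFinset]

lemma copy_unique {G G' : SimpleGraph (Fin ℓ)} {S : Finset (Sym2 (Fin n))}
    (h : Copy G S) (h' : Copy G' S) : Nonempty (G ≃g G') := by
  classical
  obtain ⟨f, hf⟩ := h
  obtain ⟨f', hf'⟩ := h'
  have k1 : ∀ a : {a // a ∈ G.support}, ∃ b : {b // b ∈ G'.support}, f' b = f a := by
    rintro ⟨a, ha⟩
    obtain ⟨b, hb, hab⟩ := (copy_mem_vs hf').1 ((copy_mem_vs hf).2 ⟨a, ha, rfl⟩)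
    exact ⟨⟨b, hb⟩, hab⟩
  have k2 : ∀ b : {b // b ∈ G'.support}, ∃ a : {a // a ∈ G.support}, f a = f' b := by
    rintro ⟨a, ha⟩
    obtain ⟨b, hb, hab⟩ := (copy_mem_vs hf).1 ((copy_mem_vs hf').2 ⟨a, ha, rfl⟩)
    exact ⟨⟨b, hb⟩, hab⟩
  choose g1 hg1 using k1
  choose g2 hg2 using k2
  let E : {a // a ∈ G.support} ≃ {b // b ∈ G'.support} :=
    { toFun := g1
      invFun := g2
      left_inv := fun a => Subtype.ext (f.injective (by rw [hg2, hg1]))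
      right_inv := fun a => Subtype.ext (f'.injective (by rw [hg1, hg2])) }
  have hE : ∀ a (ha : a ∈ G.support), f' (E.extendSubtype a) = f a := by
    intro a ha
    rw [Equiv.extendSubtype_apply_of_mem E a ha]
    exact hg1 ⟨a, ha⟩
  refine ⟨⟨E.extendSubtype, ?_⟩⟩
  intro a b
  by_cases ha : a ∈ G.support
  · by_cases hb : b ∈ G.support
    · rw [← copy_mem hf, ← copy_mem hf', hE a ha, hE b hb]
    · constructor
      · intro h
        exact absurd ⟨_, h.symm⟩ (E.extendSubtype_not_mem b hb)
      · intro h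
        exact absurd ⟨_, h.symm⟩ hb
  · constructor
    · intro h
      exact absurd ⟨_, h⟩ (E.extendSubtype_not_mem a ha)
    · intro h
      exact absurd ⟨_, h⟩ ha

open Classical in
lemma graphFactor_eq (G : SimpleGraph (Fin ℓ)) (p : ℝ) (x : Sym2 (Fin n) → Bool) :
    graphFactor G p x = ∑ S : Finset (Sym2 (Fin n)), if Copy G S then mon p S x else 0 := by
  unfold graphFactor
  refine Finset.sum_congr rfl fun S _ => ?_
  unfold Copy mon ch
  split_ifs <;> rfl

open Classical in
/-- coefficient of a monomial for a family `𝒢` -/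
noncomputable def coef (n : ℕ) (𝒢 : Finset (SimpleGraph (Fin ℓ))) (Δ : SimpleGraph (Fin ℓ) → ℝ)
    (S : Finset (Sym2 (Fin n))) : ℝ :=
  ∑ G ∈ 𝒢, if Copy G S then (n : ℝ) ^ (ℓ - Nat.card G.support) * Δ G else 0

lemma coef_expand (𝒢 : Finset (SimpleGraph (Fin ℓ))) (Δ : SimpleGraph (Fin ℓ) → ℝ) (p : ℝ)
    (x : Sym2 (Fin n) → Bool) :
    ∑ G ∈ 𝒢, (n : ℝ) ^ (ℓ - Nat.card G.support) * Δ G * graphFactor G p x =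
      ∑ S, coef n 𝒢 Δ S * mon p S x := by
  classical
  simp only [graphFactor_eq, coef, Finset.sum_mul, Finset.mul_sum]
  rw [Finset.sum_comm]
  refine Finset.sum_congr rfl fun S _ => Finset.sum_congr rfl fun G _ => ?_
  split_ifs <;> simp

/-- the remaining graphs -/
noncomputable def rest (ℋ : Finset (SimpleGraph (Fin ℓ))) : Finset (SimpleGraph (Fin ℓ)) :=
  ℋ.filter fun G => Nat.card G.support ≠ 0 ∧ Nat.card G.support ≠ 2

lemma stat_sub (ℋ : Finset (SimpleGraph (Fin ℓ))) (Δ : SimpleGraph (Fin ℓ) → ℝ) (p : ℝ)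
    (x : Sym2 (Fin n) → Bool) :
    graphStat ℓ ℋ Δ p x - graphStatPart ℓ ℋ Δ p 0 x - graphStatPart ℓ ℋ Δ p 2 x =
      ∑ S, coef n (rest ℋ) Δ S * mon p S x := by
  rw [← coef_expand]
  unfold graphStat graphStatPart rest
  rw [Finset.sum_filter, Finset.sum_filter, Finset.sum_filter, ← Finset.sum_sub_distrib,
    ← Finset.sum_sub_distrib]
  refine Finset.sum_congr rfl fun G _ => ?_
  by_cases h0 : Nat.card G.support = 0
  · simp [h0]
  · by_cases h2 : Nat.card G.support = 2
    · simp [h0, h2]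
    · rw [if_neg h0, if_neg h2, if_pos ⟨h0, h2⟩]; ring

lemma part_eq (ℋ : Finset (SimpleGraph (Fin ℓ))) (Δ : SimpleGraph (Fin ℓ) → ℝ) (p : ℝ) (k : ℕ)
    (x : Sym2 (Fin n) → Bool) :
    graphStatPart ℓ ℋ Δ p k x =
      ∑ S, coef n (ℋ.filter fun G => Nat.card G.support = k) Δ S * mon p S x := by
  rw [← coef_expand]; rfl

lemma coef_eq {𝒢 : Finset (SimpleGraph (Fin ℓ))} (Δ : SimpleGraph (Fin ℓ) → ℝ)
    (hu : ∀ G₁ ∈ 𝒢, ∀ G₂ ∈ 𝒢, Nonempty (G₁ ≃g G₂) → G₁ = G₂)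
    {G : SimpleGraph (Fin ℓ)} (hG : G ∈ 𝒢) {S : Finset (Sym2 (Fin n))} (hS : Copy G S) :
    coef n 𝒢 Δ S = (n : ℝ) ^ (ℓ - Nat.card G.support) * Δ G := by
  classical
  unfold coef
  rw [Finset.sum_eq_single_of_mem G hG, if_pos hS]
  intro G' hG' hne
  rw [if_neg]
  intro h
  exact hne (hu _ hG' _ hG (copy_unique h hS))

lemma coef_ne {𝒢 : Finset (SimpleGraph (Fin ℓ))} {Δ : SimpleGraph (Fin ℓ) → ℝ}
    {S : Finset (Sym2 (Fin n))} (h : coef n 𝒢 Δ S ≠ 0) : ∃ G ∈ 𝒢, Copy G S := by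
  classical
  by_contra hc
  push Not at hc
  apply h
  unfold coef
  refine Finset.sum_eq_zero fun G hG => ?_
  rw [if_neg (hc G hG)]

lemma card_sym2_le {X : Finset (Fin n)} (h : X.card ≤ ℓ) : X.sym2.card ≤ ℓ ^ 2 := by
  rw [Finset.card_sym2]
  calc (X.card + 1).choose 2 ≤ (ℓ + 1).choose 2 := Nat.choose_le_choose 2 (by omega)
    _ ≤ ℓ ^ 2 := by
      rw [Nat.choose_two_right]
      simp only [Nat.add_sub_cancel]
      refine Nat.div_le_of_le_mul ?_
      rcases Nat.eq_zero_or_pos ℓ with h | h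
      · subst h; simp
      · nlinarith

/-- summary of the properties of the coefficients -/
structure GoodCoef (ℓ n : ℕ) (lam : ℝ) (q : Finset (Sym2 (Fin n)) → ℝ) : Prop where
  vcard : ∀ S, q S ≠ 0 → (vs S).card ≤ ℓ
  bound : ∀ S, q S ≠ 0 → |q S| ≤ (n : ℝ) ^ (ℓ - (vs S).card) / lam
  cover : ∀ S, q S ≠ 0 → ∃ f : Fin ℓ → Fin n, vs S ⊆ Finset.univ.image f
  nodiag : ∀ S, q S ≠ 0 → ∀ e ∈ S, ¬ e.IsDiag

lemma goodCoef {𝒢 : Finset (SimpleGraph (Fin ℓ))} {Δ : SimpleGraph (Fin ℓ) → ℝ} {lam : ℝ}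
    (hu : ∀ G₁ ∈ 𝒢, ∀ G₂ ∈ 𝒢, Nonempty (G₁ ≃g G₂) → G₁ = G₂)
    (hΔ : ∀ G ∈ 𝒢, |Δ G| ≤ 1 / lam) : GoodCoef ℓ n lam (coef n 𝒢 Δ) := by
  classical
  refine ⟨?_, ?_, ?_, ?_⟩
  · intro S hS
    obtain ⟨G, hG, f, hf⟩ := coef_ne hS
    rw [copy_vs_card hf]
    calc Nat.card G.support ≤ Nat.card (Fin ℓ) := Finite.card_subtype_le _
      _ = ℓ := by simp
  · intro S hS
    obtain ⟨G, hG, hc⟩ := coef_ne hS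
    obtain ⟨f, hf⟩ := hc
    rw [coef_eq Δ hu hG ⟨f, hf⟩, copy_vs_card hf, abs_mul, abs_of_nonneg (by positivity)]
    calc _ ≤ (n : ℝ) ^ (ℓ - Nat.card G.support) * (1 / lam) :=
          mul_le_mul_of_nonneg_left (hΔ G hG) (by positivity)
      _ = _ := by ring
  · intro S hS
    obtain ⟨G, hG, f, hf⟩ := coef_ne hS
    refine ⟨f, fun w hw => ?_⟩
    obtain ⟨a, _, rfl⟩ := (copy_mem_vs hf).1 hw
    simp
  · intro S hS e he
    obtain ⟨G, hG, f, hf⟩ := coef_ne hS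
    rw [← Finset.mem_coe, hf] at he
    obtain ⟨e', he', rfl⟩ := he
    rw [Sym2.isDiag_map f.injective]
    exact G.not_isDiag_of_mem_edgeSet he'

lemma count_le {Θ : Type*} [Fintype Θ] (g : Θ → Finset (Fin n)) (hg : ∀ θ, (g θ).card ≤ ℓ)
    (𝒜 : Finset (Finset (Sym2 (Fin n)))) (h : ∀ S ∈ 𝒜, ∃ θ, vs S ⊆ g θ) :
    𝒜.card ≤ Fintype.card Θ * 2 ^ ℓ ^ 2 := by
  classical
  have hsub : 𝒜 ⊆ Finset.univ.biUnion fun θ => (g θ).sym2.powerset := by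
    intro S hS
    obtain ⟨θ, hθ⟩ := h S hS
    simp only [Finset.mem_biUnion, Finset.mem_univ, true_and, Finset.mem_powerset]
    exact ⟨θ, (sub_vs S).trans (Finset.sym2_mono hθ)⟩
  refine (Finset.card_le_card hsub).trans (Finset.card_biUnion_le.trans ?_)
  calc _ ≤ ∑ θ : Θ, 2 ^ ℓ ^ 2 := Finset.sum_le_sum fun θ _ => by
        rw [Finset.card_powerset]
        exact Nat.pow_le_pow_right (by norm_num) (card_sym2_le (hg θ))
    _ = _ := by simp

lemma GoodCoef.card_le {lam : ℝ} {q : Finset (Sym2 (Fin n)) → ℝ} (h : GoodCoef ℓ n lam q)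
    {S : Finset (Sym2 (Fin n))} (hS : q S ≠ 0) : S.card ≤ ℓ ^ 2 :=
  (Finset.card_le_card (sub_vs S)).trans (card_sym2_le (h.vcard S hS))

lemma GoodCoef.count {lam : ℝ} {q : Finset (Sym2 (Fin n)) → ℝ} (h : GoodCoef ℓ n lam q)
    (𝒜 : Finset (Finset (Sym2 (Fin n)))) (hA : ∀ S ∈ 𝒜, q S ≠ 0) : 𝒜.card ≤ n ^ ℓ * 2 ^ ℓ ^ 2 := by
  classical
  have := count_le (ℓ := ℓ) (fun f : Fin ℓ → Fin n => Finset.univ.image f)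
    (fun f => Finset.card_image_le.trans (by simp)) 𝒜 (fun S hS => h.cover S (hA S hS))
  simpa using this

lemma exists_option_fun {α β : Type*} (R : α → β → Prop) (hR : ∀ a b b', R a b → R a b' → b = b') :
    ∃ g : α → Option β, ∀ a b, g a = some b ↔ R a b := by
  classical
  refine ⟨fun a => if h : ∃ b, R a b then some h.choose else none, fun a b => ?_⟩
  constructor
  · intro h
    dsimp only at h
    split_ifs at h with h1
    have := h1.choose_spec
    rwa [Option.some.inj h] at this
  · intro h
    have h1 : ∃ b, R a b := ⟨b, h⟩
    simp only [dif_pos h1]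
    rw [hR a _ _ h1.choose_spec h]

end copies
end GS

set_option linter.unusedSectionVars false
set_option linter.unusedSimpArgs false
set_option linter.unusedVariables false

namespace GS

section groups
variable {ℓ n M u k : ℕ}

/-- `e` lies in group `i` and has colour `q` -/
def ER (v : Fin M × Fin ℓ × Fin u ↪ Fin n) (i : Fin M) (q : Sym2 (Fin ℓ)) (e : Sym2 (Fin n)) : Prop :=
  ∃ a b a' b', e = s(v (i, a, b), v (i, a', b')) ∧ q = s(a, a')

lemma ER_fun {v : Fin M × Fin ℓ × Fin u ↪ Fin n} {i i' : Fin M} {q q' : Sym2 (Fin ℓ)}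
    {e : Sym2 (Fin n)} (h : ER v i q e) (h' : ER v i' q' e) : i = i' ∧ q = q' := by
  obtain ⟨a, b, a', b', rfl, rfl⟩ := h
  obtain ⟨c, d, c', d', h1, rfl⟩ := h'
  rw [Sym2.eq_iff] at h1
  rcases h1 with ⟨h1, h2⟩ | ⟨h1, h2⟩
  · have := v.injective h1
    have h3 := v.injective h2
    simp only [Prod.mk.injEq] at this h3
    exact ⟨this.1, by rw [this.2.1, h3.2.1]⟩
  · have := v.injective h1
    have h3 := v.injective h2
    simp only [Prod.mk.injEq] at this h3
    exact ⟨this.1, by rw [this.2.1, h3.2.1, Sym2.eq_swap]⟩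

variable {v : Fin M × Fin ℓ × Fin u ↪ Fin n} {H : SimpleGraph (Fin ℓ)}
  {c : Sym2 (Fin n) → Option (Sym2 (Fin ℓ))} (hc : ∀ e q, c e = some q ↔ ∃ i, ER v i q e)
  {eg : Sym2 (Fin n) → Option (Fin M)} (heg : ∀ e i, eg e = some i ↔ ∃ q, ER v i q e)
  {T : Finset (Sym2 (Fin ℓ))} (hT : ∀ q, q ∈ T ↔ q ∈ H.edgeSet)
  {S : Finset (Sym2 (Fin n))}

include hc hT in
lemma full_edge (hS : Full c T S) {a a' : Fin ℓ} (h : H.Adj a a') :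
    ∃ i b b', v (i, a, b) ∈ vs S ∧ v (i, a', b') ∈ vs S := by
  obtain ⟨e, he, hce⟩ := hS s(a, a') ((hT _).2 h)
  obtain ⟨i, a1, b1, a2, b2, rfl, h2⟩ := (hc _ _).1 hce
  rw [Sym2.eq_iff] at h2
  have m1 : v (i, a1, b1) ∈ vs S := mem_vs.2 ⟨_, he, by simp⟩
  have m2 : v (i, a2, b2) ∈ vs S := mem_vs.2 ⟨_, he, by simp⟩
  rcases h2 with ⟨rfl, rfl⟩ | ⟨rfl, rfl⟩
  · exact ⟨i, b1, b2, m1, m2⟩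
  · exact ⟨i, b2, b1, m2, m1⟩

open Classical in
/-- transversal -/
noncomputable def tr (v : Fin M × Fin ℓ × Fin u ↪ Fin n) (H : SimpleGraph (Fin ℓ))
    (τ : H.support → Fin M × Fin u) : Finset (Fin n) :=
  Finset.univ.image fun a : H.support => v ((τ a).1, (a : Fin ℓ), (τ a).2)

lemma mem_tr {τ : H.support → Fin M × Fin u} {w : Fin n} :
    w ∈ tr v H τ ↔ ∃ a : H.support, v ((τ a).1, (a : Fin ℓ), (τ a).2) = w := by
  simp [tr]

lemma tr_card (τ : H.support → Fin M × Fin u) : (tr v H τ).card = Nat.card H.support := by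
  classical
  unfold tr
  rw [Finset.card_image_of_injective]
  · rw [Finset.card_univ, Nat.card_eq_fintype_card]
  · intro a a' h
    have := v.injective h
    simp only [Prod.mk.injEq] at this
    exact Subtype.ext this.2.1

include hc hT in
lemma full_tr (hS : Full c T S) : ∃ τ : H.support → Fin M × Fin u, tr v H τ ⊆ vs S := by
  have : ∀ a : H.support, ∃ t : Fin M × Fin u, v (t.1, (a : Fin ℓ), t.2) ∈ vs S := by
    rintro ⟨a, a', h⟩
    obtain ⟨i, b, b', h1, h2⟩ := full_edge hc hT hS h
    exact ⟨(i, b), h1⟩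
  choose τ hτ using this
  refine ⟨τ, fun w hw => ?_⟩
  obtain ⟨a, rfl⟩ := mem_tr.1 hw
  exact hτ a

include hc hT in
lemma full_card (hS : Full c T S) : Nat.card H.support ≤ (vs S).card := by
  obtain ⟨τ, hτ⟩ := full_tr hc hT hS
  rw [← tr_card (v := v) τ]
  exact Finset.card_le_card hτ

include hc hT in
lemma one_group (hS : Full c T S) (hconn : (H.induce H.support).Connected)
    (hcard : (vs S).card = Nat.card H.support) :
    ∃ i, ∃ φ : H.support → Fin u, vs S = tr v H (fun a => (i, φ a)) := by
  obtain ⟨τ, hτ⟩ := full_tr hc hT hS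
  have heq : tr v H τ = vs S := Finset.eq_of_subset_of_card_le hτ (by rw [tr_card, hcard])
  have hin : ∀ i (a : H.support) b, v (i, (a : Fin ℓ), b) ∈ vs S → i = (τ a).1 := by
    intro i a b h
    rw [← heq, mem_tr] at h
    obtain ⟨a', h⟩ := h
    have := v.injective h
    simp only [Prod.mk.injEq] at this
    have ha : a' = a := Subtype.ext this.2.1
    subst ha; exact this.1.symm
  have hadj : ∀ a a' : H.support, (H.induce H.support).Adj a a' → (τ a).1 = (τ a').1 := by
    intro a a' h
    obtain ⟨i, b, b', h1, h2⟩ := full_edge hc hT hS (a := a) (a' := a') h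
    rw [← hin i a b h1, ← hin i a' b' h2]
  have hreach : ∀ a a' : H.support, (τ a).1 = (τ a').1 := by
    intro a a'
    obtain ⟨w⟩ := hconn.preconnected a a'
    induction w with
    | nil => rfl
    | cons h _ ih => exact (hadj _ _ h).trans ih
  obtain ⟨a0⟩ := hconn.nonempty
  refine ⟨(τ a0).1, fun a => (τ a).2, ?_⟩
  rw [← heq]
  congr 1; funext a
  exact Prod.ext (hreach a a0) rfl

include heg in
lemma tr_group {i : Fin M} {φ : H.support → Fin u} (h : vs S = tr v H (fun a => (i, φ a)))
    {e : Sym2 (Fin n)} (he : e ∈ S) : eg e = some i := by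
  rw [heg]
  induction e with
  | h w w' =>
    have h1 : w ∈ vs S := mem_vs.2 ⟨_, he, by simp⟩
    have h2 : w' ∈ vs S := mem_vs.2 ⟨_, he, by simp⟩
    rw [h, mem_tr] at h1 h2
    obtain ⟨a, rfl⟩ := h1
    obtain ⟨a', rfl⟩ := h2
    exact ⟨s(↑a, ↑a'), a, φ a, a', φ a', rfl, rfl⟩

/-- counting edge sets in a group -/
lemma count_group (hk : Nat.card H.support = k) (i : Fin M) (𝒜 : Finset (Finset (Sym2 (Fin n))))
    (h : ∀ S ∈ 𝒜, ∃ φ : H.support → Fin u, vs S = tr v H (fun a => (i, φ a))) :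
    𝒜.card ≤ u ^ k * 2 ^ ℓ ^ 2 := by
  classical
  have hkl : k ≤ ℓ := by
    rw [← hk]
    calc Nat.card H.support ≤ Nat.card (Fin ℓ) := Finite.card_subtype_le _
      _ = ℓ := by simp
  have := count_le (ℓ := ℓ) (fun φ : H.support → Fin u => tr v H (fun a => (i, φ a)))
    (fun φ => by rw [tr_card, hk]; exact hkl) 𝒜 (fun S hS => by
      obtain ⟨φ, hφ⟩ := h S hS
      exact ⟨φ, hφ.le⟩)
  rwa [Fintype.card_fun, Fintype.card_fin, ← Nat.card_eq_fintype_card, hk] at this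

include hc hT in
lemma count_big (hk : Nat.card H.support = k) {k' : ℕ} (hk' : k ≤ k') (hkl : k' ≤ ℓ)
    (𝒜 : Finset (Finset (Sym2 (Fin n)))) (h : ∀ S ∈ 𝒜, Full c T S ∧ (vs S).card = k') :
    𝒜.card ≤ ((M * u) ^ k * n ^ (k' - k)) * 2 ^ ℓ ^ 2 := by
  classical
  have := count_le (ℓ := ℓ)
    (fun θ : (H.support → Fin M × Fin u) × (Fin (k' - k) → Fin n) =>
      tr v H θ.1 ∪ Finset.univ.image θ.2)
    (fun θ => by
      refine (Finset.card_union_le _ _).trans ?_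
      rw [tr_card, hk]
      have : (Finset.univ.image θ.2).card ≤ k' - k := Finset.card_image_le.trans (by simp)
      omega) 𝒜 (fun S hS => by
      obtain ⟨hF, hcard⟩ := h S hS
      obtain ⟨τ, hτ⟩ := full_tr hc hT hF
      have h2 : (vs S \ tr v H τ).card = k' - k := by
        rw [Finset.card_sdiff_of_subset hτ, tr_card, hk, hcard]
      let E := Finset.equivFinOfCardEq h2
      refine ⟨(τ, fun j => (E.symm j : Fin n)), fun w hw => ?_⟩
      by_cases hwt : w ∈ tr v H τ
      · exact Finset.mem_union_left _ hwt
      · refine Finset.mem_union_right _ ?_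
        rw [Finset.mem_image]
        exact ⟨E ⟨w, Finset.mem_sdiff.2 ⟨hw, hwt⟩⟩, Finset.mem_univ _, by simp⟩)
  rwa [Fintype.card_prod, Fintype.card_fun, Fintype.card_fun, Fintype.card_prod, Fintype.card_fin,
    Fintype.card_fin, Fintype.card_fin, Fintype.card_fin, ← Nat.card_eq_fintype_card, hk] at this

open Classical in
/-- lower bound for the number of copies in a group -/
lemma count_lower (hk : Nat.card H.support = k) (hu : 1 ≤ u) (i : Fin M)
    (hc : ∀ e q, c e = some q ↔ ∃ i, ER v i q e) (hT : ∀ q, q ∈ T ↔ q ∈ H.edgeSet)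
    (𝒜 : Finset (Finset (Sym2 (Fin n))))
    (h : ∀ S, Copy H S → Full c T S → (∃ φ : H.support → Fin u, vs S = tr v H (fun a => (i, φ a))) → S ∈ 𝒜) :
    u ^ k ≤ (𝒜.filter (Copy H)).card := by
  classical
  set ext : (H.support → Fin u) → Fin ℓ → Fin u := fun φ a => if h : a ∈ H.support then φ ⟨a, h⟩ else ⟨0, hu⟩ with hext
  let f : (H.support → Fin u) → (Fin ℓ ↪ Fin n) := fun φ =>
    ⟨fun a => v (i, a, ext φ a), fun a a' h => by
      have := v.injective h
      simp only [Prod.mk.injEq] at this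
      exact this.2.1⟩
  have hf : ∀ φ a, f φ a = v (i, a, ext φ a) := fun _ _ => rfl
  let SS : (H.support → Fin u) → Finset (Sym2 (Fin n)) := fun φ => H.edgeFinset.image (Sym2.map (f φ))
  have hSS : ∀ φ, (↑(SS φ) : Set (Sym2 (Fin n))) = Sym2.map (f φ) '' H.edgeSet := by
    intro φ; simp [SS]
  have hvs : ∀ φ, vs (SS φ) = tr v H (fun a => (i, φ a)) := by
    intro φ
    ext w
    rw [copy_mem_vs (hSS φ), mem_tr]
    constructor
    · rintro ⟨a, ha, rfl⟩
      exact ⟨⟨a, ha⟩, by rw [hf]; simp [hext, ha]⟩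
    · rintro ⟨⟨a, ha⟩, rfl⟩
      exact ⟨a, ha, by rw [hf]; simp [hext, ha]⟩
  have hinj : Function.Injective SS := by
    intro φ ψ hh
    funext a
    have h1 : v (i, (a : Fin ℓ), φ a) ∈ vs (SS φ) := by rw [hvs, mem_tr]; exact ⟨a, rfl⟩
    rw [hh, hvs, mem_tr] at h1
    obtain ⟨a', h2⟩ := h1
    have := v.injective h2
    simp only [Prod.mk.injEq] at this
    have ha : a' = a := Subtype.ext this.2.1
    subst ha
    exact this.2.2.symm
  calc u ^ k = (Finset.univ.image SS).card := by
        rw [Finset.card_image_of_injective _ hinj, Finset.card_univ, Fintype.card_fun,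
          Fintype.card_fin, ← Nat.card_eq_fintype_card, hk]
    _ ≤ _ := by
      refine Finset.card_le_card fun S hS => ?_
      obtain ⟨φ, _, rfl⟩ := Finset.mem_image.1 hS
      have hcopy : Copy H (SS φ) := ⟨f φ, hSS φ⟩
      refine Finset.mem_filter.2 ⟨h _ hcopy ?_ ⟨φ, hvs φ⟩, hcopy⟩
      intro q hq
      rw [hT] at hq
      refine ⟨Sym2.map (f φ) q, ?_, ?_⟩
      · rw [← Finset.mem_coe, hSS]; exact ⟨q, hq, rfl⟩
      · rw [hc]
        refine ⟨i, ?_⟩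
        induction q with
        | h a a' => exact ⟨a, ext φ a, a', ext φ a', rfl, rfl⟩

lemma edges_ge (hk : Nat.card H.support = k) (hk3 : 3 ≤ k) (hT : ∀ q, q ∈ T ↔ q ∈ H.edgeSet) :
    2 ≤ T.card := by
  classical
  have hsub : H.support.toFinset ⊆ T.biUnion fun e => e.toFinset := by
    intro a ha
    simp only [Set.mem_toFinset] at ha
    obtain ⟨b, hab⟩ := ha
    rw [Finset.mem_biUnion]
    exact ⟨s(a, b), (hT _).2 hab, by simp⟩
  have h1 := Finset.card_le_card hsub
  rw [← Nat.card_eq_card_toFinset, hk] at h1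
  have h2 : (T.biUnion fun e => e.toFinset).card ≤ T.card * 2 := by
    refine Finset.card_biUnion_le_card_mul _ _ _ fun e _ => ?_
    rw [Sym2.card_toFinset]; split_ifs <;> omega
  omega

lemma edges_le (T : Finset (Sym2 (Fin ℓ))) : T.card ≤ ℓ ^ 2 := by
  have : T ⊆ (Finset.univ : Finset (Fin ℓ)).sym2 := by simp
  exact (Finset.card_le_card this).trans (card_sym2_le (by simp))

lemma exists_v (h : M * ℓ * u ≤ n) : Nonempty (Fin M × Fin ℓ × Fin u ↪ Fin n) := by
  apply Function.Embedding.nonempty_of_card_le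
  simp only [Fintype.card_prod, Fintype.card_fin]
  rwa [← mul_assoc]

end groups
end GS

set_option linter.unusedSectionVars false
set_option linter.unusedSimpArgs false
set_option linter.unusedVariables false

namespace GS

section core

lemma prod_sq_sum {ι Γ : Type*} (𝒜 : Finset (Finset ι)) (T : Finset Γ) (q : Finset ι → ℝ) :
    ∑ m ∈ 𝒜 ×ˢ T.powerset, ((-1 : ℝ) ^ m.2.card * q m.1) ^ 2 = 2 ^ T.card * ∑ S ∈ 𝒜, q S ^ 2 := by
  rw [Finset.sum_product, Finset.mul_sum]
  refine Finset.sum_congr rfl fun S _ => ?_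
  have : ∀ A ∈ T.powerset, ((-1 : ℝ) ^ A.card * q S) ^ 2 = q S ^ 2 := by
    intro A _
    rw [mul_pow, ← pow_mul, mul_comm A.card, pow_mul]; norm_num
  rw [Finset.sum_congr rfl this, Finset.sum_const, Finset.card_powerset, nsmul_eq_mul]
  push_cast; ring

lemma prod_abs_sum {ι Γ : Type*} (𝒜 : Finset (Finset ι)) (T : Finset Γ) (q : Finset ι → ℝ) :
    ∑ m ∈ 𝒜 ×ˢ T.powerset, |(-1 : ℝ) ^ m.2.card * q m.1| = 2 ^ T.card * ∑ S ∈ 𝒜, |q S| := by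
  rw [Finset.sum_product, Finset.mul_sum]
  refine Finset.sum_congr rfl fun S _ => ?_
  have : ∀ A ∈ T.powerset, |(-1 : ℝ) ^ A.card * q S| = |q S| := by
    intro A _
    rw [abs_mul, abs_pow]; simp
  rw [Finset.sum_congr rfl this, Finset.sum_const, Finset.card_powerset, nsmul_eq_mul]
  push_cast; ring

variable {ℓ n M u k : ℕ} {lam p s : ℝ}

lemma q_bound {cf : Finset (Sym2 (Fin n)) → ℝ} (hl : 0 < lam) (hg : GoodCoef ℓ n lam cf)
    {S : Finset (Sym2 (Fin n))} (hS : cf S ≠ 0) {j : ℕ} (hj : (vs S).card = j) (s : ℝ) :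
    (s * cf S) ^ 2 ≤ (s * (n : ℝ) ^ (ℓ - j)) ^ 2 / lam ^ 2 := by
  have h1 := hg.bound S hS
  rw [hj] at h1
  have h2 : cf S ^ 2 ≤ ((n : ℝ) ^ (ℓ - j) / lam) ^ 2 := by
    rw [← sq_abs]; exact pow_le_pow_left₀ (abs_nonneg _) h1 2
  calc (s * cf S) ^ 2 = s ^ 2 * cf S ^ 2 := by ring
    _ ≤ s ^ 2 * ((n : ℝ) ^ (ℓ - j) / lam) ^ 2 := by gcongr
    _ = _ := by field_simp

/-- main combinatorial estimate -/
lemma core (hl : 0 < lam) (hl1 : lam < 1 / 2) (h0 : lam < p) (h1 : p < 1 - lam) (hn : 1 ≤ n)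
    (hM : 1 ≤ M) (hu : 1 ≤ u) (hMu : M * ℓ * u ≤ n) (H : SimpleGraph (Fin ℓ))
    (hconn : (H.induce H.support).Connected) (hk : Nat.card H.support = k) (hk3 : 3 ≤ k)
    (cf : Finset (Sym2 (Fin n)) → ℝ) (hg : GoodCoef ℓ n lam cf)
    (hH : ∀ S, Copy H S → lam * (n : ℝ) ^ (ℓ - k) ≤ |cf S|) (hs : |s| ≤ 1)
    {y : ℝ} (hy : y = (u : ℝ) ^ k * (s * (n : ℝ) ^ (ℓ - k)) ^ 2)
    (hy0 : 256 * (3 + 1 / lam) ^ (2 * ℓ ^ 2) * (4 ^ ℓ ^ 2 / lam ^ 2 * y) ≤ 1)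
    (g : Sym2 (Fin n) → Bool → ℝ) (b : ℕ) :
    ‖Ex p (fun x => ee (∑ e, g e (x e) + ∑ S, (s * cf S) * mon p S x))‖ ^ (2 ^ ℓ ^ 2) ≤
      2 ^ (b + 1) * ((4 ^ ℓ ^ 2 * (n : ℝ) ^ (2 * ℓ) / lam) * (1 / lam) ^ ℓ ^ 2) ^ (2 ^ (b + 1)) *
        (1 - lam ^ 2 * y / 4) ^ (M - 2 ^ (b + 1) * ℓ ^ 2) +
      4 * ((3 + 1 / lam) ^ (ℓ ^ 2 * b) * (4 ^ ℓ ^ 2 / lam ^ 2 * ℓ * (M : ℝ) ^ ℓ * y / n)) ^ (2 ^ b) := by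
  classical
  have hp0 : 0 < p := hl.trans h0
  have hp1 : p < 1 := by linarith
  have hnr : (1 : ℝ) ≤ n := by exact_mod_cast hn
  have hMr : (1 : ℝ) ≤ M := by exact_mod_cast hM
  have hy00 : 0 ≤ y := by rw [hy]; positivity
  have hkl : k ≤ ℓ := by
    rw [← hk]
    calc Nat.card H.support ≤ Nat.card (Fin ℓ) := Finite.card_subtype_le _
      _ = ℓ := by simp
  have hB : ∀ b, |ch p b| ≤ 1 / lam := ch_abs_le hl h0 h1
  have hB1 : 1 ≤ 1 / lam := by rw [le_div_iff₀ hl]; linarith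
  obtain ⟨v⟩ := exists_v hMu
  obtain ⟨c, hc⟩ := exists_option_fun (fun (e : Sym2 (Fin n)) (q : Sym2 (Fin ℓ)) => ∃ i, ER v i q e)
    (fun e q q' ⟨i, h⟩ ⟨i', h'⟩ => (ER_fun h h').2)
  obtain ⟨eg, heg⟩ := exists_option_fun (fun (e : Sym2 (Fin n)) (i : Fin M) => ∃ q, ER v i q e)
    (fun e i i' ⟨q, h⟩ ⟨q', h'⟩ => (ER_fun h h').1)
  set T : Finset (Sym2 (Fin ℓ)) := H.edgeFinset with hTdef
  have hT : ∀ q, q ∈ T ↔ q ∈ H.edgeSet := fun q => by simp [hTdef]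
  have hT2 : 2 ≤ T.card := edges_ge hk hk3 hT
  have hTl : T.card ≤ ℓ ^ 2 := edges_le T
  have h2T : (2 : ℝ) ^ T.card ≤ 2 ^ ℓ ^ 2 := pow_le_pow_right₀ (by norm_num) hTl
  have h24 : (2 : ℝ) ^ ℓ ^ 2 * 2 ^ ℓ ^ 2 = 4 ^ ℓ ^ 2 := by rw [← mul_pow]; norm_num
  set q : Finset (Sym2 (Fin n)) → ℝ := fun S => s * cf S with hq
  set 𝒮 : Finset (Finset (Sym2 (Fin n))) := Finset.univ.filter fun S => cf S ≠ 0 with h𝒮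
  have hsum𝒮 : ∀ x, ∑ S, (s * cf S) * mon p S x = ∑ S ∈ 𝒮, q S * mon p S x := by
    intro x
    rw [h𝒮, Finset.sum_filter]
    refine Finset.sum_congr rfl fun S _ => ?_
    split_ifs with h
    · rfl
    · push Not at h; rw [h]; ring
  simp only [hsum𝒮]
  set E0 := Ex p (fun x => ee (∑ e, g e (x e) + ∑ S ∈ 𝒮, q S * mon p S x)) with hE0
  have hE1 : ‖E0‖ ≤ 1 := by
    refine (Ex_norm_le hp0.le hp1.le _).trans ?_
    simp only [ee_norm, Ex_const]; rfl
  refine (pow_le_pow_of_le_one (norm_nonneg _) hE1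
    (Nat.pow_le_pow_right (by norm_num) hTl)).trans ?_
  refine (decouple hp0.le hp1.le c T hT2 g 𝒮 q).trans ?_
  set 𝓕 := 𝒮.filter (Full c T) with h𝓕
  have hF : ∀ S ∈ 𝓕, cf S ≠ 0 ∧ Full c T S := by
    intro S hS
    rw [h𝓕, Finset.mem_filter, h𝒮, Finset.mem_filter] at hS
    exact ⟨hS.1.2, hS.2⟩
  -- the group of a tight edge set
  have hgi : ∃ gi : Finset (Sym2 (Fin n)) → Fin M, ∀ S ∈ 𝓕, (vs S).card = k →
      ∃ φ : H.support → Fin u, vs S = tr v H (fun a => (gi S, φ a)) := by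
    have : ∀ S : Finset (Sym2 (Fin n)), ∃ i : Fin M, S ∈ 𝓕 → (vs S).card = k →
        ∃ φ : H.support → Fin u, vs S = tr v H (fun a => (i, φ a)) := by
      intro S
      by_cases h : S ∈ 𝓕 ∧ (vs S).card = k
      · obtain ⟨i, hi⟩ := one_group hc hT (hF S h.1).2 hconn (by rw [h.2, hk])
        exact ⟨i, fun _ _ => hi⟩
      · exact ⟨⟨0, hM⟩, fun h1 h2 => absurd ⟨h1, h2⟩ h⟩
    choose gi hgi using this
    exact ⟨gi, hgi⟩
  obtain ⟨gi, hgi⟩ := hgi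
  set 𝒯 := 𝓕.filter (fun S => (vs S).card = k) with h𝒯
  set 𝓡 := 𝓕.filter (fun S => ¬ (vs S).card = k) with h𝓡
  set 𝒳 : Fin M → Finset (Finset (Sym2 (Fin n))) := fun i => 𝒯.filter fun S => gi S = i with h𝒳
  have hX : ∀ i, ∀ S ∈ 𝒳 i, S ∈ 𝓕 ∧ (vs S).card = k ∧
      ∃ φ : H.support → Fin u, vs S = tr v H (fun a => (i, φ a)) := by
    intro i S hS
    simp only [h𝒳, h𝒯, Finset.mem_filter] at hS
    obtain ⟨⟨hS1, hS2⟩, hS3⟩ := hS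
    exact ⟨hS1, hS2, hS3 ▸ hgi S hS1 hS2⟩
  set U : Finset (Sym2 (Fin n)) × Finset (Sym2 (Fin ℓ)) → Finset (Sym2 (Fin n) ⊕ Sym2 (Fin n)) :=
    fun m => m.1.image (lift c m.2) with hU
  set r : Finset (Sym2 (Fin n)) × Finset (Sym2 (Fin ℓ)) → ℝ :=
    fun m => (-1 : ℝ) ^ m.2.card * q m.1 with hr
  have hinj : ∀ 𝒜 ⊆ 𝓕, Set.InjOn U (𝒜 ×ˢ T.powerset : Finset _) := by
    intro 𝒜 hA
    refine lift_injOn c T _ ?_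
    intro m hm
    rw [Finset.mem_coe, Finset.mem_product, Finset.mem_powerset] at hm
    exact ⟨(hF _ (hA hm.1)).2, hm.2⟩
  have hUcard : ∀ 𝒜 ⊆ 𝓕, ∀ m ∈ 𝒜 ×ˢ T.powerset, (U m).card ≤ ℓ ^ 2 := by
    intro 𝒜 hA m hm
    rw [Finset.mem_product] at hm
    exact Finset.card_image_le.trans (hg.card_le (hF _ (hA hm.1)).1)
  have hXF : ∀ i, 𝒳 i ⊆ 𝓕 := fun i S hS => (hX i S hS).1
  have hRF : 𝓡 ⊆ 𝓕 := Finset.filter_subset _ _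
  set X : Fin M → (Sym2 (Fin n) ⊕ Sym2 (Fin n) → Bool) → ℝ :=
    fun i z => ∑ m ∈ 𝒳 i ×ˢ T.powerset, r m * mon p (U m) z with hXdef
  -- decomposition of the sum
  have hdecomp : ∀ z, ∑ m ∈ 𝓕 ×ˢ T.powerset, ((-1 : ℝ) ^ m.2.card * q m.1) * mon p (m.1.image (lift c m.2)) z
      = ∑ i, X i z + ∑ m ∈ 𝓡 ×ˢ T.powerset, r m * mon p (U m) z := by
    intro z
    simp only [hXdef, Finset.sum_product]
    rw [Finset.sum_fiberwise 𝒯 gi (fun S => ∑ A ∈ T.powerset, r (S, A) * mon p (U (S, A)) z)]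
    rw [h𝒯, h𝓡, Finset.sum_filter_add_sum_filter_not]
  simp only [hdecomp]
  -- variance of X i
  have hVar : ∀ i, Ex p (fun z => X i z ^ 2) = 2 ^ T.card * ∑ S ∈ 𝒳 i, q S ^ 2 := by
    intro i
    simp only [hXdef]
    rw [parseval hp0 hp1 _ r U (hinj _ (hXF i))]
    exact prod_sq_sum _ _ _
  have hup : ∀ i, 2 ^ T.card * ∑ S ∈ 𝒳 i, q S ^ 2 ≤ 4 ^ ℓ ^ 2 / lam ^ 2 * y := by
    intro i
    have h2 : ∑ S ∈ 𝒳 i, q S ^ 2 ≤ (𝒳 i).card * ((s * (n : ℝ) ^ (ℓ - k)) ^ 2 / lam ^ 2) := by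
      rw [← nsmul_eq_mul]
      refine Finset.sum_le_card_nsmul _ _ _ fun S hS => ?_
      obtain ⟨hS1, hS2, _⟩ := hX i S hS
      exact q_bound hl hg (hF S hS1).1 hS2 s
    have h3 : ((𝒳 i).card : ℝ) ≤ (u : ℝ) ^ k * 2 ^ ℓ ^ 2 := by
      exact_mod_cast count_group hk i (𝒳 i) (fun S hS => (hX i S hS).2.2)
    calc _ ≤ 2 ^ ℓ ^ 2 * (((u : ℝ) ^ k * 2 ^ ℓ ^ 2) * ((s * (n : ℝ) ^ (ℓ - k)) ^ 2 / lam ^ 2)) := by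
          refine mul_le_mul h2T (h2.trans ?_) (Finset.sum_nonneg fun _ _ => sq_nonneg _) (by positivity)
          exact mul_le_mul_of_nonneg_right h3 (by positivity)
      _ = (2 ^ ℓ ^ 2 * 2 ^ ℓ ^ 2) / lam ^ 2 * y := by rw [hy]; ring
      _ = _ := by rw [h24]
  have hlow : ∀ i, lam ^ 2 * y ≤ 2 ^ T.card * ∑ S ∈ 𝒳 i, q S ^ 2 := by
    intro i
    have h3 : ((u : ℝ) ^ k) ≤ ((𝒳 i).filter (Copy H)).card := by
      by_cases hs0 : s = 0 ∧ False
      · exact hs0.2.elim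
      have := count_lower (v := v) (c := c) (T := T) hk hu i hc hT (𝒳 i) (by
        intro S hS1 hS2 hS3
        have hne : cf S ≠ 0 := by
          intro h
          have := hH S hS1
          rw [h, abs_zero] at this
          have : 0 < lam * (n : ℝ) ^ (ℓ - k) := by positivity
          linarith
        have hSF : S ∈ 𝓕 := by
          rw [h𝓕, Finset.mem_filter, h𝒮, Finset.mem_filter]
          exact ⟨⟨Finset.mem_univ _, hne⟩, hS2⟩
        obtain ⟨φ, hφ⟩ := hS3
        have hcard : (vs S).card = k := by rw [hφ, tr_card, hk]
        have hgiS : gi S = i := by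
          obtain ⟨ψ, hψ⟩ := hgi S hSF hcard
          obtain ⟨a0⟩ := hconn.nonempty
          have h1 : v (i, (a0 : Fin ℓ), φ a0) ∈ vs S := by rw [hφ, mem_tr]; exact ⟨a0, rfl⟩
          rw [hψ, mem_tr] at h1
          obtain ⟨a', h2⟩ := h1
          have := v.injective h2
          simp only [Prod.mk.injEq] at this
          exact this.1
        simp only [h𝒳, h𝒯, Finset.mem_filter]
        exact ⟨⟨hSF, hcard⟩, hgiS⟩)
      exact_mod_cast this
    have h4 : ((𝒳 i).filter (Copy H)).card * (s * (lam * (n : ℝ) ^ (ℓ - k))) ^ 2 ≤ ∑ S ∈ 𝒳 i, q S ^ 2 := by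
      refine le_trans ?_ (Finset.sum_le_sum_of_subset_of_nonneg (Finset.filter_subset (Copy H) _)
        (fun _ _ _ => sq_nonneg _))
      rw [← nsmul_eq_mul]
      refine Finset.card_nsmul_le_sum _ _ _ fun S hS => ?_
      have := hH S (Finset.mem_filter.1 hS).2
      have h5 : (lam * (n : ℝ) ^ (ℓ - k)) ^ 2 ≤ cf S ^ 2 := by
        rw [← sq_abs (cf S)]; exact pow_le_pow_left₀ (by positivity) this 2
      simp only [hq, mul_pow s]
      exact mul_le_mul_of_nonneg_left h5 (sq_nonneg _)
    have h6 : (0 : ℝ) ≤ ∑ S ∈ 𝒳 i, q S ^ 2 := Finset.sum_nonneg fun _ _ => sq_nonneg _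
    calc lam ^ 2 * y = (u : ℝ) ^ k * (s * (lam * (n : ℝ) ^ (ℓ - k))) ^ 2 := by rw [hy]; ring
      _ ≤ ((𝒳 i).filter (Copy H)).card * (s * (lam * (n : ℝ) ^ (ℓ - k))) ^ 2 :=
          mul_le_mul_of_nonneg_right h3 (sq_nonneg _)
      _ ≤ 1 * ∑ S ∈ 𝒳 i, q S ^ 2 := by rw [one_mul]; exact h4
      _ ≤ _ := mul_le_mul_of_nonneg_right (one_le_pow₀ (by norm_num)) h6
  have hXdeg : ∀ i, X i ∈ PD p (ℓ ^ 2) := by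
    intro i
    have : X i = ∑ m ∈ 𝒳 i ×ˢ T.powerset, r m • mon p (U m) := by
      funext z; simp [hXdef, Finset.sum_apply]
    rw [this]
    exact Submodule.sum_mem _ fun m hm => Submodule.smul_mem _ _ (mon_mem _ (hUcard _ (hXF i) m hm))
  have hXmean : ∀ i, Ex p (X i) = 0 := by
    intro i
    have : Ex p (X i) = ∑ m ∈ 𝒳 i ×ˢ T.powerset, r m * Ex p (fun z => mon p (U m) z) := by
      simp only [hXdef]
      rw [Ex_sum]
      refine Finset.sum_congr rfl fun m _ => ?_
      exact Ex_mul_left _ _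
    rw [this]
    refine Finset.sum_eq_zero fun m hm => ?_
    rw [Finset.mem_product] at hm
    rw [Ex_mon hp0 hp1, mul_zero]
    obtain ⟨j, hj⟩ : T.Nonempty := Finset.card_pos.1 (by omega)
    obtain ⟨e, he, _⟩ := (hF _ (hXF i hm.1)).2 j hj
    exact ⟨_, Finset.mem_image_of_mem _ he⟩
  have hρ0 : 0 ≤ 1 - lam ^ 2 * y / 4 := by
    have h5 : (1 : ℝ) ≤ (3 + 1 / lam) ^ (2 * ℓ ^ 2) := one_le_pow₀ (by linarith)
    have i0 : Fin M := ⟨0, hM⟩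
    have h6 := (hlow i0).trans (hup i0)
    have h7 : 0 ≤ 4 ^ ℓ ^ 2 / lam ^ 2 * y := by positivity
    nlinarith
  have hXE : ∀ i, ‖Ex p (fun z => Complex.exp (Complex.I * (X i z : ℝ)))‖ ≤ 1 - lam ^ 2 * y / 4 := by
    intro i
    have h3 : 0 ≤ 3 + 1 / lam := by positivity
    have hsm : 256 * (3 + 1 / lam) ^ (2 * ℓ ^ 2) * (2 ^ T.card * ∑ S ∈ 𝒳 i, q S ^ 2) ≤ 1 :=
      (mul_le_mul_of_nonneg_left (hup i) (by positivity)).trans hy0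
    refine (charfun_small hp0 hp1 hB (hXdeg i) (hXmean i) (hVar i) hsm).trans ?_
    linarith [hlow i]
  have hXdep : ∀ i, Dep (fun w => eg (Sum.elim id id w) = some i) (X i) := by
    intro i z z' hzz
    simp only [hXdef]
    refine Finset.sum_congr rfl fun m hm => ?_
    rw [Finset.mem_product] at hm
    rw [mon_dep (U m) z z']
    intro w hw
    obtain ⟨e, he, rfl⟩ := Finset.mem_image.1 hw
    apply hzz
    rw [lift_proj]
    obtain ⟨φ, hφ⟩ := (hX i _ hm.1).2.2
    exact tr_group heg hφ he
  -- L bound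
  have hL : ∑ m ∈ 𝓡 ×ˢ T.powerset, |r m| ≤ 4 ^ ℓ ^ 2 * (n : ℝ) ^ (2 * ℓ) / lam := by
    have h3 : ∑ S ∈ 𝓡, |q S| ≤ 𝓡.card * ((n : ℝ) ^ ℓ / lam) := by
      rw [← nsmul_eq_mul]
      refine Finset.sum_le_card_nsmul _ _ _ fun S hS => ?_
      have h4 := hg.bound S (hF S (hRF hS)).1
      simp only [hq]
      rw [abs_mul]
      calc |s| * |cf S| ≤ 1 * ((n : ℝ) ^ (ℓ - (vs S).card) / lam) :=
            mul_le_mul hs h4 (abs_nonneg _) zero_le_one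
        _ ≤ _ := by
            rw [one_mul]
            exact div_le_div_of_nonneg_right (pow_le_pow_right₀ hnr (Nat.sub_le _ _)) hl.le
    have h5 : (𝓡.card : ℝ) ≤ (n : ℝ) ^ ℓ * 2 ^ ℓ ^ 2 := by
      exact_mod_cast hg.count 𝓡 (fun S hS => (hF S (hRF hS)).1)
    simp only [hr]
    rw [prod_abs_sum]
    calc _ ≤ 2 ^ ℓ ^ 2 * (((n : ℝ) ^ ℓ * 2 ^ ℓ ^ 2) * ((n : ℝ) ^ ℓ / lam)) := by
          refine mul_le_mul h2T (h3.trans ?_) (Finset.sum_nonneg fun _ _ => abs_nonneg _) (by positivity)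
          exact mul_le_mul_of_nonneg_right h5 (by positivity)
      _ = (2 ^ ℓ ^ 2 * 2 ^ ℓ ^ 2) * (n : ℝ) ^ (2 * ℓ) / lam := by
          rw [two_mul, pow_add]; ring
      _ = _ := by rw [h24]
  have hL1 : 1 ≤ 4 ^ ℓ ^ 2 * (n : ℝ) ^ (2 * ℓ) / lam := by
    rw [le_div_iff₀ hl]
    have a1 : (1 : ℝ) ≤ 4 ^ ℓ ^ 2 := one_le_pow₀ (by norm_num)
    have a2 : (1 : ℝ) ≤ (n : ℝ) ^ (2 * ℓ) := one_le_pow₀ hnr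
    nlinarith
  -- variance of the remainder
  have hv : Ex p (fun z => (∑ m ∈ 𝓡 ×ˢ T.powerset, r m * mon p (U m) z) ^ 2) ≤
      4 ^ ℓ ^ 2 / lam ^ 2 * ℓ * (M : ℝ) ^ ℓ * y / n := by
    rw [parseval hp0 hp1 _ r U (hinj _ hRF)]
    simp only [hr]
    rw [prod_sq_sum]
    have hmaps : ∀ S ∈ 𝓡, (vs S).card ∈ Finset.Ioc k ℓ := by
      intro S hS
      have h3 := full_card hc hT (hF S (hRF hS)).2
      rw [hk] at h3
      have h4 := (Finset.mem_filter.1 hS).2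
      have h5 := hg.vcard S (hF S (hRF hS)).1
      rw [Finset.mem_Ioc]
      exact ⟨lt_of_le_of_ne h3 (Ne.symm h4), h5⟩
    have hterm : ∀ k' ∈ Finset.Ioc k ℓ, ∑ S ∈ 𝓡 with (vs S).card = k', q S ^ 2 ≤
        2 ^ ℓ ^ 2 / lam ^ 2 * (M : ℝ) ^ ℓ * y / n := by
      intro k' hk'
      rw [Finset.mem_Ioc] at hk'
      have h3 : ∑ S ∈ 𝓡 with (vs S).card = k', q S ^ 2 ≤
          (𝓡.filter fun S => (vs S).card = k').card * ((s * (n : ℝ) ^ (ℓ - k')) ^ 2 / lam ^ 2) := by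
        rw [← nsmul_eq_mul]
        refine Finset.sum_le_card_nsmul _ _ _ fun S hS => ?_
        rw [Finset.mem_filter] at hS
        exact q_bound hl hg (hF S (hRF hS.1)).1 hS.2 s
      have h4 : ((𝓡.filter fun S => (vs S).card = k').card : ℝ) ≤
          (((M : ℝ) * u) ^ k * (n : ℝ) ^ (k' - k)) * 2 ^ ℓ ^ 2 := by
        exact_mod_cast count_big hc hT hk hk'.1.le hk'.2 _ (fun S hS => by
          rw [Finset.mem_filter] at hS
          exact ⟨(hF S (hRF hS.1)).2, hS.2⟩)
      refine h3.trans ((mul_le_mul_of_nonneg_right h4 (by positivity)).trans ?_)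
      have hMk : (M : ℝ) ^ k ≤ (M : ℝ) ^ ℓ := pow_le_pow_right₀ hMr hkl
      have hpw : (n : ℝ) * ((n : ℝ) ^ (k' - k) * ((n : ℝ) ^ (ℓ - k')) ^ 2) ≤ ((n : ℝ) ^ (ℓ - k)) ^ 2 := by
        rw [← pow_mul, ← pow_mul, ← pow_add, ← pow_succ']
        exact pow_le_pow_right₀ hnr (by omega)
      rw [le_div_iff₀ (by linarith)]
      calc (((M : ℝ) * u) ^ k * (n : ℝ) ^ (k' - k)) * 2 ^ ℓ ^ 2 * ((s * (n : ℝ) ^ (ℓ - k')) ^ 2 / lam ^ 2) * n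
          = (2 ^ ℓ ^ 2 / lam ^ 2 * (u : ℝ) ^ k * s ^ 2) * ((M : ℝ) ^ k *
              ((n : ℝ) * ((n : ℝ) ^ (k' - k) * ((n : ℝ) ^ (ℓ - k')) ^ 2))) := by
            rw [mul_pow, mul_pow]; ring
        _ ≤ (2 ^ ℓ ^ 2 / lam ^ 2 * (u : ℝ) ^ k * s ^ 2) * ((M : ℝ) ^ ℓ * ((n : ℝ) ^ (ℓ - k)) ^ 2) := by
            gcongr
        _ = _ := by rw [hy]; ring
    have hsum : ∑ S ∈ 𝓡, q S ^ 2 ≤ ℓ * (2 ^ ℓ ^ 2 / lam ^ 2 * (M : ℝ) ^ ℓ * y / n) := by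
      rw [← Finset.sum_fiberwise_of_maps_to hmaps]
      refine (Finset.sum_le_card_nsmul _ _ _ hterm).trans ?_
      rw [nsmul_eq_mul, Nat.card_Ioc]
      refine mul_le_mul_of_nonneg_right ?_ (by positivity)
      exact_mod_cast Nat.sub_le _ _
    calc _ ≤ 2 ^ ℓ ^ 2 * (ℓ * (2 ^ ℓ ^ 2 / lam ^ 2 * (M : ℝ) ^ ℓ * y / n)) :=
          mul_le_mul h2T hsum (Finset.sum_nonneg fun _ _ => sq_nonneg _) (by positivity)
      _ = (2 ^ ℓ ^ 2 * 2 ^ ℓ ^ 2) / lam ^ 2 * ℓ * (M : ℝ) ^ ℓ * y / n := by ring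
      _ = _ := by rw [h24]
  have := main_analytic hp0 hp1 hB hB1 (fun w => eg (Sum.elim id id w)) X hXdep hρ0
    (by have : 0 ≤ lam ^ 2 * y / 4 := by positivity
        linarith) hXE (𝓡 ×ˢ T.powerset) r U (hUcard _ hRF) hL hL1 hv b
  rw [Fintype.card_fin] at this
  exact this

end core
end GS

namespace GS

lemma params {ℓ n M : ℕ} (hℓ : 3 ≤ ℓ) {D y0 ε s : ℝ} (hD : 1 ≤ D) (hy0 : 0 < y0) (hy1 : y0 ≤ 1)
    (hε : 0 < ε) (hε4 : ε ≤ 1 / 4) (hn : 1 ≤ n) (hM : 1 ≤ M) (hMl : (M : ℝ) ^ ℓ ≤ (n : ℝ) ^ ε)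
    (hs0 : |s| ≤ (n : ℝ) ^ (-ε)) (hs1 : (n : ℝ) ^ (2 * ε) ≤ D * (s ^ 2 * (n : ℝ) ^ (2 * ℓ - 3)))
    (hbig : (ℓ : ℝ) ^ ℓ * D ≤ (n : ℝ) ^ ε) (hyn : ((n : ℝ) ^ (-ε)) ^ 2 ≤ y0) :
    ∃ k u : ℕ, 3 ≤ k ∧ k ≤ ℓ ∧ 1 ≤ u ∧ M * ℓ * u ≤ n ∧
      (u : ℝ) ^ k * (s * (n : ℝ) ^ (ℓ - k)) ^ 2 ≤ y0 ∧
      y0 / 2 ^ ℓ ≤ (u : ℝ) ^ k * (s * (n : ℝ) ^ (ℓ - k)) ^ 2 := by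
  classical
  have hnr : (1 : ℝ) ≤ n := by exact_mod_cast hn
  have hn0 : (0 : ℝ) < n := by linarith
  have hex : ∃ k, 3 ≤ k ∧ k ≤ ℓ ∧ |s| * (n : ℝ) ^ (ℓ - k) ≤ (n : ℝ) ^ (-ε) :=
    ⟨ℓ, hℓ, le_rfl, by simpa using hs0⟩
  obtain ⟨k, ⟨hk3, hkl, hks⟩, hmin⟩ : ∃ k, (3 ≤ k ∧ k ≤ ℓ ∧ |s| * (n : ℝ) ^ (ℓ - k) ≤ (n : ℝ) ^ (-ε)) ∧
      ∀ j < k, ¬ (3 ≤ j ∧ j ≤ ℓ ∧ |s| * (n : ℝ) ^ (ℓ - j) ≤ (n : ℝ) ^ (-ε)) :=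
    ⟨Nat.find hex, Nat.find_spec hex, fun j hj => Nat.find_min hex hj⟩
  have hsq : (n : ℝ) ^ (2 * ε) = ((n : ℝ) ^ ε) ^ 2 := by
    rw [← Real.rpow_natCast, ← Real.rpow_mul hn0.le]; congr 1; push_cast; ring
  have hneg : (n : ℝ) ^ (-ε) * (n : ℝ) ^ ε = 1 := by
    rw [← Real.rpow_add hn0]; simp
  have hpos : 0 < (n : ℝ) ^ ε := Real.rpow_pos_of_pos hn0 _
  have hnpos : 0 < (n : ℝ) ^ (-ε) := Real.rpow_pos_of_pos hn0 _
  set z : ℝ := (s * (n : ℝ) ^ (ℓ - k)) ^ 2 with hz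
  have hzn : z ≤ ((n : ℝ) ^ (-ε)) ^ 2 := by
    rw [hz, ← sq_abs, abs_mul, abs_of_nonneg (by positivity : (0:ℝ) ≤ (n : ℝ) ^ (ℓ - k))]
    exact pow_le_pow_left₀ (by positivity) hks 2
  have hzl : ((n : ℝ) ^ ε) ^ 2 ≤ D * (z * (n : ℝ) ^ k) := by
    rcases Nat.eq_or_lt_of_le hk3 with h3 | h4
    · rw [← hsq]
      refine hs1.trans (le_of_eq ?_)
      rw [hz, ← h3]
      obtain ⟨j, rfl⟩ := Nat.exists_eq_add_of_le hℓ
      have e1 : 2 * (3 + j) - 3 = 2 * j + 3 := by omega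
      have e2 : 3 + j - 3 = j := by omega
      rw [e1, e2]; ring
    · have h := hmin (k - 1) (by omega)
      push Not at h
      have h' := h (by omega) (by omega)
      have e1 : ℓ - (k - 1) = (ℓ - k) + 1 := by omega
      rw [e1, pow_succ] at h'
      have h2 : ((n : ℝ) ^ (-ε)) ^ 2 ≤ z * (n : ℝ) ^ 2 := by
        have := pow_le_pow_left₀ hnpos.le h'.le 2
        rw [← mul_assoc, mul_pow, mul_pow, sq_abs, ← mul_pow] at this
        exact this
      have h3 : (n : ℝ) ^ ε ^ 1 ≤ (n : ℝ) ^ (1 / 4 : ℝ) := by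
        rw [pow_one]; exact Real.rpow_le_rpow_of_exponent_le hnr hε4
      rw [pow_one] at h3
      have h4' : ((n : ℝ) ^ (1 / 4 : ℝ)) ^ 4 = n := by
        rw [← Real.rpow_natCast, ← Real.rpow_mul hn0.le]; norm_num
      have h5 : ((n : ℝ) ^ ε) ^ 4 ≤ n := by
        calc ((n : ℝ) ^ ε) ^ 4 ≤ ((n : ℝ) ^ (1 / 4 : ℝ)) ^ 4 := pow_le_pow_left₀ hpos.le h3 4
          _ = n := h4'
      have h6 : (n : ℝ) ^ 4 ≤ (n : ℝ) ^ k := pow_le_pow_right₀ hnr h4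
      have hz0 : 0 ≤ z := by rw [hz]; positivity
      calc ((n : ℝ) ^ ε) ^ 2 = ((n : ℝ) ^ (-ε)) ^ 2 * ((n : ℝ) ^ ε) ^ 4 := by
            have : ((n : ℝ) ^ (-ε)) ^ 2 * ((n : ℝ) ^ ε) ^ 4 = ((n : ℝ) ^ (-ε) * (n : ℝ) ^ ε) ^ 2 * ((n : ℝ) ^ ε) ^ 2 := by ring
            rw [this, hneg]; ring
        _ ≤ (z * (n : ℝ) ^ 2) * n := by gcongr
        _ ≤ (z * (n : ℝ) ^ 2) * (n : ℝ) ^ 2 := by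
            gcongr; nlinarith
        _ = z * (n : ℝ) ^ 4 := by ring
        _ ≤ z * (n : ℝ) ^ k := by gcongr
        _ ≤ D * (z * (n : ℝ) ^ k) := le_mul_of_one_le_left (by positivity) hD
  have hzpos : 0 < z := by
    by_contra hcon
    have hz0 : z = 0 := le_antisymm (not_lt.mp hcon) (by rw [hz]; positivity)
    rw [hz0] at hzl
    have : 0 < ((n : ℝ) ^ ε) ^ 2 := by positivity
    simp at hzl; linarith
  have hexu : ∃ u : ℕ, y0 < ((u : ℝ) + 1) ^ k * z := by
    obtain ⟨u, hu⟩ := exists_nat_gt (y0 / z)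
    refine ⟨u, ?_⟩
    rw [div_lt_iff₀ hzpos] at hu
    refine hu.trans_le ?_
    gcongr
    calc (u : ℝ) ≤ (u : ℝ) + 1 := by linarith
      _ = ((u : ℝ) + 1) ^ 1 := (pow_one _).symm
      _ ≤ ((u : ℝ) + 1) ^ k := pow_le_pow_right₀ (by linarith [(Nat.cast_nonneg u : (0:ℝ) ≤ u)]) (by omega)
  obtain ⟨u, hu, humin⟩ : ∃ u : ℕ, y0 < ((u : ℝ) + 1) ^ k * z ∧ ∀ j < u, ¬ y0 < ((j : ℝ) + 1) ^ k * z :=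
    ⟨Nat.find hexu, Nat.find_spec hexu, fun j hj => Nat.find_min hexu hj⟩
  have hu1 : 1 ≤ u := by
    by_contra h
    have : u = 0 := by omega
    subst this
    simp at hu; linarith
  have huy : (u : ℝ) ^ k * z ≤ y0 := by
    have := humin (u - 1) (by omega)
    rw [not_lt] at this
    have e : ((u - 1 : ℕ) : ℝ) + 1 = u := by
      rw [Nat.cast_sub hu1]; simp
    rwa [e] at this
  have hur : (1 : ℝ) ≤ u := by exact_mod_cast hu1
  have hMr : (1 : ℝ) ≤ M := by exact_mod_cast hM
  refine ⟨k, u, hk3, hkl, hu1, ?_, huy, ?_⟩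
  · have hlr : (1 : ℝ) ≤ ℓ := by exact_mod_cast (by omega : 1 ≤ ℓ)
    have key : ((M : ℝ) * ℓ * u) ^ k ≤ (n : ℝ) ^ k := by
      have h1 : (u : ℝ) ^ k * z ≤ 1 := huy.trans hy1
      have h2 : (M : ℝ) ^ k ≤ (n : ℝ) ^ ε := (pow_le_pow_right₀ hMr hkl).trans hMl
      have h3 : (ℓ : ℝ) ^ k * D ≤ (n : ℝ) ^ ε :=
        (mul_le_mul_of_nonneg_right (pow_le_pow_right₀ hlr hkl) (by linarith)).trans hbig
      have h4 : (u : ℝ) ^ k * ((n : ℝ) ^ ε) ^ 2 ≤ D * (n : ℝ) ^ k := by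
        calc (u : ℝ) ^ k * ((n : ℝ) ^ ε) ^ 2 ≤ (u : ℝ) ^ k * (D * (z * (n : ℝ) ^ k)) := by gcongr
          _ = ((u : ℝ) ^ k * z) * (D * (n : ℝ) ^ k) := by ring
          _ ≤ 1 * (D * (n : ℝ) ^ k) := by gcongr
          _ = _ := one_mul _
      have h5 : ((M : ℝ) * ℓ * u) ^ k * ((n : ℝ) ^ ε) ^ 2 ≤ (n : ℝ) ^ k * ((n : ℝ) ^ ε) ^ 2 := by
        calc ((M : ℝ) * ℓ * u) ^ k * ((n : ℝ) ^ ε) ^ 2 = (M : ℝ) ^ k * (ℓ : ℝ) ^ k * ((u : ℝ) ^ k * ((n : ℝ) ^ ε) ^ 2) := by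
              rw [mul_pow, mul_pow]; ring
          _ ≤ (M : ℝ) ^ k * (ℓ : ℝ) ^ k * (D * (n : ℝ) ^ k) := by gcongr
          _ = (M : ℝ) ^ k * ((ℓ : ℝ) ^ k * D) * (n : ℝ) ^ k := by ring
          _ ≤ (n : ℝ) ^ ε * (n : ℝ) ^ ε * (n : ℝ) ^ k := by gcongr
          _ = _ := by ring
      exact le_of_mul_le_mul_right h5 (by positivity)
    have := le_of_pow_le_pow_left₀ (by omega : k ≠ 0) (by positivity) key
    exact_mod_cast this
  · rw [div_le_iff₀ (by positivity)]
    refine hu.le.trans ?_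
    calc ((u : ℝ) + 1) ^ k * z ≤ (2 * (u : ℝ)) ^ k * z := by gcongr; linarith
      _ = (u : ℝ) ^ k * z * 2 ^ k := by rw [mul_pow]; ring
      _ ≤ (u : ℝ) ^ k * z * 2 ^ ℓ := by gcongr; norm_num

end GS

namespace GS
open Filter

lemma ev_log_pow (a : ℕ) {δ K : ℝ} (hδ : 0 < δ) (hK : 0 < K) :
    ∀ᶠ n : ℕ in atTop, K * (Real.log n) ^ a ≤ (n : ℝ) ^ δ := by
  have h := (isLittleO_log_rpow_rpow_atTop (a : ℝ) hδ).def (inv_pos.mpr hK)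
  have h' := tendsto_natCast_atTop_atTop (R := ℝ) |>.eventually h
  filter_upwards [h', eventually_ge_atTop 1] with n hn h1
  have hn1 : (1 : ℝ) ≤ n := by exact_mod_cast h1
  rw [Real.rpow_natCast, Real.norm_of_nonneg (pow_nonneg (Real.log_nonneg hn1) _),
    Real.norm_of_nonneg (by positivity)] at hn
  calc K * (Real.log n) ^ a ≤ K * (K⁻¹ * (n : ℝ) ^ δ) := by gcongr
    _ = _ := by field_simp

lemma ev_log_ge (K : ℝ) : ∀ᶠ n : ℕ in atTop, K ≤ Real.log n :=
  (Real.tendsto_log_atTop.comp (tendsto_natCast_atTop_atTop (R := ℝ))).eventually_ge_atTop K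

lemma ev_rpow_ge {δ : ℝ} (hδ : 0 < δ) (K : ℝ) : ∀ᶠ n : ℕ in atTop, K ≤ (n : ℝ) ^ δ :=
  ((tendsto_rpow_atTop hδ).comp (tendsto_natCast_atTop_atTop (R := ℝ))).eventually_ge_atTop K

set_option maxHeartbeats 1000000 in
lemma psi_bound (ℓ : ℕ) {lam y1 δ : ℝ} (hl : 0 < lam) (hl1 : lam < 1 / 2) (hy1 : 0 < y1)
    (hδ : 0 < δ) : ∀ᶠ n : ℕ in atTop, ∀ M b : ℕ, ∀ y : ℝ, (n : ℝ) ^ δ / 2 ≤ M →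
      (M : ℝ) ^ ℓ ≤ (n : ℝ) ^ (1 / 4 : ℝ) → y1 ≤ y → y ≤ 1 → (2 : ℝ) ^ b ≤ Real.log n →
      Real.log n < (2 : ℝ) ^ (b + 1) →
      2 ^ (b + 1) * ((4 ^ ℓ ^ 2 * (n : ℝ) ^ (2 * ℓ) / lam) * (1 / lam) ^ ℓ ^ 2) ^ (2 ^ (b + 1)) *
        (1 - lam ^ 2 * y / 4) ^ (M - 2 ^ (b + 1) * ℓ ^ 2) +
      4 * ((3 + 1 / lam) ^ (ℓ ^ 2 * b) * (4 ^ ℓ ^ 2 / lam ^ 2 * ℓ * (M : ℝ) ^ ℓ * y / n)) ^ (2 ^ b)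
      ≤ 5 * Real.exp (-(Real.log n) ^ 2 / 4) := by
  set ρ : ℝ := lam ^ 2 * y1 / 4 with hρ
  have hρ0 : 0 < ρ := by positivity
  obtain ⟨a, ha⟩ : ∃ a : ℕ, (3 + 1 / lam) ^ ℓ ^ 2 ≤ (2 : ℝ) ^ a :=
    pow_unbounded_of_one_lt _ (by norm_num : (1 : ℝ) < 2) |>.imp fun _ h => h.le
  set D : ℝ := 4 ^ ℓ ^ 2 / lam ^ 2 * ℓ + 1 with hD
  have hD0 : 0 < D := by positivity
  set E : ℝ := 4 ^ ℓ ^ 2 / lam * (1 / lam) ^ ℓ ^ 2 with hE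
  have hE0 : 0 < E := by positivity
  set K : ℝ := (2 / ρ) * (1 + 2 * (2 * ℓ + 1) + ρ * 2 * ℓ ^ 2 + 1 / 4) with hK
  have hK0 : 0 < K := by positivity
  filter_upwards [ev_log_ge 1, ev_log_pow a (by norm_num : (0 : ℝ) < 1 / 4) hD0,
    ev_log_pow 2 hδ hK0, ev_rpow_ge one_pos E, eventually_ge_atTop 1] with n hL1 h2 h3 h4 hn
  intro M b y hM hMl hy hy' hb hb'
  have hnr : (1 : ℝ) ≤ n := by exact_mod_cast hn
  have hn0 : (0 : ℝ) < n := by linarith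
  rw [Real.rpow_one] at h4
  set L := Real.log n with hL
  have hnL : (n : ℝ) = Real.exp L := (Real.exp_log hn0).symm
  have hb2 : (2 : ℝ) ^ (b + 1) ≤ 2 * L := by rw [pow_succ]; linarith
  have hy0 : 0 < y := hy1.trans_le hy
  have hB : 0 < 3 + 1 / lam := by positivity
  have hlam2 : lam ^ 2 ≤ 1 := pow_le_one₀ hl.le (by linarith)
  -- first term
  have t1 : 2 ^ (b + 1) * ((4 ^ ℓ ^ 2 * (n : ℝ) ^ (2 * ℓ) / lam) * (1 / lam) ^ ℓ ^ 2) ^ (2 ^ (b + 1)) *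
        (1 - lam ^ 2 * y / 4) ^ (M - 2 ^ (b + 1) * ℓ ^ 2) ≤ Real.exp (-L ^ 2 / 4) := by
    have e1 : (2 : ℝ) ^ (b + 1) ≤ Real.exp L := by
      refine hb2.trans ?_
      have := Real.quadratic_le_exp_of_nonneg (x := L) (by linarith)
      linarith [sq_nonneg (L - 1), (by ring : (L - 1) ^ 2 = L ^ 2 - 2 * L + 1)]
    have e2 : ((4 ^ ℓ ^ 2 * (n : ℝ) ^ (2 * ℓ) / lam) * (1 / lam) ^ ℓ ^ 2) ^ (2 ^ (b + 1)) ≤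
        Real.exp (2 * (2 * ℓ + 1) * L ^ 2) := by
      have f1 : (4 ^ ℓ ^ 2 * (n : ℝ) ^ (2 * ℓ) / lam) * (1 / lam) ^ ℓ ^ 2 ≤ Real.exp ((2 * ℓ + 1) * L) := by
        calc (4 ^ ℓ ^ 2 * (n : ℝ) ^ (2 * ℓ) / lam) * (1 / lam) ^ ℓ ^ 2 = E * (n : ℝ) ^ (2 * ℓ) := by
              rw [hE]; ring
          _ ≤ n * (n : ℝ) ^ (2 * ℓ) := by gcongr
          _ = (n : ℝ) ^ (2 * ℓ + 1) := by ring
          _ = Real.exp ((2 * ℓ + 1) * L) := by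
              rw [hnL, ← Real.exp_nat_mul]; push_cast; ring_nf
      calc _ ≤ (Real.exp ((2 * ℓ + 1) * L)) ^ (2 ^ (b + 1)) := by gcongr
        _ = Real.exp ((2 : ℝ) ^ (b + 1) * ((2 * ℓ + 1) * L)) := by
            rw [← Real.exp_nat_mul]; push_cast; ring_nf
        _ ≤ _ := by
            rw [Real.exp_le_exp]
            calc (2 : ℝ) ^ (b + 1) * ((2 * ℓ + 1) * L) ≤ (2 * L) * ((2 * ℓ + 1) * L) := by gcongr
              _ = _ := by ring
    have e3 : (1 - lam ^ 2 * y / 4) ^ (M - 2 ^ (b + 1) * ℓ ^ 2) ≤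
        Real.exp (-(ρ * ((n : ℝ) ^ δ / 2 - 2 * L * ℓ ^ 2))) := by
      have f0 : 0 ≤ 1 - lam ^ 2 * y / 4 := by linarith [mul_le_one₀ hlam2 hy0.le hy']
      have f1 : 1 - lam ^ 2 * y / 4 ≤ Real.exp (-ρ) := by
        have := Real.add_one_le_exp (-ρ)
        have : ρ ≤ lam ^ 2 * y / 4 := by rw [hρ]; gcongr
        linarith
      have f2 : (n : ℝ) ^ δ / 2 - 2 * L * ℓ ^ 2 ≤ ((M - 2 ^ (b + 1) * ℓ ^ 2 : ℕ) : ℝ) := by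
        have : (M : ℝ) - ((2 ^ (b + 1) * ℓ ^ 2 : ℕ) : ℝ) ≤ ((M - 2 ^ (b + 1) * ℓ ^ 2 : ℕ) : ℝ) := by
          rw [sub_le_iff_le_add]; exact_mod_cast Nat.sub_le_iff_le_add.mp le_rfl
        push_cast at this
        have g : (2 : ℝ) ^ (b + 1) * ℓ ^ 2 ≤ 2 * L * ℓ ^ 2 := by gcongr
        linarith
      calc _ ≤ (Real.exp (-ρ)) ^ (M - 2 ^ (b + 1) * ℓ ^ 2) := pow_le_pow_left₀ f0 f1 _
        _ = Real.exp (((M - 2 ^ (b + 1) * ℓ ^ 2 : ℕ) : ℝ) * (-ρ)) := by rw [← Real.exp_nat_mul]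
        _ ≤ _ := by
            rw [Real.exp_le_exp]
            have := mul_le_mul_of_nonneg_left f2 hρ0.le
            linarith
    have f0 : 0 ≤ 1 - lam ^ 2 * y / 4 := by linarith [mul_le_one₀ hlam2 hy0.le hy']
    calc _ ≤ Real.exp L * Real.exp (2 * (2 * ℓ + 1) * L ^ 2) *
          Real.exp (-(ρ * ((n : ℝ) ^ δ / 2 - 2 * L * ℓ ^ 2))) :=
          mul_le_mul (mul_le_mul e1 e2 (by positivity) (Real.exp_pos _).le) e3 (pow_nonneg f0 _) (by positivity)
      _ = Real.exp (L + 2 * (2 * ℓ + 1) * L ^ 2 + -(ρ * ((n : ℝ) ^ δ / 2 - 2 * L * ℓ ^ 2))) := by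
          rw [Real.exp_add, Real.exp_add]
      _ ≤ _ := by
          rw [Real.exp_le_exp]
          have g1 : (1 + 2 * (2 * (ℓ : ℝ) + 1) + ρ * 2 * ℓ ^ 2 + 1 / 4) * L ^ 2 ≤ ρ * ((n : ℝ) ^ δ / 2) := by
            have := mul_le_mul_of_nonneg_left h3 (by positivity : 0 ≤ ρ / 2)
            calc _ = ρ / 2 * (K * L ^ 2) := by rw [hK]; field_simp
              _ ≤ _ := this
              _ = _ := by ring
          have g2 : L ≤ L ^ 2 := le_self_pow₀ hL1 (by norm_num)
          have g3 : ρ * 2 * ℓ ^ 2 * L ≤ ρ * 2 * ℓ ^ 2 * L ^ 2 := by gcongr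
          linarith
  have t2 : ((3 + 1 / lam) ^ (ℓ ^ 2 * b) * (4 ^ ℓ ^ 2 / lam ^ 2 * ℓ * (M : ℝ) ^ ℓ * y / n)) ^ (2 ^ b) ≤
      Real.exp (-L ^ 2 / 4) := by
    have f1 : (3 + 1 / lam) ^ (ℓ ^ 2 * b) ≤ L ^ a := by
      calc (3 + 1 / lam) ^ (ℓ ^ 2 * b) = ((3 + 1 / lam) ^ ℓ ^ 2) ^ b := pow_mul _ _ _
        _ ≤ ((2 : ℝ) ^ a) ^ b := by gcongr
        _ = ((2 : ℝ) ^ b) ^ a := by rw [← pow_mul, mul_comm, pow_mul]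
        _ ≤ L ^ a := by gcongr
    have f2 : (3 + 1 / lam) ^ (ℓ ^ 2 * b) * (4 ^ ℓ ^ 2 / lam ^ 2 * ℓ * (M : ℝ) ^ ℓ * y / n) ≤ Real.exp (-L / 2) := by
      have hrp : (n : ℝ) ^ (1 / 4 : ℝ) = Real.exp (L / 4) := by
        rw [Real.rpow_def_of_pos hn0, ← hL]; congr 1; ring
      calc _ ≤ L ^ a * (D * (n : ℝ) ^ (1 / 4 : ℝ) * 1 / n) := by
            gcongr; rw [hD]; linarith
        _ = (D * L ^ a) * (n : ℝ) ^ (1 / 4 : ℝ) / n := by ring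
        _ ≤ (n : ℝ) ^ (1 / 4 : ℝ) * (n : ℝ) ^ (1 / 4 : ℝ) / n := by gcongr
        _ = Real.exp (-L / 2) := by
            rw [hrp]; nth_rewrite 1 [hnL]; rw [← Real.exp_add, ← Real.exp_sub]; congr 1; ring
    calc _ ≤ (Real.exp (-L / 2)) ^ (2 ^ b) := by gcongr
      _ = Real.exp ((2 : ℝ) ^ b * (-L / 2)) := by rw [← Real.exp_nat_mul]; push_cast; rfl
      _ ≤ _ := by
          rw [Real.exp_le_exp]
          rw [pow_succ] at hb'
          have := mul_le_mul_of_nonneg_right (by linarith : L / 2 ≤ (2 : ℝ) ^ b) (by linarith : 0 ≤ L / 2)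
          linarith [(by ring : L / 2 * (L / 2) = L ^ 2 / 4)]
  linarith

end GS

open MeasureTheory ProbabilityTheory
namespace GS

lemma sigma_le {ℓ n : ℕ} (hℓ : 3 ≤ ℓ) (hn : 1 ≤ n) {lam p : ℝ} (hl : 0 < lam) (h0 : 0 < p) (h1 : p < 1)
    {ℋ : Finset (SimpleGraph (Fin ℓ))} {Δ : SimpleGraph (Fin ℓ) → ℝ}
    (hu : ∀ G₁ ∈ ℋ, ∀ G₂ ∈ ℋ, Nonempty (G₁ ≃g G₂) → G₁ = G₂)
    (hΔ : ∀ G ∈ ℋ, |Δ G| ≤ 1 / lam) :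
    ∫ x, (graphStatPart ℓ ℋ Δ p 3 x -
          ∫ y, graphStatPart ℓ ℋ Δ p 3 y ∂(gnp n p)) ^ 2 ∂(gnp n p) ≤
      2 ^ ℓ ^ 2 / lam ^ 2 * (n : ℝ) ^ (2 * ℓ - 3) := by
  classical
  unfold gnp
  set c := ∫ y, graphStatPart ℓ ℋ Δ p 3 y ∂(bernoulliPi (Sym2 (Fin n)) p) with hc
  rw [integral_bernoulliPi h0.le h1.le]
  rw [integral_bernoulliPi h0.le h1.le] at hc
  set F : (Sym2 (Fin n) → Bool) → ℝ := fun x => graphStatPart ℓ ℋ Δ p 3 x with hF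
  have hvar : Ex p (fun x => (F x - c) ^ 2) = Ex p (fun x => F x ^ 2) - c ^ 2 := by
    have : (fun x => (F x - c) ^ 2) = fun x => F x ^ 2 + ((-2 * c) * F x + c ^ 2) := by
      funext x; ring
    rw [this, Ex_add, Ex_add, Ex_mul_left, Ex_const, ← hc]; ring
  set q := coef n (ℋ.filter fun G => Nat.card G.support = 3) Δ with hq
  have hg : GoodCoef ℓ n lam q := goodCoef
    (fun G₁ h₁ G₂ h₂ h => hu _ (Finset.mem_filter.1 h₁).1 _ (Finset.mem_filter.1 h₂).1 h)
    (fun G hG => hΔ G (Finset.mem_filter.1 hG).1)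
  have hv : ∀ S, q S ≠ 0 → (vs S).card = 3 := by
    intro S hS
    obtain ⟨G, hG, f, hf⟩ := coef_ne hS
    rw [copy_vs_card hf]; exact (Finset.mem_filter.1 hG).2
  have hpar : Ex p (fun x => F x ^ 2) = ∑ S, q S ^ 2 := by
    rw [← parseval h0 h1 Finset.univ q id (Set.injOn_id _)]
    congr 1; funext x; rw [hF]; simp only [part_eq, id]; rfl
  have hcount : (Finset.univ.filter fun S => q S ≠ 0).card ≤ n ^ 3 * 2 ^ ℓ ^ 2 := by
    have := count_le (ℓ := ℓ) (fun f : Fin 3 → Fin n => Finset.univ.image f)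
      (fun f => Finset.card_image_le.trans (by simpa using hℓ)) (Finset.univ.filter fun S => q S ≠ 0) (by
        intro S hS
        have h3 := hv S (Finset.mem_filter.1 hS).2
        let e := (vs S).equivFinOfCardEq h3
        refine ⟨fun i => (e.symm i : Fin n), fun w hw => ?_⟩
        rw [Finset.mem_image]
        exact ⟨e ⟨w, hw⟩, Finset.mem_univ _, by simp⟩)
    simpa using this
  have hsum : ∑ S, q S ^ 2 ≤ 2 ^ ℓ ^ 2 / lam ^ 2 * (n : ℝ) ^ (2 * ℓ - 3) := by
    have e1 : ∑ S, q S ^ 2 = ∑ S ∈ Finset.univ.filter (fun S => q S ≠ 0), q S ^ 2 := by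
      rw [Finset.sum_filter]
      refine Finset.sum_congr rfl fun S _ => ?_
      split_ifs with h
      · rfl
      · rw [not_not.1 h]; norm_num
    rw [e1]
    have e2 : ∀ S ∈ Finset.univ.filter (fun S => q S ≠ 0), q S ^ 2 ≤ ((n : ℝ) ^ (ℓ - 3) / lam) ^ 2 := by
      intro S hS
      have hS' := (Finset.mem_filter.1 hS).2
      have := hg.bound S hS'
      rw [hv S hS'] at this
      rw [← sq_abs]
      exact pow_le_pow_left₀ (abs_nonneg _) this 2
    refine (Finset.sum_le_card_nsmul _ _ _ e2).trans ?_
    rw [nsmul_eq_mul]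
    calc _ ≤ ((n ^ 3 * 2 ^ ℓ ^ 2 : ℕ) : ℝ) * ((n : ℝ) ^ (ℓ - 3) / lam) ^ 2 := by gcongr
      _ = _ := by
        obtain ⟨j, rfl⟩ := Nat.exists_eq_add_of_le hℓ
        have e1 : 2 * (3 + j) - 3 = 2 * j + 3 := by omega
        have e2 : 3 + j - 3 = j := by omega
        rw [e1, e2]; push_cast; field_simp; ring
  change Ex p (fun x => (F x - c) ^ 2) ≤ _
  rw [hvar, hpar]
  linarith [sq_nonneg c]

end GS

open MeasureTheory ProbabilityTheory
namespace GS
open Filter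

lemma transfer {ℓ n m : ℕ} {p lam s Z : ℝ} (hp : p = (m : ℝ) / (n.choose 2)) (h0 : 0 < p) (h1 : p < 1)
    {cf : Finset (Sym2 (Fin n)) → ℝ} (hg : GoodCoef ℓ n lam cf) (F : (Sym2 (Fin n) → Bool) → ℝ)
    (hF : ∀ x, F x = ∑ S, (s * cf S) * mon p S x)
    (hZ : ∀ g : Sym2 (Fin n) → Bool → ℝ,
      ‖Ex p (fun x => ee (∑ e, g e (x e) + ∑ S, (s * cf S) * mon p S x))‖ ≤ Z) :
    ‖∫ x, Complex.exp (Complex.I * Complex.ofReal (F x)) ∂(gnm n m)‖ ≤ ((n.choose 2 : ℝ) + 1) * Z := by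
  classical
  refine slice_transfer hp h0 h1 (fun x => ee (F x)) ?_ ?_
  · intro x y hxy
    have : F x = F y := by
      rw [hF, hF]
      refine Finset.sum_congr rfl fun S _ => ?_
      by_cases hS : cf S = 0
      · simp [hS]
      · rw [mon_dep S x y fun e he => hxy e (hg.nodiag S hS e he)]
    simp only [this]
  · intro θ
    have := hZ (fun e b => θ * (if ¬ e.IsDiag ∧ b = true then 1 else 0))
    have e : (fun x => ee (θ * cnt x) * ee (F x)) = fun x : Sym2 (Fin n) → Bool =>
        ee (∑ e : Sym2 (Fin n), θ * (if ¬ e.IsDiag ∧ x e = true then (1 : ℝ) else 0) + ∑ S, (s * cf S) * mon p S x) := by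
      funext x
      rw [← ee_add, cnt_eq, hF, Finset.mul_sum]
    rw [e]
    exact this

lemma triv_bound {ℓ n m : ℕ} {p lam s : ℝ} (hp : p = (m : ℝ) / (n.choose 2)) (h0 : 0 < p) (h1 : p < 1)
    {cf : Finset (Sym2 (Fin n)) → ℝ} (hg : GoodCoef ℓ n lam cf) (F : (Sym2 (Fin n) → Bool) → ℝ)
    (hF : ∀ x, F x = ∑ S, (s * cf S) * mon p S x) :
    ‖∫ x, Complex.exp (Complex.I * Complex.ofReal (F x)) ∂(gnm n m)‖ ≤ ((n.choose 2 : ℝ) + 1) * 1 := by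
  refine transfer hp h0 h1 hg F hF fun g => ?_
  refine (Ex_norm_le h0.le h1.le _).trans ?_
  simp only [ee_norm]
  rw [Ex_const]

lemma large (ℓ : ℕ) (hℓ : 3 ≤ ℓ) {lam ε : ℝ} (hl : 0 < lam) (hl1 : lam < 1 / 2) (hε : 0 < ε)
    (hε4 : ε ≤ 1 / 4) : ∀ᶠ n : ℕ in atTop, ∀ p : ℝ, lam < p → p < 1 - lam →
      ∀ ℋ ℋ' : Finset (SimpleGraph (Fin ℓ)), ∀ Δ : SimpleGraph (Fin ℓ) → ℝ,
        IsFactorSystem ℓ lam ℋ ℋ' Δ → ∀ s : ℝ, |s| ≤ (n : ℝ) ^ (-ε) →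
        (n : ℝ) ^ (2 * ε) ≤ 2 ^ ℓ ^ 2 / lam ^ 2 * (s ^ 2 * (n : ℝ) ^ (2 * ℓ - 3)) →
        ∀ g : Sym2 (Fin n) → Bool → ℝ,
        ‖Ex p (fun x => ee (∑ e, g e (x e) + ∑ S, (s * coef n (rest ℋ) Δ S) * mon p S x))‖ ≤
          5 * Real.exp (-(Real.log n) ^ 2 / (4 * 2 ^ ℓ ^ 2)) := by
  set δ : ℝ := ε / ℓ with hδd
  have hlr : (0 : ℝ) < ℓ := by exact_mod_cast (by omega : 0 < ℓ)
  have hδ : 0 < δ := by positivity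
  set A : ℝ := 256 * (3 + 1 / lam) ^ (2 * ℓ ^ 2) * (4 ^ ℓ ^ 2 / lam ^ 2) with hA
  have hlam2 : lam ^ 2 ≤ 1 := pow_le_one₀ hl.le (by linarith)
  have hA1 : 1 ≤ A := by
    have a1 : (1 : ℝ) ≤ (3 + 1 / lam) ^ (2 * ℓ ^ 2) :=
      one_le_pow₀ (by have : 0 < 1 / lam := by positivity
                      linarith)
    have a2 : (1 : ℝ) ≤ 4 ^ ℓ ^ 2 / lam ^ 2 := by
      rw [le_div_iff₀ (by positivity), one_mul]
      exact hlam2.trans (one_le_pow₀ (by norm_num))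
    have a3 : (1 : ℝ) ≤ 256 * (3 + 1 / lam) ^ (2 * ℓ ^ 2) := by linarith
    rw [hA]
    exact one_le_mul_of_one_le_of_one_le a3 a2
  have hA0 : 0 < A := by linarith
  set y0 : ℝ := 1 / A with hy0d
  have hy0 : 0 < y0 := by positivity
  have hy01 : y0 ≤ 1 := by rw [hy0d, div_le_one hA0]; exact hA1
  set D : ℝ := 2 ^ ℓ ^ 2 / lam ^ 2 with hD
  have hD1 : 1 ≤ D := by
    rw [hD, le_div_iff₀ (by positivity), one_mul]
    exact hlam2.trans (one_le_pow₀ (by norm_num))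
  filter_upwards [psi_bound ℓ hl hl1 (by positivity : 0 < y0 / 2 ^ ℓ) hδ, ev_log_ge 1,
    ev_rpow_ge hδ 1, ev_rpow_ge hε ((ℓ : ℝ) ^ ℓ * D), ev_rpow_ge hε A, eventually_ge_atTop 1]
    with n hpsi hL1 hnδ hbig hnA hn
  intro p h0 h1 ℋ ℋ' Δ hfs s hs hs1 g
  obtain ⟨hsub, hu, hex, hΔ, hΔ'⟩ := hfs
  have hnr : (1 : ℝ) ≤ n := by exact_mod_cast hn
  have hn0 : (0 : ℝ) < n := by linarith
  set M := ⌊(n : ℝ) ^ δ⌋₊ with hM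
  have hM1 : 1 ≤ M := (Nat.one_le_floor_iff _).2 hnδ
  have hM1r : (1 : ℝ) ≤ M := by exact_mod_cast hM1
  have hMle : (M : ℝ) ≤ (n : ℝ) ^ δ := Nat.floor_le (by positivity)
  have hMge : (n : ℝ) ^ δ / 2 ≤ M := by
    have := Nat.lt_floor_add_one ((n : ℝ) ^ δ)
    rw [← hM] at this; linarith
  have hMl : (M : ℝ) ^ ℓ ≤ (n : ℝ) ^ ε := by
    calc (M : ℝ) ^ ℓ ≤ ((n : ℝ) ^ δ) ^ ℓ := by gcongr
      _ = (n : ℝ) ^ ε := by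
        rw [← Real.rpow_natCast, ← Real.rpow_mul hn0.le, hδd, div_mul_cancel₀ _ hlr.ne']
  have hMl4 : (M : ℝ) ^ ℓ ≤ (n : ℝ) ^ (1 / 4 : ℝ) :=
    hMl.trans (Real.rpow_le_rpow_of_exponent_le hnr hε4)
  have hnε1 : (n : ℝ) ^ (-ε) ≤ 1 := Real.rpow_le_one_of_one_le_of_nonpos hnr (by linarith)
  have hyn : ((n : ℝ) ^ (-ε)) ^ 2 ≤ y0 := by
    have e1 : (n : ℝ) ^ (-ε) ≤ y0 := by
      rw [Real.rpow_neg hn0.le, hy0d, one_div]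
      exact inv_anti₀ hA0 hnA
    have e2 : 0 ≤ (n : ℝ) ^ (-ε) := by positivity
    calc ((n : ℝ) ^ (-ε)) ^ 2 ≤ (n : ℝ) ^ (-ε) := pow_le_of_le_one e2 hnε1 (by norm_num)
      _ ≤ y0 := e1
  obtain ⟨k, u, hk3, hkl, hu1, hMu, hyle, hyge⟩ :=
    params hℓ hD1 hy0 hy01 hε hε4 hn hM1 hMl hs hs1 hbig hyn
  obtain ⟨H, hH, hconn, hHk⟩ := hex k hk3 hkl
  have hHr : H ∈ rest ℋ := by
    unfold rest
    rw [Finset.mem_filter]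
    exact ⟨hsub hH, by omega, by omega⟩
  have hur : ∀ G₁ ∈ rest ℋ, ∀ G₂ ∈ rest ℋ, Nonempty (G₁ ≃g G₂) → G₁ = G₂ :=
    fun G₁ h₁ G₂ h₂ h => hu _ (Finset.mem_filter.1 h₁).1 _ (Finset.mem_filter.1 h₂).1 h
  have hg : GoodCoef ℓ n lam (coef n (rest ℋ) Δ) := goodCoef hur
    (fun G hG => hΔ G (Finset.mem_filter.1 hG).1)
  have hHc : ∀ S, Copy H S → lam * (n : ℝ) ^ (ℓ - k) ≤ |coef n (rest ℋ) Δ S| := by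
    intro S hS
    rw [coef_eq Δ hur hHr hS, hHk, abs_mul, abs_of_nonneg (by positivity), mul_comm]
    exact mul_le_mul_of_nonneg_left (hΔ' H hH) (by positivity)
  obtain ⟨b, hb, hb'⟩ := exists_nat_pow_near hL1 (by norm_num : (1 : ℝ) < 2)
  have hyy : 256 * (3 + 1 / lam) ^ (2 * ℓ ^ 2) * (4 ^ ℓ ^ 2 / lam ^ 2 *
      ((u : ℝ) ^ k * (s * (n : ℝ) ^ (ℓ - k)) ^ 2)) ≤ 1 := by
    rw [← mul_assoc, ← hA]
    calc _ ≤ A * y0 := by gcongr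
      _ = 1 := by rw [hy0d]; field_simp
  have hcore := core hl hl1 h0 h1 hn hM1 hu1 hMu H hconn hHk hk3 _ hg hHc (hs.trans hnε1) rfl hyy g b
  have hfin := hcore.trans (hpsi M b _ hMge hMl4 hyge (hyle.trans hy01) hb hb')
  refine le_of_pow_le_pow_left₀ (by positivity : 2 ^ ℓ ^ 2 ≠ 0) (by positivity) (hfin.trans ?_)
  rw [mul_pow, ← Real.exp_nat_mul]
  have e5 : (5 : ℝ) ≤ 5 ^ 2 ^ ℓ ^ 2 := le_self_pow₀ (by norm_num) (by positivity)
  have ee' : ((2 ^ ℓ ^ 2 : ℕ) : ℝ) * (-(Real.log n) ^ 2 / (4 * 2 ^ ℓ ^ 2)) = -(Real.log n) ^ 2 / 4 := by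
    push_cast; field_simp
  rw [ee']
  gcongr

end GS

theorem graph_stat_char_fun_medium_range
    (ℓ : ℕ) (hℓ : 3 ≤ ℓ) (lam : ℝ) (hlam : lam ∈ Set.Ioo (0 : ℝ) (1 / 2))
    (ε : ℝ) (hε : 0 < ε) :
    ∃ c C : ℝ, 0 < c ∧ 0 < C ∧ ∀ n : ℕ, 3 ≤ n → ∀ m : ℕ,
      (m : ℝ) / (n.choose 2) ∈ Set.Ioo lam (1 - lam) →
      ∀ ℋ ℋ' : Finset (SimpleGraph (Fin ℓ)), ∀ Δ : SimpleGraph (Fin ℓ) → ℝ,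
        IsFactorSystem ℓ lam ℋ ℋ' Δ →
        let p : ℝ := (m : ℝ) / (n.choose 2)
        let σ := Real.sqrt (∫ x, (graphStatPart ℓ ℋ Δ p 3 x -
          ∫ y, graphStatPart ℓ ℋ Δ p 3 y ∂(gnp n p)) ^ 2 ∂(gnp n p))
        let K : (Sym2 (Fin n) → Bool) → ℝ := fun x =>
          (graphStat ℓ ℋ Δ p x - graphStatPart ℓ ℋ Δ p 0 x - graphStatPart ℓ ℋ Δ p 2 x) / σ
        ∀ t : ℝ, (n : ℝ) ^ ε ≤ |t| → |t| ≤ σ * (n : ℝ) ^ (-ε) →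
          ‖(∫ x, Complex.exp (Complex.I * Complex.ofReal (t * K x)) ∂(gnm n m)) -
              Complex.ofReal (Real.exp (-(t ^ 2) / 2))‖
            ≤ C * (n : ℝ) ^ (-(c * Real.log (Real.log n))) := by
  obtain ⟨hl, hl1⟩ := hlam
  set ε' : ℝ := min ε (1 / 4) with hε'
  have hε'0 : 0 < ε' := lt_min hε (by norm_num)
  have hε'4 : ε' ≤ 1 / 4 := min_le_right _ _
  have hε'ε : ε' ≤ ε := min_le_left _ _
  set c : ℝ := 1 / (8 * 2 ^ ℓ ^ 2) with hc
  have hc0 : 0 < c := by positivity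
  obtain ⟨n0, hn0⟩ := Filter.eventually_atTop.1 ((GS.large ℓ hℓ hl hl1 hε'0 hε'4).and
    ((GS.ev_log_ge (2 / c)).and (GS.ev_log_pow 2 (by positivity : 0 < 2 * ε')
      (by positivity : 0 < 2 * c))))
  set n1 : ℕ := n0 + 3 with hn1
  have hlogn1 : 0 ≤ Real.log n1 := Real.log_natCast_nonneg _
  set C : ℝ := 6 + (((n1 : ℝ)) ^ 2 + 1) * Real.exp (c * Real.log n1 ^ 2) with hC
  have hC0 : 0 < C := by positivity
  refine ⟨c, C, hc0, hC0, ?_⟩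
  intro n hn m hm ℋ ℋ' Δ hfs p σ K t ht1 ht2
  obtain ⟨hpl, hpu⟩ := hm
  have hp0 : 0 < p := hl.trans hpl
  have hp1 : p < 1 := lt_of_lt_of_le hpu (by linarith)
  have hn3 : (3 : ℝ) ≤ n := by exact_mod_cast hn
  have hnr : (1 : ℝ) ≤ n := by linarith
  have hnpos : (0 : ℝ) < n := by linarith
  set L := Real.log n with hL
  have hnL : (n : ℝ) = Real.exp L := (Real.exp_log hnpos).symm
  have hLpos : 0 < L := Real.log_pos (by linarith)
  -- reduce the target
  suffices hmain : ‖(∫ x, Complex.exp (Complex.I * Complex.ofReal (t * K x)) ∂(gnm n m)) -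
              Complex.ofReal (Real.exp (-(t ^ 2) / 2))‖ ≤ C * Real.exp (-(c * L ^ 2)) by
    refine hmain.trans (mul_le_mul_of_nonneg_left ?_ hC0.le)
    rw [Real.rpow_def_of_pos hnpos, ← hL, Real.exp_le_exp]
    have h1 : Real.log L ≤ L := (Real.log_le_sub_one_of_pos hLpos).trans (by linarith)
    have h2 : L * (c * Real.log L) ≤ L * (c * L) := by gcongr
    linarith [(by ring : L * (c * L) = c * L ^ 2)]
  have htpos : 0 < |t| := lt_of_lt_of_le (Real.rpow_pos_of_pos hnpos _) ht1
  have hσ0 : 0 < σ := by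
    by_contra h
    have : σ = 0 := le_antisymm (not_lt.1 h) (Real.sqrt_nonneg _)
    rw [this] at ht2
    linarith
  set s : ℝ := t / σ with hs
  have hfs' := hfs
  obtain ⟨hsub, hu, hex, hΔ, hΔ'⟩ := hfs'
  have hg : GS.GoodCoef ℓ n lam (GS.coef n (GS.rest ℋ) Δ) := GS.goodCoef
    (fun G₁ h₁ G₂ h₂ h => hu _ (Finset.mem_filter.1 h₁).1 _ (Finset.mem_filter.1 h₂).1 h)
    (fun G hG => hΔ G (Finset.mem_filter.1 hG).1)
  have hF : ∀ x, t * K x = ∑ S, (s * GS.coef n (GS.rest ℋ) Δ S) * GS.mon p S x := by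
    intro x
    change t * ((graphStat ℓ ℋ Δ p x - graphStatPart ℓ ℋ Δ p 0 x - graphStatPart ℓ ℋ Δ p 2 x) / σ) = _
    rw [GS.stat_sub]
    simp only [mul_assoc]
    rw [← Finset.mul_sum, hs]
    ring
  have hN : ((n.choose 2 : ℕ) : ℝ) + 1 ≤ (n : ℝ) ^ 2 := by
    rw [Nat.cast_choose_two]; nlinarith
  have hgauss : ‖Complex.ofReal (Real.exp (-(t ^ 2) / 2))‖ = Real.exp (-(t ^ 2) / 2) := by
    rw [Complex.norm_real, Real.norm_of_nonneg (Real.exp_pos _).le]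
  refine (norm_sub_le _ _).trans ?_
  rw [hgauss]
  rcases lt_or_ge n n1 with hsmall | hbig
  · have h1 := GS.triv_bound (m := m) rfl hp0 hp1 hg (fun x => t * K x) hF
    rw [mul_one] at h1
    have h2 : Real.exp (-(t ^ 2) / 2) ≤ 1 := by
      rw [Real.exp_le_one_iff]; linarith [sq_nonneg t]
    have hnn : (n : ℝ) ≤ n1 := by exact_mod_cast hsmall.le
    have hLL : L ≤ Real.log n1 := Real.log_le_log hnpos hnn
    have h3 : 1 ≤ Real.exp (c * Real.log n1 ^ 2) * Real.exp (-(c * L ^ 2)) := by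
      rw [← Real.exp_add, Real.one_le_exp_iff]
      have : c * L ^ 2 ≤ c * Real.log n1 ^ 2 := by gcongr
      linarith
    calc _ ≤ (n : ℝ) ^ 2 + 1 := by
          refine add_le_add (h1.trans hN) h2
      _ ≤ ((n1 : ℝ) ^ 2 + 1) * 1 := by rw [mul_one]; gcongr
      _ ≤ ((n1 : ℝ) ^ 2 + 1) * (Real.exp (c * Real.log n1 ^ 2) * Real.exp (-(c * L ^ 2))) := by gcongr
      _ = ((n1 : ℝ) ^ 2 + 1) * Real.exp (c * Real.log n1 ^ 2) * Real.exp (-(c * L ^ 2)) := by ring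
      _ ≤ C * Real.exp (-(c * L ^ 2)) := by
          gcongr; rw [hC]; linarith
  · obtain ⟨hlarge, hL2, hL3⟩ := hn0 n (by omega)
    rw [← hL] at hL2 hL3
    have hs1 : |s| ≤ (n : ℝ) ^ (-ε') := by
      rw [hs, abs_div, abs_of_pos hσ0, div_le_iff₀ hσ0, mul_comm]
      refine ht2.trans (mul_le_mul_of_nonneg_left ?_ hσ0.le)
      exact Real.rpow_le_rpow_of_exponent_le hnr (by linarith)
    have ht3 : (n : ℝ) ^ (2 * ε') ≤ t ^ 2 := by
      have e1 : (n : ℝ) ^ ε' ≤ |t| := (Real.rpow_le_rpow_of_exponent_le hnr hε'ε).trans ht1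
      have e2 : (n : ℝ) ^ (2 * ε') = ((n : ℝ) ^ ε') ^ 2 := by
        rw [← Real.rpow_natCast, ← Real.rpow_mul hnpos.le]; congr 1; push_cast; ring
      rw [e2, ← sq_abs t]
      exact pow_le_pow_left₀ (by positivity) e1 2
    have hσsq : σ ^ 2 ≤ 2 ^ ℓ ^ 2 / lam ^ 2 * (n : ℝ) ^ (2 * ℓ - 3) := by
      have e : σ ^ 2 = ∫ x, (graphStatPart ℓ ℋ Δ p 3 x -
          ∫ y, graphStatPart ℓ ℋ Δ p 3 y ∂(gnp n p)) ^ 2 ∂(gnp n p) :=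
        Real.sq_sqrt (integral_nonneg fun x => sq_nonneg _)
      rw [e]
      exact GS.sigma_le hℓ (by omega) hl hp0 hp1 hu hΔ
    have hs2 : (n : ℝ) ^ (2 * ε') ≤ 2 ^ ℓ ^ 2 / lam ^ 2 * (s ^ 2 * (n : ℝ) ^ (2 * ℓ - 3)) := by
      calc (n : ℝ) ^ (2 * ε') ≤ t ^ 2 := ht3
        _ = s ^ 2 * σ ^ 2 := by rw [hs]; field_simp
        _ ≤ s ^ 2 * (2 ^ ℓ ^ 2 / lam ^ 2 * (n : ℝ) ^ (2 * ℓ - 3)) := by gcongr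
        _ = _ := by ring
    have h1 := GS.transfer (m := m) rfl hp0 hp1 hg (fun x => t * K x) hF
      (hlarge p hpl hpu ℋ ℋ' Δ hfs s hs1 hs2)
    have h2 : Real.exp (-(t ^ 2) / 2) ≤ Real.exp (-(c * L ^ 2)) := by
      rw [Real.exp_le_exp]; linarith
    have h3 : (((n.choose 2 : ℕ) : ℝ) + 1) * (5 * Real.exp (-L ^ 2 / (4 * 2 ^ ℓ ^ 2))) ≤
        5 * Real.exp (-(c * L ^ 2)) := by
      calc _ ≤ (n : ℝ) ^ 2 * (5 * Real.exp (-L ^ 2 / (4 * 2 ^ ℓ ^ 2))) := by gcongr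
        _ = 5 * Real.exp (2 * L + -L ^ 2 / (4 * 2 ^ ℓ ^ 2)) := by
            rw [hnL, ← Real.exp_nat_mul, Real.exp_add]; push_cast; ring
        _ ≤ _ := by
            gcongr
            have e1 : -L ^ 2 / (4 * 2 ^ ℓ ^ 2) = - (2 * c) * L ^ 2 := by
              rw [hc]; field_simp; norm_num
            rw [e1]
            have e2 : 2 ≤ L * c := by rwa [div_le_iff₀ hc0] at hL2
            have e3 := mul_le_mul_of_nonneg_right e2 hLpos.le
            linarith [(by ring : L * c * L = c * L ^ 2)]
    calc _ ≤ 5 * Real.exp (-(c * L ^ 2)) + Real.exp (-(c * L ^ 2)) := add_le_add (h1.trans h3) h2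
      _ = 6 * Real.exp (-(c * L ^ 2)) := by ring
      _ ≤ C * Real.exp (-(c * L ^ 2)) := by
          gcongr; rw [hC]
          have : 0 ≤ (((n1 : ℝ)) ^ 2 + 1) * Real.exp (c * Real.log n1 ^ 2) := by positivity
          linarith
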